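/- arXiv:1603.03855 — 2 statements merged into one kernel-verified Lean document; each statement's English description precedes it below -/
import Mathlib

section
/- Let G be a connected subcubic graph on n vertices and m edges with girth at least 4. Then one of the following holds: (a) G is isomorphic to Q_3 or V_8, and φ(G) = (2/9)m + 1/3; (b) G is obtained from a disjoint union of copies of L by adding edges such that each added edge is a cut-edge of G, and φ(G) = (2/9)m + 2/9; (c) G is obtained from a disjoint union of one member of F_{3,2} ∪ F_{4,0} and copies of L by adding edges such that each added edge is a cut-edge of G, and φ(G) = (2/9)m + 1/9; (d) φ(G) ≤ (2/9)m. -/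
open SimpleGraph

namespace InducedForest

/-- A graph is subcubic if every vertex has at most 3 neighbours. -/
def Subcubic {V : Type} (G : SimpleGraph V) : Prop := ∀ v : V, (G.neighborSet v).ncard ≤ 3

/-- A graph is cubic if every vertex has exactly 3 neighbours. -/
def Cubic {V : Type} (G : SimpleGraph V) : Prop := ∀ v : V, (G.neighborSet v).ncard = 3

/-- `S` is a feedback vertex set of `G` iff `G - S` is a forest. -/
def IsFVS {V : Type} (G : SimpleGraph V) (S : Set V) : Prop := (G.induce Sᶜ).IsAcyclic

/-- `φ(G)`: the minimum size of a feedback vertex set of `G`. -/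
noncomputable def fvs {V : Type} (G : SimpleGraph V) : ℕ :=
  sInf {n : ℕ | ∃ S : Set V, IsFVS G S ∧ S.ncard = n}

/-- `a(G)`: the maximum number of vertices of an induced forest in `G`. -/
noncomputable def indForestNum {V : Type} (G : SimpleGraph V) : ℕ :=
  sSup {n : ℕ | ∃ S : Set V, (G.induce S).IsAcyclic ∧ S.ncard = n}

/-- `v` is a cut-vertex of `G`: deleting it increases the number of connected components. -/
def IsCutVertex {V : Type} (G : SimpleGraph V) (v : V) : Prop :=
  Nat.card G.ConnectedComponent < Nat.card (G.induce {u | u ≠ v}).ConnectedComponent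

/-- `B` is a block of `G`: a maximal set of vertices inducing a connected subgraph
without cut-vertices. -/
def IsBlock {V : Type} (G : SimpleGraph V) (B : Set V) : Prop :=
  ((G.induce B).Connected ∧ ∀ v, ¬ IsCutVertex (G.induce B) v) ∧
  ∀ B' : Set V, B ⊆ B' →
    ((G.induce B').Connected ∧ ∀ v, ¬ IsCutVertex (G.induce B') v) → B' = B

/-- 2-connectedness: at least 3 vertices and removing fewer than 2 vertices
leaves a connected graph. -/
def TwoConnected {V : Type} (G : SimpleGraph V) : Prop :=
  3 ≤ Nat.card V ∧ ∀ s : Set V, s.ncard < 2 → (G.induce sᶜ).Connected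

/-- 3-connectedness: at least 4 vertices and removing fewer than 3 vertices
leaves a connected graph. -/
def ThreeConnected {V : Type} (G : SimpleGraph V) : Prop :=
  4 ≤ Nat.card V ∧ ∀ s : Set V, s.ncard < 3 → (G.induce sᶜ).Connected

/-- The graph obtained from `H` by subdividing the edge `xy` once;
the subdivision vertex is `none`. -/
def subdivide {V : Type} (H : SimpleGraph V) (x y : V) : SimpleGraph (Option V) :=
  SimpleGraph.fromRel (fun p q =>
    match p, q with
    | some u, some v => H.Adj u v ∧ s(u, v) ≠ s(x, y)
    | some u, none => u = x ∨ u = y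
    | _, _ => False)

/-- `G` is obtained from `H` by subdividing one edge once. -/
def IsSubdivisionOfOneEdge {V W : Type} (H : SimpleGraph V) (G : SimpleGraph W) : Prop :=
  ∃ x y : V, H.Adj x y ∧ Nonempty (G ≃g subdivide H x y)

/-- The graph obtained from `K` by adding one new vertex (`none`)
joined to all vertices of `S`. -/
def addApex {V : Type} (K : SimpleGraph V) (S : Set V) : SimpleGraph (Option V) :=
  SimpleGraph.fromRel (fun p q =>
    match p, q with
    | some u, some v => K.Adj u v
    | some u, none => u ∈ S
    | _, _ => False)

/-- `G` is (isomorphic to) `H ∘ (e1, e2, a)`: subdivide `e1` and `e2` once each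
(with `e1` subdivided twice if `e1 = e2`) and add a new vertex adjacent to `a` and to the
two subdivision vertices. -/
def IsCircOp {V W : Type} (H : SimpleGraph V) (e1 e2 : Sym2 V) (a : V)
    (G : SimpleGraph W) : Prop :=
  (e1 ≠ e2 ∧ ∃ x1 y1 x2 y2 : V, e1 = s(x1, y1) ∧ e2 = s(x2, y2) ∧
    Nonempty (G ≃g addApex (subdivide (subdivide H x1 y1) (some x2) (some y2))
      {some (some a), some none, none})) ∨
  (e1 = e2 ∧ ∃ x y : V, e1 = s(x, y) ∧
    Nonempty (G ≃g addApex (subdivide (subdivide H x y) none (some y))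
      {some (some a), some none, none}))

/-- The cycle of length `n` (for `n ≥ 3`). -/
def cyc (n : ℕ) : SimpleGraph (ZMod n) :=
  SimpleGraph.fromRel (fun u v => v = u + 1)

/-- The families `F_{i,j}` of graphs (closed under isomorphism):
`F_{i,0} = {C_i}` for `i ≥ 3`; `F_{1,1} = {K_4}`; `F_{j,j}` for `j ≥ 2` is obtained from
`F_{j-1,j-1}` by subdividing one edge once and then applying the `∘` operation at the
subdivision vertex; and `F_{i,j}` for `i > j ≥ 1` is obtained from `F_{j,j}` by `i - j`
successive single-edge subdivisions. -/
inductive MemF : ℕ → ℕ → ∀ {V : Type}, SimpleGraph V → Prop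
  | cycle {i : ℕ} (hi : 3 ≤ i) {V : Type} {G : SimpleGraph V}
      (h : Nonempty (G ≃g cyc i)) : MemF i 0 G
  | k4 {V : Type} {G : SimpleGraph V}
      (h : Nonempty (G ≃g (⊤ : SimpleGraph (Fin 4)))) : MemF 1 1 G
  | circ {j : ℕ} (hj : 2 ≤ j) {V : Type} {H : SimpleGraph V}
      (hH : MemF (j - 1) (j - 1) H) {x y : V} (hxy : H.Adj x y)
      {e1 e2 : Sym2 (Option V)} (he1 : e1 ∈ (subdivide H x y).edgeSet)
      (he2 : e2 ∈ (subdivide H x y).edgeSet)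
      {W : Type} {G : SimpleGraph W}
      (hG : IsCircOp (subdivide H x y) e1 e2 none G) : MemF j j G
  | subd {i j : ℕ} (hj : 1 ≤ j) {V : Type} {H : SimpleGraph V}
      (hH : MemF i j H) {x y : V} (hxy : H.Adj x y) {W : Type} {G : SimpleGraph W}
      (hG : Nonempty (G ≃g subdivide H x y)) : MemF (i + 1) j G

/-- `K_4^+`: the graph obtained from `K_4` by subdividing one edge once. -/
def K4plus : SimpleGraph (Option (Fin 4)) :=
  subdivide (⊤ : SimpleGraph (Fin 4)) 0 1

/-- `L`: the graph obtained from `K_4` by subdividing once each edge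
of a perfect matching. -/
def Lgraph : SimpleGraph (Option (Option (Fin 4))) :=
  subdivide (subdivide (⊤ : SimpleGraph (Fin 4)) 0 1) (some 2) (some 3)

/-- The Petersen graph. -/
def petersen : SimpleGraph (ZMod 5 × Fin 2) :=
  SimpleGraph.fromRel (fun u v =>
    (u.2 = 0 ∧ v.2 = 0 ∧ v.1 = u.1 + 1) ∨
    (u.2 = 1 ∧ v.2 = 1 ∧ v.1 = u.1 + 2) ∨
    (u.2 = 0 ∧ v.2 = 1 ∧ u.1 = v.1))

/-- `R`: the Petersen graph minus one edge. -/
def Rgraph : SimpleGraph (ZMod 5 × Fin 2) :=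
  petersen.deleteEdges {s(((0 : ZMod 5), (0 : Fin 2)), ((1 : ZMod 5), (0 : Fin 2)))}

/-- `Q_3`: the 3-dimensional cube graph. -/
def Q3 : SimpleGraph (Fin 2 × Fin 2 × Fin 2) :=
  SimpleGraph.fromRel (fun u v =>
    (u.1 ≠ v.1 ∧ u.2 = v.2) ∨ (u.1 = v.1 ∧ u.2.1 ≠ v.2.1 ∧ u.2.2 = v.2.2) ∨
    (u.1 = v.1 ∧ u.2.1 = v.2.1 ∧ u.2.2 ≠ v.2.2))

/-- `V_8`: the Wagner graph. -/
def V8 : SimpleGraph (ZMod 8) :=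
  SimpleGraph.fromRel (fun u v => v = u + 1 ∨ v = u + 4)

/-- The dodecahedron, presented as the generalized Petersen graph `GP(10,2)`. -/
def dodecahedron : SimpleGraph (ZMod 10 × Fin 2) :=
  SimpleGraph.fromRel (fun u v =>
    (u.2 = 0 ∧ v.2 = 0 ∧ v.1 = u.1 + 1) ∨
    (u.2 = 1 ∧ v.2 = 1 ∧ v.1 = u.1 + 2) ∨
    (u.2 = 0 ∧ v.2 = 1 ∧ u.1 = v.1))

/-- The families `F^g_{i,j,k}`: 2-connected subcubic graphs obtained from the disjoint
union of `k` copies of `L` (when `g = 4`) or of `R` (when `g = 5`) and one member of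
`F_{i,j}` by adding `k+1` edges; when `k ≥ 1`, each added edge joins two different
constituent copies. -/
def MemFG (g i j k : ℕ) {W : Type} (G : SimpleGraph W) : Prop :=
  TwoConnected G ∧ Subcubic G ∧
  ∃ (P : W → Fin (k + 1)) (H : SimpleGraph W),
    H ≤ G ∧ (∀ u v, H.Adj u v → P u = P v) ∧
    MemF i j (H.induce (P ⁻¹' {0})) ∧
    ((g = 4 ∧ ∀ l : Fin (k + 1), l ≠ 0 → Nonempty ((H.induce (P ⁻¹' {l})) ≃g Lgraph)) ∨
     (g = 5 ∧ ∀ l : Fin (k + 1), l ≠ 0 → Nonempty ((H.induce (P ⁻¹' {l})) ≃g Rgraph))) ∧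
    (G.edgeSet \ H.edgeSet).ncard = k + 1 ∧
    (1 ≤ k → ∀ u v, G.Adj u v → ¬ H.Adj u v → P u ≠ P v)

/-- `t_4 = 2/9`, `t_5 = 1/5`. -/
noncomputable def tg (g : ℕ) : ℝ := if g = 4 then 2 / 9 else 1 / 5

/-- The error function `ε_g` on graphs. -/
noncomputable def eps (g : ℕ) {V : Type} (G : SimpleGraph V) : ℝ := by
  classical
  exact
    if h1 : ∃ p : ℕ × ℕ, 1 ≤ p.1 ∧ p.2 ≤ p.1 ∧ MemF p.1 p.2 G then
      max (1 - (h1.choose.2 : ℝ) * (5 * tg g - 1) - (h1.choose.1 : ℝ) * tg g) 0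
    else if h2 : ∃ q : ℕ × ℕ × ℕ, 1 ≤ q.1 ∧ q.2.1 ≤ q.1 ∧ MemFG g q.1 q.2.1 q.2.2 G then
      max (1 - tg g - (h2.choose.2.1 : ℝ) * (5 * tg g - 1) - (h2.choose.1 : ℝ) * tg g) 0
    else if Nonempty (G ≃g (⊤ : SimpleGraph (Fin 2))) then -tg g
    else 0

/-- The error function `r_g(G)`: the sum of `ε_g(B)` over all blocks `B` of `G`. -/
noncomputable def rg (g : ℕ) {V : Type} (G : SimpleGraph V) : ℝ :=
  ∑ᶠ B ∈ {B : Set V | IsBlock G B}, eps g (G.induce B)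

/-- `G` has two vertex-disjoint cycles, each of length less than `g`. -/
def TwoDisjointCyclesLt {V : Type} (G : SimpleGraph V) (g : ℕ) : Prop :=
  ∃ (u v : V) (c1 : G.Walk u u) (c2 : G.Walk v v), c1.IsCycle ∧ c2.IsCycle ∧
    c1.length < g ∧ c2.length < g ∧ ∀ x, x ∈ c1.support → x ∉ c2.support

/-- `G` contains a (not necessarily induced) subgraph isomorphic to `K`. -/
def ContainsSubgraphCopy {U V : Type} (K : SimpleGraph U) (G : SimpleGraph V) : Prop :=
  ∃ f : U → V, Function.Injective f ∧ ∀ u v, K.Adj u v → G.Adj (f u) (f v)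

/-- `G` is obtained from `H` by adding edges, each of which is a cut-edge of `G`. -/
def AddCutEdges {V : Type} (H G : SimpleGraph V) : Prop :=
  H ≤ G ∧ ∀ e ∈ G.edgeSet \ H.edgeSet, G.IsBridge e

/-- The edges of `H` all lie inside the parts of the partition given by `P`. -/
def PartitionedBy {V ι : Type} (H : SimpleGraph V) (P : V → ι) : Prop :=
  ∀ u v, H.Adj u v → P u = P v

/-- `G` is `g`-minimal: a minimum counterexample to the main theorem. -/
def GMinimal (g : ℕ) {V : Type} [Fintype V] (G : SimpleGraph V) : Prop :=
  Subcubic G ∧ ¬ TwoDisjointCyclesLt G g ∧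
  tg g * G.edgeSet.ncard + rg g G < (fvs G : ℝ) ∧
  ∀ (W : Type) [Fintype W] (H : SimpleGraph W), Nat.card W < Nat.card V →
    Subcubic H → ¬ TwoDisjointCyclesLt H g →
    (fvs H : ℝ) ≤ tg g * H.edgeSet.ncard + rg g H


section LinAlg

set_option linter.unusedSectionVars false
set_option linter.unusedVariables false

variable {E : Type} [AddCommGroup E] [Module ℝ E] [FiniteDimensional ℝ E]

/-- The radical of the bilinear form `Y` restricted to the subspace `W`. -/
def radOn (Y : E →ₗ[ℝ] E →ₗ[ℝ] ℝ) (W : Submodule ℝ E) : Submodule ℝ E where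
  carrier := {z | z ∈ W ∧ ∀ w ∈ W, Y z w = 0}
  add_mem' := by
    rintro a b ⟨ha, ha'⟩ ⟨hb, hb'⟩
    exact ⟨W.add_mem ha hb, fun w hw => by simp [ha' w hw, hb' w hw]⟩
  zero_mem' := ⟨W.zero_mem, fun w _ => by simp⟩
  smul_mem' := by
    rintro c a ⟨ha, ha'⟩
    exact ⟨W.smul_mem c ha, fun w hw => by simp [ha' w hw]⟩

/-- `dim W + dim rad W`. -/
noncomputable def numN (Y : E →ₗ[ℝ] E →ₗ[ℝ] ℝ) (W : Submodule ℝ E) : ℕ :=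
  Module.finrank ℝ W + Module.finrank ℝ (radOn Y W)

lemma mem_radOn {Y : E →ₗ[ℝ] E →ₗ[ℝ] ℝ} {W : Submodule ℝ E} {z : E} :
    z ∈ radOn Y W ↔ z ∈ W ∧ ∀ w ∈ W, Y z w = 0 := Iff.rfl

lemma radOn_le (Y : E →ₗ[ℝ] E →ₗ[ℝ] ℝ) (W : Submodule ℝ E) : radOn Y W ≤ W :=
  fun _ h => h.1

lemma isAlt_swap {Y : E →ₗ[ℝ] E →ₗ[ℝ] ℝ} (hY : ∀ z, Y z z = 0) (a b : E) :
    Y a b = - Y b a := by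
  have := hY (a + b)
  simp [hY a, hY b] at this
  linarith

/-- The form restricted to `W`, as a map to the dual. -/
noncomputable def formOn (Y : E →ₗ[ℝ] E →ₗ[ℝ] ℝ) (W : Submodule ℝ E) :
    W →ₗ[ℝ] Module.Dual ℝ W :=
  (W.subtype.dualMap).comp (Y.comp W.subtype)

lemma formOn_apply (Y : E →ₗ[ℝ] E →ₗ[ℝ] ℝ) (W : Submodule ℝ E) (z w : W) :
    formOn Y W z w = Y z w := rfl

lemma formOn_add_smul (Y B : E →ₗ[ℝ] E →ₗ[ℝ] ℝ) (t : ℝ) (W : Submodule ℝ E) :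
    formOn (Y + t • B) W = formOn Y W + t • formOn B W := by
  ext z w
  simp [formOn_apply]

lemma map_ker_formOn (Y : E →ₗ[ℝ] E →ₗ[ℝ] ℝ) (W : Submodule ℝ E) :
    (LinearMap.ker (formOn Y W)).map W.subtype = radOn Y W := by
  ext z
  simp only [Submodule.mem_map, LinearMap.mem_ker, mem_radOn]
  constructor
  · rintro ⟨y, hy, rfl⟩
    refine ⟨y.2, fun w hw => ?_⟩
    have := LinearMap.congr_fun hy ⟨w, hw⟩
    simpa [formOn_apply] using this
  · rintro ⟨hz, hz'⟩
    exact ⟨⟨z, hz⟩, LinearMap.ext fun w => hz' w w.2, rfl⟩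

lemma finrank_ker_formOn (Y : E →ₗ[ℝ] E →ₗ[ℝ] ℝ) (W : Submodule ℝ E) :
    Module.finrank ℝ (LinearMap.ker (formOn Y W)) = Module.finrank ℝ (radOn Y W) := by
  rw [← map_ker_formOn]
  exact (LinearEquiv.finrank_eq
    (Submodule.equivMapOfInjective _ W.injective_subtype _))

lemma exists_repr {Y : E →ₗ[ℝ] E →ₗ[ℝ] ℝ} (hY : ∀ z, Y z z = 0) (W : Submodule ℝ E)
    (e : E →ₗ[ℝ] ℝ) (he : ∀ z ∈ radOn Y W, e z = 0) :
    ∃ y ∈ W, ∀ w ∈ W, Y y w = e w := by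
  have hle : LinearMap.range (formOn Y W) ≤ (LinearMap.ker (formOn Y W)).dualAnnihilator := by
    rintro _ ⟨y, rfl⟩
    rw [Submodule.mem_dualAnnihilator]
    intro w hw
    rw [formOn_apply, isAlt_swap hY, ← formOn_apply, LinearMap.mem_ker.1 hw]
    simp
  have h1 := LinearMap.finrank_range_add_finrank_ker (formOn Y W)
  have h2 := Subspace.finrank_add_finrank_dualAnnihilator_eq (LinearMap.ker (formOn Y W))
  have heq := Submodule.eq_of_le_of_finrank_eq hle (by omega)
  have hmem : e.comp W.subtype ∈ LinearMap.range (formOn Y W) := by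
    rw [heq, Submodule.mem_dualAnnihilator]
    intro w hw
    apply he
    rw [← map_ker_formOn]
    exact ⟨w, hw, rfl⟩
  obtain ⟨y, hy⟩ := hmem
  refine ⟨y, y.2, fun w hw => ?_⟩
  have := LinearMap.congr_fun hy ⟨w, hw⟩
  simpa [formOn_apply] using this

lemma finrank_inf_ker (W : Submodule ℝ E) (e : E →ₗ[ℝ] ℝ) :
    Module.finrank ℝ W ≤ Module.finrank ℝ (W ⊓ LinearMap.ker e : Submodule ℝ E) + 1 := by
  have h1 := Submodule.finrank_sup_add_finrank_inf_eq W (LinearMap.ker e)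
  have h2 := LinearMap.finrank_range_add_finrank_ker e
  have h3 : Module.finrank ℝ (LinearMap.range e) ≤ 1 := by
    simpa using Submodule.finrank_le (LinearMap.range e)
  have h4 := Submodule.finrank_le (W ⊔ LinearMap.ker e)
  omega

lemma numN_mono {Y : E →ₗ[ℝ] E →ₗ[ℝ] ℝ} (hY : ∀ z, Y z z = 0) {W' W : Submodule ℝ E}
    (h : W' ≤ W) : numN Y W' ≤ numN Y W := by
  let f : radOn Y W' →ₗ[ℝ] Module.Dual ℝ W :=
    (W.subtype.dualMap).comp (Y.comp (radOn Y W').subtype)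
  have hf : ∀ (r : radOn Y W') (w : W), f r w = Y r w := fun _ _ => rfl
  let W'' : Submodule ℝ W := W'.comap W.subtype
  have hW'' : Module.finrank ℝ W'' = Module.finrank ℝ W' := by
    have : W''.map W.subtype = W' := by
      rw [Submodule.map_comap_subtype]; exact inf_eq_right.2 h
    conv_rhs => rw [← this]
    exact (LinearEquiv.finrank_eq (Submodule.equivMapOfInjective _ W.injective_subtype _))
  have hr : LinearMap.range f ≤ W''.dualAnnihilator := by
    rintro _ ⟨r, rfl⟩
    rw [Submodule.mem_dualAnnihilator]
    intro w hw
    rw [hf]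
    exact r.2.2 w hw
  have hk : (LinearMap.ker f).map (radOn Y W').subtype ≤ radOn Y W := by
    rintro _ ⟨r, hr, rfl⟩
    refine ⟨h r.2.1, fun w hw => ?_⟩
    have := LinearMap.congr_fun (LinearMap.mem_ker.1 hr) ⟨w, hw⟩
    simpa [hf] using this
  have h1 := LinearMap.finrank_range_add_finrank_ker f
  have h2 := Subspace.finrank_add_finrank_dualAnnihilator_eq W''
  have h3 := Submodule.finrank_mono hr
  have h4 := Submodule.finrank_mono hk
  rw [← LinearEquiv.finrank_eq (Submodule.equivMapOfInjective _
    (radOn Y W').injective_subtype _)] at h4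
  unfold numN
  omega

lemma numN_drop {Y : E →ₗ[ℝ] E →ₗ[ℝ] ℝ} (hY : ∀ z, Y z z = 0) (W : Submodule ℝ E)
    (e : E →ₗ[ℝ] ℝ) {k : E} (hk : k ∈ radOn Y W) (hek : e k ≠ 0) :
    numN Y (W ⊓ LinearMap.ker e) + 2 ≤ numN Y W := by
  have h1 : W ⊓ LinearMap.ker e < W := by
    refine lt_of_le_of_ne inf_le_left fun h => ?_
    have : k ∈ W ⊓ LinearMap.ker e := by rw [h]; exact hk.1
    exact hek this.2
  have h2 : radOn Y (W ⊓ LinearMap.ker e) < radOn Y W := by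
    refine lt_of_le_of_ne ?_ fun h => ?_
    · rintro r ⟨⟨hr1, hr2⟩, hr3⟩
      refine ⟨hr1, fun w hw => ?_⟩
      have h3 := hr3 (w - (e w / e k) • k)
        ⟨W.sub_mem hw (W.smul_mem _ hk.1), by simp [hek]⟩
      have h4 : Y r k = 0 := by rw [isAlt_swap hY, hk.2 r hr1, neg_zero]
      simpa [h4] using h3
    · have : k ∈ radOn Y (W ⊓ LinearMap.ker e) := by rw [h]; exact hk
      exact hek this.1.2
  have h3 := Submodule.finrank_lt_finrank_of_lt h1
  have h4 := Submodule.finrank_lt_finrank_of_lt h2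
  unfold numN
  omega

lemma numN_keep {Y : E →ₗ[ℝ] E →ₗ[ℝ] ℝ} (hY : ∀ z, Y z z = 0) (W : Submodule ℝ E)
    (e : E →ₗ[ℝ] ℝ) (he : ∀ z ∈ radOn Y W, e z = 0) :
    numN Y W ≤ numN Y (W ⊓ LinearMap.ker e) := by
  by_cases h0 : ∀ w ∈ W, e w = 0
  · have : W ⊓ LinearMap.ker e = W := inf_eq_left.2 fun w hw => h0 w hw
    rw [this]
  · push Not at h0
    obtain ⟨w0, hw0, hne⟩ := h0
    obtain ⟨y, hyW, hy⟩ := exists_repr hY W e he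
    have h2 : radOn Y W < radOn Y (W ⊓ LinearMap.ker e) := by
      refine lt_of_le_of_ne ?_ fun h => ?_
      · intro r hr
        exact ⟨⟨hr.1, he r hr⟩, fun w hw => hr.2 w hw.1⟩
      · have hy' : y ∈ radOn Y (W ⊓ LinearMap.ker e) := by
          refine ⟨⟨hyW, ?_⟩, fun w hw => ?_⟩
          · show e y = 0
            rw [← hy y hyW, hY]
          · rw [hy w hw.1]; exact hw.2
        rw [← h] at hy'
        exact hne (by rw [← hy w0 hw0, hy'.2 w0 hw0])
    have h4 := Submodule.finrank_lt_finrank_of_lt h2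
    have h5 := finrank_inf_ker W e
    unfold numN
    omega

lemma numN_even {Y : E →ₗ[ℝ] E →ₗ[ℝ] ℝ} (hY : ∀ z, Y z z = 0) (W : Submodule ℝ E) :
    Even (numN Y W) := by
  induction hn : Module.finrank ℝ W using Nat.strong_induction_on generalizing W with
  | _ n ih =>
    by_cases h : ∀ z ∈ W, ∀ w ∈ W, Y z w = 0
    · have : radOn Y W = W := le_antisymm (radOn_le Y W) fun z hz => ⟨hz, h z hz⟩
      unfold numN
      rw [this]
      exact ⟨_, rfl⟩
    · push Not at h
      obtain ⟨z, hz, w, hw, hzw⟩ := h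
      have h1 : W ⊓ LinearMap.ker (Y z) < W := by
        refine lt_of_le_of_ne inf_le_left fun h => ?_
        have : w ∈ W ⊓ LinearMap.ker (Y z) := by rw [h]; exact hw
        exact hzw this.2
      have h2 := Submodule.finrank_lt_finrank_of_lt h1
      have h3 := ih _ (hn ▸ h2) _ rfl
      have h4 : numN Y W ≤ numN Y (W ⊓ LinearMap.ker (Y z)) :=
        numN_keep hY W (Y z) fun r hr => by rw [isAlt_swap hY, hr.2 z hz, neg_zero]
      have h5 := numN_mono hY h1.le
      rwa [le_antisymm h4 h5]

/-- The alternating form `α ∧ β`. -/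
noncomputable def wedge (α β : E →ₗ[ℝ] ℝ) : E →ₗ[ℝ] E →ₗ[ℝ] ℝ :=
  α.smulRight β - β.smulRight α

lemma wedge_apply (α β : E →ₗ[ℝ] ℝ) (y z : E) :
    wedge α β y z = α y * β z - β y * α z := by
  simp [wedge]

/-- The weighted sum of the forms. -/
noncomputable def sumForm {ι : Type} [Fintype ι] (α β : ι → E →ₗ[ℝ] ℝ) (x : ι → ℝ) :
    E →ₗ[ℝ] E →ₗ[ℝ] ℝ := ∑ v, x v • wedge (α v) (β v)

lemma sumForm_apply {ι : Type} [Fintype ι] (α β : ι → E →ₗ[ℝ] ℝ) (x : ι → ℝ) (y z : E) :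
    sumForm α β x y z = ∑ v, x v * (α v y * β v z - β v y * α v z) := by
  simp [sumForm, wedge_apply]

lemma sumForm_alt {ι : Type} [Fintype ι] (α β : ι → E →ₗ[ℝ] ℝ) (x : ι → ℝ) (y : E) :
    sumForm α β x y y = 0 := by
  rw [sumForm_apply]
  exact Finset.sum_eq_zero fun v _ => by ring

lemma exists_drop_two {ι : Type} [Fintype ι] (α β : ι → E →ₗ[ℝ] ℝ) (x : ι → ℝ)
    (W : Submodule ℝ E) (hW : W ≠ ⊥) (hrad : radOn (sumForm α β x) W = ⊥) :
    ∃ v, numN (sumForm α β x) (W ⊓ LinearMap.ker (α v) ⊓ LinearMap.ker (β v)) + 2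
      ≤ numN (sumForm α β x) W := by
  set Y := sumForm α β x with hYdef
  have hY : ∀ z, Y z z = 0 := sumForm_alt α β x
  have hz : ∀ (e : E →ₗ[ℝ] ℝ), ∀ z ∈ radOn Y W, e z = 0 := by
    intro e z hz
    rw [hrad, Submodule.mem_bot] at hz
    rw [hz, map_zero]
  choose a haW ha using fun v => exists_repr hY W (α v) (hz (α v))
  choose b hbW hb using fun v => exists_repr hY W (β v) (hz (β v))
  have key : ∃ v, Y (a v) (b v) ≠ 0 := by
    by_contra hcon
    push Not at hcon
    have hid : (LinearMap.id : W →ₗ[ℝ] W) =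
        ∑ v, x v • (((α v).comp W.subtype).smulRight (⟨b v, hbW v⟩ : W) -
          ((β v).comp W.subtype).smulRight (⟨a v, haW v⟩ : W)) := by
      ext y
      have hmem : (y : E) - ∑ v, x v • (α v y • b v - β v y • a v) ∈ radOn Y W := by
        refine ⟨W.sub_mem y.2 (W.sum_mem fun v _ => W.smul_mem _
          (W.sub_mem (W.smul_mem _ (hbW v)) (W.smul_mem _ (haW v)))), fun w hw => ?_⟩
        have h1 : Y y w = ∑ v, x v * (α v y * β v w - β v y * α v w) :=
          sumForm_apply α β x y w
        rw [map_sub, LinearMap.sub_apply, h1, map_sum, LinearMap.sum_apply, sub_eq_zero]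
        refine Finset.sum_congr rfl fun v _ => ?_
        simp [ha v w hw, hb v w hw]
      rw [hrad, Submodule.mem_bot, sub_eq_zero] at hmem
      simp only [LinearMap.id_coe, id_eq]
      rw [hmem]
      simp
    have htr := congrArg (LinearMap.trace ℝ W) hid
    rw [LinearMap.trace_id, map_sum] at htr
    have : ∀ v ∈ Finset.univ, (LinearMap.trace ℝ W) (x v •
        (((α v).comp W.subtype).smulRight (⟨b v, hbW v⟩ : W) -
          ((β v).comp W.subtype).smulRight (⟨a v, haW v⟩ : W))) = 0 := by
      intro v _
      rw [map_smul, map_sub, LinearMap.trace_smulRight, LinearMap.trace_smulRight]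
      have e1 : α v (b v) = 0 := by rw [← ha v _ (hbW v), hcon]
      have e2 : β v (a v) = 0 := by rw [← hb v _ (haW v), isAlt_swap hY, hcon, neg_zero]
      simp [e1, e2]
    rw [Finset.sum_eq_zero this] at htr
    have h0 : Module.finrank ℝ W = 0 := by exact_mod_cast htr
    exact hW (Submodule.finrank_eq_zero.1 h0)
  obtain ⟨v, hv⟩ := key
  refine ⟨v, ?_⟩
  have h1 : numN Y W ≤ numN Y (W ⊓ LinearMap.ker (α v)) := numN_keep hY W _ (hz _)
  have h1' : numN Y (W ⊓ LinearMap.ker (α v)) ≤ numN Y W := numN_mono hY inf_le_left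
  have h2 : a v ∈ radOn Y (W ⊓ LinearMap.ker (α v)) := by
    refine ⟨⟨haW v, ?_⟩, fun w hw => ?_⟩
    · show α v (a v) = 0
      rw [← ha v _ (haW v), hY]
    · rw [ha v w hw.1]; exact hw.2
  have h3 : β v (a v) ≠ 0 := by
    rw [← hb v _ (haW v), isAlt_swap hY]
    exact neg_ne_zero.2 hv
  have := numN_drop hY _ (β v) h2 h3
  omega

lemma eventually_ker_le {M F : Type} [AddCommGroup M] [Module ℝ M] [FiniteDimensional ℝ M]
    [AddCommGroup F] [Module ℝ F] [FiniteDimensional ℝ F] (A B : M →ₗ[ℝ] F) :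
    ∀ᶠ t in nhds (0 : ℝ), Module.finrank ℝ (LinearMap.ker (A + t • B)) ≤
      Module.finrank ℝ (LinearMap.ker A) := by
  let φ := (Module.finBasis ℝ F).equivFun
  obtain ⟨C, hC⟩ := Submodule.exists_isCompl (LinearMap.ker A)
  let b := Module.finBasis ℝ C
  have hli : LinearIndependent ℝ (fun i => φ (A (b i))) := by
    have h1 : LinearIndependent ℝ (fun i => (b i : M)) :=
      b.linearIndependent.map' C.subtype (Submodule.ker_subtype C)
    have h2 : LinearIndependent ℝ (fun i => A (b i : M)) := by
      refine h1.map ?_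
      have : Submodule.span ℝ (Set.range fun i => (b i : M)) ≤ C := by
        rw [Submodule.span_le]
        rintro _ ⟨i, rfl⟩
        exact (b i).2
      exact hC.symm.disjoint.mono_left this
    exact h2.map' φ.toLinearMap φ.ker
  have hcont : Continuous fun t : ℝ => fun i => φ ((A + t • B) (b i)) := by
    refine continuous_pi fun i => ?_
    simp only [LinearMap.add_apply, LinearMap.smul_apply, map_add, map_smul]
    fun_prop
  have hopen := (isOpen_setOfPred_linearIndependent (𝕜 := ℝ)
    (E := Fin (Module.finrank ℝ F) → ℝ) (ι := Fin (Module.finrank ℝ C))).preimage hcont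
  have hmem : (0 : ℝ) ∈ (fun t : ℝ => fun i => φ ((A + t • B) (b i))) ⁻¹'
      {f | LinearIndependent ℝ f} := by
    simpa using hli
  filter_upwards [hopen.mem_nhds hmem] with t ht
  have ht' : LinearIndependent ℝ (fun i => φ ((A + t • B) (b i))) := ht
  have h3 : LinearIndependent ℝ (fun i => (A + t • B) (b i : M)) :=
    LinearIndependent.of_comp φ.toLinearMap ht'
  have h4 : Module.finrank ℝ C ≤ Module.finrank ℝ (LinearMap.range (A + t • B)) := by
    have h5 : LinearIndependent ℝ (fun i => (⟨(A + t • B) (b i : M), ⟨_, rfl⟩⟩ :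
        LinearMap.range (A + t • B))) :=
      LinearIndependent.of_comp (LinearMap.range (A + t • B)).subtype h3
    simpa using h5.fintype_card_le_finrank
  have h6 := LinearMap.finrank_range_add_finrank_ker (A + t • B)
  have h7 := Submodule.finrank_add_eq_of_isCompl hC
  omega

lemma exists_nat_min {A : Type} [Nonempty A] (F : A → ℕ) : ∃ x, ∀ y, F x ≤ F y := by
  have hne : (Set.range F).Nonempty := Set.range_nonempty F
  obtain ⟨x, hx⟩ := Nat.sInf_mem hne
  exact ⟨x, fun y => by rw [hx]; exact Nat.sInf_le ⟨y, rfl⟩⟩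

lemma radOn_perturb_lt {Y : E →ₗ[ℝ] E →ₗ[ℝ] ℝ} (hY : ∀ z, Y z z = 0) (W : Submodule ℝ E)
    (a b : E →ₗ[ℝ] ℝ) {z₁ z₂ : E} (h₁ : z₁ ∈ radOn Y W) (h₂ : z₂ ∈ radOn Y W)
    (hne : a z₁ * b z₂ - b z₁ * a z₂ ≠ 0) {t : ℝ} (ht0' : t ≠ 0) :
    radOn (Y + t • wedge a b) W < radOn Y W := by
  refine lt_of_le_of_ne ?_ fun h => ?_
  · rintro y ⟨hy1, hy2⟩
    have e1 := hy2 z₁ h₁.1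
    have e2 := hy2 z₂ h₂.1
    simp only [LinearMap.add_apply, LinearMap.smul_apply, wedge_apply, smul_eq_mul] at e1 e2
    rw [isAlt_swap hY, h₁.2 y hy1] at e1
    rw [isAlt_swap hY, h₂.2 y hy1] at e2
    have e1' : a y * b z₁ - b y * a z₁ = 0 := by
      rcases mul_eq_zero.1 (by linarith : t * (a y * b z₁ - b y * a z₁) = 0) with h | h
      · exact absurd h ht0'
      · exact h
    have e2' : a y * b z₂ - b y * a z₂ = 0 := by
      rcases mul_eq_zero.1 (by linarith : t * (a y * b z₂ - b y * a z₂) = 0) with h | h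
      · exact absurd h ht0'
      · exact h
    have ea : a y = 0 := by
      have : a y * (a z₁ * b z₂ - b z₁ * a z₂) = 0 := by
        linear_combination a z₁ * e2' - a z₂ * e1'
      exact (mul_eq_zero.1 this).resolve_right hne
    have eb : b y = 0 := by
      have : b y * (a z₁ * b z₂ - b z₁ * a z₂) = 0 := by
        linear_combination b z₁ * e2' - b z₂ * e1'
      exact (mul_eq_zero.1 this).resolve_right hne
    refine ⟨hy1, fun w hw => ?_⟩
    have := hy2 w hw
    simpa [wedge_apply, ea, eb] using this
  · have hz : z₁ ∈ radOn (Y + t • wedge (a) (b)) W := by rw [h]; exact h₁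
    have := hz.2 z₂ h₂.1
    simp only [LinearMap.add_apply, LinearMap.smul_apply, wedge_apply, smul_eq_mul,
      h₁.2 z₂ h₂.1, zero_add] at this
    exact (mul_ne_zero ht0' hne) this

lemma exists_generic {ι κ : Type} [Fintype ι] [Fintype κ] (α β : ι → E →ₗ[ℝ] ℝ)
    (W : κ → Submodule ℝ E) :
    ∃ x : ι → ℝ, ∀ k v, ∀ z₁ ∈ radOn (sumForm α β x) (W k), ∀ z₂ ∈ radOn (sumForm α β x) (W k),
      α v z₁ * β v z₂ - β v z₁ * α v z₂ = 0 := by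
  classical
  obtain ⟨x, hx⟩ := exists_nat_min
    (fun x : ι → ℝ => ∑ k, Module.finrank ℝ (radOn (sumForm α β x) (W k)))
  refine ⟨x, fun k v z₁ h₁ z₂ h₂ => ?_⟩
  by_contra hne
  set Y := sumForm α β x with hYdef
  have hY : ∀ z, Y z z = 0 := sumForm_alt α β x
  have hupd : ∀ t : ℝ, sumForm α β (x + Pi.single v t) = Y + t • wedge (α v) (β v) := by
    intro t
    rw [hYdef]
    unfold sumForm
    simp only [Pi.add_apply, add_smul, Finset.sum_add_distrib]
    congr 1
    rw [Finset.sum_eq_single v]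
    · simp
    · intro b _ hb; simp [Pi.single_eq_of_ne hb]
    · simp
  have hev : ∀ᶠ t in nhds (0 : ℝ), ∀ j, Module.finrank ℝ
      (radOn (sumForm α β (x + Pi.single v t)) (W j)) ≤ Module.finrank ℝ (radOn Y (W j)) := by
    rw [Filter.eventually_all]
    intro j
    filter_upwards [eventually_ker_le (formOn Y (W j)) (formOn (wedge (α v) (β v)) (W j))]
      with t ht
    rw [hupd, ← finrank_ker_formOn, ← finrank_ker_formOn, formOn_add_smul]
    exact ht
  have hev2 : ∀ᶠ t in nhdsWithin (0 : ℝ) {0}ᶜ, ∀ j, Module.finrank ℝ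
      (radOn (sumForm α β (x + Pi.single v t)) (W j)) ≤ Module.finrank ℝ (radOn Y (W j)) :=
    hev.filter_mono nhdsWithin_le_nhds
  obtain ⟨t, ht, ht0⟩ := (hev2.and self_mem_nhdsWithin).exists
  have ht0' : t ≠ 0 := ht0
  have hlt : radOn (sumForm α β (x + Pi.single v t)) (W k) < radOn Y (W k) := by
    rw [hupd]
    exact radOn_perturb_lt hY (W k) _ _ h₁ h₂ hne ht0'
  have hF : ∑ k, Module.finrank ℝ (radOn (sumForm α β (x + Pi.single v t)) (W k)) <
      ∑ k, Module.finrank ℝ (radOn Y (W k)) := by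
    refine Finset.sum_lt_sum ?_ ?_
    · intro j _
      exact ht j
    · refine ⟨k, Finset.mem_univ k, ?_⟩
      exact Submodule.finrank_lt_finrank_of_lt hlt
  have h8 := hx (x + Pi.single v t)
  exact absurd hF (not_lt.2 h8)

end LinAlg



section Flow

set_option linter.unusedSectionVars false

variable {V : Type} [Fintype V]

/-- Evaluation at a pair. -/
def ev (u v : V) : (V → V → ℝ) →ₗ[ℝ] ℝ where
  toFun z := z u v
  map_add' _ _ := rfl
  map_smul' _ _ := rfl

lemma ev_apply (u v : V) (z : V → V → ℝ) : ev u v z = z u v := rfl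

/-- Antisymmetric functions supported on the edges of `H`. -/
def chainSp (H : SimpleGraph V) : Submodule ℝ (V → V → ℝ) where
  carrier := {z | (∀ u v, z u v = - z v u) ∧ ∀ u v, ¬ H.Adj u v → z u v = 0}
  add_mem' := by
    rintro a b ⟨ha, ha'⟩ ⟨hb, hb'⟩
    refine ⟨fun u v => ?_, fun u v h => ?_⟩
    · simp only [Pi.add_apply]; rw [ha, hb]; ring
    · simp only [Pi.add_apply]; rw [ha' u v h, hb' u v h]; ring
  zero_mem' := ⟨fun u v => by simp, fun u v _ => rfl⟩
  smul_mem' := by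
    rintro c a ⟨ha, ha'⟩
    refine ⟨fun u v => ?_, fun u v h => ?_⟩
    · simp only [Pi.smul_apply, smul_eq_mul]; rw [ha]; ring
    · simp only [Pi.smul_apply, smul_eq_mul]; rw [ha' u v h]; ring

/-- The boundary map. -/
def bdry : (V → V → ℝ) →ₗ[ℝ] (V → ℝ) where
  toFun z u := ∑ v, z u v
  map_add' a b := by ext u; simp [Finset.sum_add_distrib]
  map_smul' c a := by ext u; simp [Finset.mul_sum]

lemma bdry_apply (z : V → V → ℝ) (u : V) : bdry z u = ∑ v, z u v := rfl

/-- The cycle space of `H`. -/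
def cycSp (H : SimpleGraph V) : Submodule ℝ (V → V → ℝ) := chainSp H ⊓ LinearMap.ker bdry

lemma mem_cycSp {H : SimpleGraph V} {z : V → V → ℝ} :
    z ∈ cycSp H ↔ ((∀ u v, z u v = - z v u) ∧ ∀ u v, ¬ H.Adj u v → z u v = 0) ∧
      ∀ u, ∑ v, z u v = 0 := by
  constructor
  · rintro ⟨h1, h2⟩
    exact ⟨h1, fun u => congrFun h2 u⟩
  · rintro ⟨h1, h2⟩
    exact ⟨h1, funext h2⟩

lemma chainSp_mono {H K : SimpleGraph V} (h : H ≤ K) : chainSp H ≤ chainSp K :=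
  fun _ hz => ⟨hz.1, fun u v huv => hz.2 u v fun h' => huv (h h')⟩

lemma cycSp_mono {H K : SimpleGraph V} (h : H ≤ K) : cycSp H ≤ cycSp K :=
  inf_le_inf_right _ (chainSp_mono h)

open Classical in
/-- The unit flow along one edge. -/
noncomputable def edgeFlow (a b : V) : V → V → ℝ := fun x y =>
  (if x = a ∧ y = b then 1 else 0) - (if x = b ∧ y = a then 1 else 0)

lemma edgeFlow_mem {H : SimpleGraph V} {a b : V} (h : H.Adj a b) : edgeFlow a b ∈ chainSp H := by
  classical
  refine ⟨fun u v => ?_, fun u v huv => ?_⟩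
  · simp only [edgeFlow]
    simp only [and_comm (a := v = a), and_comm (a := v = b)]
    ring
  · simp only [edgeFlow]
    rw [if_neg, if_neg, sub_zero]
    · rintro ⟨rfl, rfl⟩; exact huv h.symm
    · rintro ⟨rfl, rfl⟩; exact huv h

open Classical in
lemma bdry_edgeFlow (a b : V) : bdry (edgeFlow a b) = Pi.single a 1 - Pi.single b 1 := by
  ext x
  simp only [bdry_apply, edgeFlow, Finset.sum_sub_distrib, Pi.sub_apply, Pi.single_apply]
  congr 1
  · by_cases h : x = a <;> simp [h]
  · by_cases h : x = b <;> simp [h]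

open Classical in
lemma exists_flow {H : SimpleGraph V} {a b : V} (h : H.Reachable a b) :
    ∃ z ∈ chainSp H, bdry z = Pi.single a 1 - Pi.single b 1 := by
  obtain ⟨p⟩ := h
  induction p with
  | nil => exact ⟨0, Submodule.zero_mem _, by simp⟩
  | cons hadj p ih =>
    obtain ⟨z, hz, hz'⟩ := ih
    refine ⟨edgeFlow _ _ + z, Submodule.add_mem _ (edgeFlow_mem hadj) hz, ?_⟩
    rw [map_add, hz', bdry_edgeFlow]
    abel

lemma acyclic_of_cycSp {H : SimpleGraph V} (h : cycSp H = ⊥) : H.IsAcyclic := by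
  classical
  rw [isAcyclic_iff_forall_adj_isBridge]
  intro u v huv
  rw [isBridge_iff]
  intro hr
  obtain ⟨z, hz, hz'⟩ := exists_flow hr
  have hmem : z + edgeFlow v u ∈ cycSp H := by
    refine ⟨Submodule.add_mem _ (chainSp_mono (deleteEdges_le _) hz) (edgeFlow_mem huv.symm), ?_⟩
    show bdry _ = 0
    rw [map_add, hz', bdry_edgeFlow]
    abel
  rw [h, Submodule.mem_bot] at hmem
  have h1 := congrFun (congrFun hmem v) u
  have h2 : z v u = 0 := hz.2 v u (by simp [deleteEdges_adj, Sym2.eq_swap])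
  have h3 : v ≠ u := huv.ne'
  simp [h2, edgeFlow, h3] at h1

lemma cycSp_deleteEdge (H : SimpleGraph V) (a b : V) :
    cycSp (H.deleteEdges {s(a, b)}) = cycSp H ⊓ LinearMap.ker (ev a b) := by
  ext z
  rw [Submodule.mem_inf, LinearMap.mem_ker, ev_apply, mem_cycSp, mem_cycSp]
  constructor
  · rintro ⟨⟨h1, h2⟩, h3⟩
    refine ⟨⟨⟨h1, fun u v huv => h2 u v ?_⟩, h3⟩, h2 a b ?_⟩
    · rw [deleteEdges_adj]; exact fun h => huv h.1
    · rw [deleteEdges_adj]; simp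
  · rintro ⟨⟨⟨h1, h2⟩, h3⟩, h4⟩
    refine ⟨⟨h1, fun u v huv => ?_⟩, h3⟩
    by_cases hadj : H.Adj u v
    · rw [deleteEdges_adj] at huv
      have : s(u, v) = s(a, b) := by
        by_contra hne
        exact huv ⟨hadj, by simpa using hne⟩
      rcases Sym2.eq_iff.1 this with ⟨rfl, rfl⟩ | ⟨rfl, rfl⟩
      · exact h4
      · rw [h1, h4, neg_zero]
    · exact h2 u v hadj

/-- Remove all edges at `v`. -/
def delV (H : SimpleGraph V) (v : V) : SimpleGraph V where
  Adj a b := H.Adj a b ∧ a ≠ v ∧ b ≠ v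
  symm := ⟨fun _ _ h => ⟨h.1.symm, h.2.2, h.2.1⟩⟩
  loopless := ⟨fun _ h => h.1.ne rfl⟩

lemma delV_le (H : SimpleGraph V) (v : V) : delV H v ≤ H := fun _ _ h => h.1

lemma mem_cycSp_delV {H : SimpleGraph V} {v : V} {z : V → V → ℝ} (hz : z ∈ cycSp H)
    (h0 : ∀ w, z v w = 0) : z ∈ cycSp (delV H v) := by
  rw [mem_cycSp] at hz ⊢
  obtain ⟨⟨h1, h2⟩, h3⟩ := hz
  refine ⟨⟨h1, fun a b hab => ?_⟩, h3⟩
  by_cases ha : a = v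
  · rw [ha, h0]
  · by_cases hb : b = v
    · rw [h1, hb, h0, neg_zero]
    · exact h2 a b fun h => hab ⟨h, ha, hb⟩

lemma isFVS_insert {H : SimpleGraph V} {v : V} {S : Set V} (h : IsFVS (delV H v) S) :
    IsFVS H (insert v S) := by
  unfold IsFVS at *
  let f : H.induce (insert v S)ᶜ →g (delV H v).induce Sᶜ :=
    { toFun := fun x => ⟨x.1, fun hx => x.2 (Set.mem_insert_of_mem _ hx)⟩
      map_rel' := by
        rintro ⟨a, ha⟩ ⟨b, hb⟩ hab
        refine ⟨hab, ?_, ?_⟩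
        · intro (h : a = v); subst h; exact ha (Set.mem_insert _ _)
        · intro (h : b = v); subst h; exact hb (Set.mem_insert _ _) }
  refine h.comap f ?_
  rintro ⟨a, ha⟩ ⟨b, hb⟩ hab
  simpa [f] using hab

/-- `a, b` cover all but at most one neighbour of `v`. -/
def GoodPair (G : SimpleGraph V) (v a b : V) : Prop :=
  ∀ w w', G.Adj v w → G.Adj v w' → w ≠ a → w ≠ b → w' ≠ a → w' ≠ b → w = w'

lemma exists_goodPair {G : SimpleGraph V} (h : Subcubic G) (v : V) : ∃ a b, GoodPair G v a b := by
  classical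
  by_cases hs : (G.neighborSet v).Subsingleton
  · exact ⟨v, v, fun w w' h1 h2 _ _ _ _ => hs h1 h2⟩
  · rw [Set.not_subsingleton_iff] at hs
    obtain ⟨a, ha, b, hb, hab⟩ := hs
    refine ⟨a, b, fun w w' h1 h2 hwa hwb hwa' hwb' => ?_⟩
    by_contra hne
    have hsub : (({a, b, w, w'} : Finset V) : Set V) ⊆ G.neighborSet v := by
      intro x hx
      simp only [Finset.coe_insert, Finset.coe_singleton, Set.mem_insert_iff,
        Set.mem_singleton_iff] at hx
      rcases hx with rfl | rfl | rfl | rfl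
      exacts [ha, hb, h1, h2]
    have hc := Set.ncard_le_ncard hsub (Set.toFinite _)
    rw [Set.ncard_coe_finset] at hc
    have h4 : ({a, b, w, w'} : Finset V).card = 4 := by
      rw [Finset.card_insert_of_notMem, Finset.card_insert_of_notMem,
        Finset.card_insert_of_notMem, Finset.card_singleton] <;>
        simp [hab, hwa.symm, hwb.symm, hwa'.symm, hwb'.symm, hne]
    have := h v
    omega

lemma zero_of_goodPair {G H : SimpleGraph V} (hHG : H ≤ G) {v a b : V} (hg : GoodPair G v a b)
    {z : V → V → ℝ} (hz : z ∈ cycSp H) (ha : z v a = 0) (hb : z v b = 0) (w : V) :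
    z v w = 0 := by
  rw [mem_cycSp] at hz
  obtain ⟨⟨h1, h2⟩, h3⟩ := hz
  by_contra hne
  have hw : G.Adj v w := by
    by_contra h
    exact hne (h2 v w fun h' => h (hHG h'))
  have := h3 v
  rw [Finset.sum_eq_single w] at this
  · exact hne this
  · intro w' _ hw'
    by_contra hne'
    have hw'' : G.Adj v w' := by
      by_contra h
      exact hne' (h2 v w' fun h' => h (hHG h'))
    refine hw' (hg w' w hw'' hw ?_ ?_ ?_ ?_)
    · rintro rfl; exact hne' ha
    · rintro rfl; exact hne' hb
    · rintro rfl; exact hne ha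
    · rintro rfl; exact hne hb
  · simp

/-- The form on the flow space. -/
noncomputable def gForm (a b : V → V) (x : V → ℝ) :
    (V → V → ℝ) →ₗ[ℝ] (V → V → ℝ) →ₗ[ℝ] ℝ :=
  sumForm (fun v => ev v (a v)) (fun v => ev v (b v)) x

lemma gForm_apply (a b : V → V) (x : V → ℝ) (y z : V → V → ℝ) :
    gForm a b x y z = ∑ v, x v * (y v (a v) * z v (b v) - y v (b v) * z v (a v)) :=
  sumForm_apply _ _ x y z

lemma gForm_alt (a b : V → V) (x : V → ℝ) (y : V → V → ℝ) : gForm a b x y y = 0 :=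
  sumForm_alt _ _ x y

lemma exists_fvs_le {G : SimpleGraph V} {a b : V → V}
    (x : V → ℝ) : ∀ (n : ℕ) (H : SimpleGraph V), H ≤ G → numN (gForm a b x) (cycSp H) = n →
      ∃ S : Set V, IsFVS H S ∧ 2 * S.ncard ≤ n := by
  intro n
  induction n using Nat.strong_induction_on with
  | _ n ih =>
    intro H hH hn
    have step : ∀ v, numN (gForm a b x) (cycSp (delV H v)) + 2 ≤ n →
        ∃ S : Set V, IsFVS H S ∧ 2 * S.ncard ≤ n := by
      intro v hv
      obtain ⟨S, hS, hS'⟩ := ih _ (by omega) (delV H v) ((delV_le H v).trans hH) rfl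
      refine ⟨insert v S, isFVS_insert hS, ?_⟩
      have := Set.ncard_insert_le v S
      omega
    by_cases h0 : cycSp H = ⊥
    · refine ⟨∅, ?_, by simp⟩
      exact (acyclic_of_cycSp h0).comap (Embedding.induce (G := H) _).toHom
        (Embedding.induce (G := H) _).injective
    · by_cases hr : radOn (gForm a b x) (cycSp H) = ⊥
      · obtain ⟨v, hv⟩ := exists_drop_two _ _ x (cycSp H) h0 hr
        refine step v ?_
        have hle : cycSp (delV H v) ≤ cycSp H ⊓ LinearMap.ker (ev v (a v)) ⊓
            LinearMap.ker (ev v (b v)) := by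
          intro z hz
          refine ⟨⟨cycSp_mono (delV_le H v) hz, ?_⟩, ?_⟩
          · exact (mem_cycSp.1 hz).1.2 _ _ fun h => h.2.1 rfl
          · exact (mem_cycSp.1 hz).1.2 _ _ fun h => h.2.1 rfl
        have h1 := numN_mono (gForm_alt a b x) hle
        have h2 : numN (gForm a b x) (cycSp H ⊓ LinearMap.ker (ev v (a v)) ⊓
            LinearMap.ker (ev v (b v))) + 2 ≤ numN (gForm a b x) (cycSp H) := hv
        omega
      · obtain ⟨z, hz, hz0⟩ := Submodule.exists_mem_ne_zero_of_ne_bot hr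
        obtain ⟨v, hv⟩ := Function.ne_iff.1 hz0
        obtain ⟨w, hw⟩ := Function.ne_iff.1 hv
        refine step v ?_
        have h2 := numN_drop (gForm_alt a b x) (cycSp H) (ev v w) hz hw
        have hle : cycSp (delV H v) ≤ cycSp H ⊓ LinearMap.ker (ev v w) := by
          intro z hz
          refine ⟨cycSp_mono (delV_le H v) hz, ?_⟩
          exact (mem_cycSp.1 hz).1.2 _ _ fun h => h.2.1 rfl
        have h1 := numN_mono (gForm_alt a b x) hle
        omega

end Flow



section Comp

set_option linter.unusedSectionVars false

variable {V : Type} [Fintype V]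

/-- The edges of `H` inside the component `C`. -/
def compG (H : SimpleGraph V) (C : H.ConnectedComponent) : SimpleGraph V where
  Adj a b := H.Adj a b ∧ H.connectedComponentMk a = C
  symm := ⟨fun _ _ h => ⟨h.1.symm, by
    rw [← ConnectedComponent.connectedComponentMk_eq_of_adj h.1]; exact h.2⟩⟩
  loopless := ⟨fun _ h => h.1.ne rfl⟩

lemma compG_le (H : SimpleGraph V) (C : H.ConnectedComponent) : compG H C ≤ H := fun _ _ h => h.1

open Classical in
/-- Restriction of a function to a component. -/
noncomputable def restr (H : SimpleGraph V) (C : H.ConnectedComponent) :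
    (V → V → ℝ) →ₗ[ℝ] (V → V → ℝ) where
  toFun z u v := if H.connectedComponentMk u = C then z u v else 0
  map_add' a b := by ext u v; simp only [Pi.add_apply]; split_ifs <;> simp
  map_smul' c a := by ext u v; simp

lemma restr_pos {H : SimpleGraph V} {C : H.ConnectedComponent} {u : V}
    (h : H.connectedComponentMk u = C) (z : V → V → ℝ) (v : V) : restr H C z u v = z u v :=
  if_pos h

lemma restr_neg {H : SimpleGraph V} {C : H.ConnectedComponent} {u : V}
    (h : H.connectedComponentMk u ≠ C) (z : V → V → ℝ) (v : V) : restr H C z u v = 0 :=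
  if_neg h

lemma restr_mem {H : SimpleGraph V} (C : H.ConnectedComponent) {z : V → V → ℝ}
    (hz : z ∈ cycSp H) : restr H C z ∈ cycSp (compG H C) := by
  rw [mem_cycSp] at hz ⊢
  obtain ⟨⟨h1, h2⟩, h3⟩ := hz
  refine ⟨⟨fun u v => ?_, fun u v huv => ?_⟩, fun u => ?_⟩
  · by_cases hadj : H.Adj u v
    · have h := ConnectedComponent.connectedComponentMk_eq_of_adj hadj
      by_cases hu : H.connectedComponentMk u = C
      · rw [restr_pos hu, restr_pos (h ▸ hu), h1]
      · rw [restr_neg hu, restr_neg (h ▸ hu), neg_zero]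
    · have e1 := h2 u v hadj
      have e2 := h2 v u fun h => hadj h.symm
      by_cases hu : H.connectedComponentMk u = C <;> by_cases hv : H.connectedComponentMk v = C <;>
        simp [restr, hu, hv, e1, e2]
  · by_cases hu : H.connectedComponentMk u = C
    · rw [restr_pos hu]
      exact h2 u v fun h => huv ⟨h, hu⟩
    · rw [restr_neg hu]
  · by_cases hu : H.connectedComponentMk u = C
    · simp only [restr_pos hu]; exact h3 u
    · simp only [restr_neg hu]; simp

lemma zero_off {H : SimpleGraph V} {C : H.ConnectedComponent} {z : V → V → ℝ}
    (hz : z ∈ cycSp (compG H C)) {u : V} (hu : H.connectedComponentMk u ≠ C) (v : V) :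
    z u v = 0 := (mem_cycSp.1 hz).1.2 u v fun h => hu h.2

lemma gForm_restr_right {H : SimpleGraph V} {C : H.ConnectedComponent} (a b : V → V) (x : V → ℝ)
    {z : V → V → ℝ} (hz : z ∈ cycSp (compG H C)) (w : V → V → ℝ) :
    gForm a b x z (restr H C w) = gForm a b x z w := by
  rw [gForm_apply, gForm_apply]
  refine Finset.sum_congr rfl fun v _ => ?_
  by_cases hv : H.connectedComponentMk v = C
  · rw [restr_pos hv, restr_pos hv]
  · rw [zero_off hz hv, zero_off hz hv]; ring

lemma radOn_comp_le {H : SimpleGraph V} (C : H.ConnectedComponent) (a b : V → V) (x : V → ℝ) :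
    radOn (gForm a b x) (cycSp (compG H C)) ≤ radOn (gForm a b x) (cycSp H) := by
  rintro z ⟨hz, hz'⟩
  refine ⟨cycSp_mono (compG_le H C) hz, fun w hw => ?_⟩
  rw [← gForm_restr_right a b x hz]
  exact hz' _ (restr_mem C hw)

lemma restr_mem_rad {H : SimpleGraph V} (C : H.ConnectedComponent) (a b : V → V) (x : V → ℝ)
    {z : V → V → ℝ} (hz : z ∈ radOn (gForm a b x) (cycSp H)) :
    restr H C z ∈ radOn (gForm a b x) (cycSp (compG H C)) := by
  refine ⟨restr_mem C hz.1, fun w hw => ?_⟩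
  rw [isAlt_swap (gForm_alt a b x), gForm_restr_right a b x hw,
    ← isAlt_swap (gForm_alt a b x)]
  exact hz.2 w (cycSp_mono (compG_le H C) hw)

lemma finrank_le_sum {E κ : Type} [Fintype κ] [AddCommGroup E] [Module ℝ E]
    [FiniteDimensional ℝ E] (W : Submodule ℝ E) (W' : κ → Submodule ℝ E) (f : κ → E →ₗ[ℝ] E)
    (h1 : ∀ k, ∀ z ∈ W, f k z ∈ W' k) (h2 : ∀ z ∈ W, (∀ k, f k z = 0) → z = 0) :
    Module.finrank ℝ W ≤ ∑ k, Module.finrank ℝ (W' k) := by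
  rw [← Module.finrank_pi_fintype]
  let g : W →ₗ[ℝ] ((k : κ) → W' k) := LinearMap.pi fun k => (f k).restrict (h1 k)
  refine LinearMap.finrank_le_finrank_of_injective (f := g) ?_
  rw [← LinearMap.ker_eq_bot, LinearMap.ker_eq_bot']
  intro z hz
  have := h2 z z.2 fun k => congrArg Subtype.val (congrFun hz k)
  exact Subtype.ext this

lemma eq_zero_of_restr {H : SimpleGraph V} {z : V → V → ℝ} (h : ∀ C, restr H C z = 0) : z = 0 := by
  ext u v
  have := congrFun (congrFun (h (H.connectedComponentMk u)) u) v
  rwa [restr_pos rfl] at this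

open Classical in
lemma numN_le_sum (H : SimpleGraph V) (a b : V → V) (x : V → ℝ) :
    numN (gForm a b x) (cycSp H) ≤
      ∑ C : H.ConnectedComponent, numN (gForm a b x) (cycSp (compG H C)) := by
  unfold numN
  rw [Finset.sum_add_distrib]
  refine add_le_add ?_ ?_
  · exact finrank_le_sum _ _ (restr H) (fun C z hz => restr_mem C hz)
      fun z _ h => eq_zero_of_restr h
  · exact finrank_le_sum _ _ (restr H) (fun C z hz => restr_mem_rad C a b x hz)
      fun z _ h => eq_zero_of_restr h

lemma finrank_chainSp (K : SimpleGraph V) :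
    Module.finrank ℝ (chainSp K) ≤ K.edgeSet.ncard := by
  classical
  have hc : Module.finrank ℝ (K.edgeSet → ℝ) = K.edgeSet.ncard := by
    rw [Module.finrank_fintype_fun_eq_card, ← Nat.card_eq_fintype_card, Nat.card_coe_set_eq]
  rw [← hc]
  let g : chainSp K →ₗ[ℝ] (K.edgeSet → ℝ) :=
    { toFun := fun z e => z.1 (Quot.out e.1).1 (Quot.out e.1).2
      map_add' := fun _ _ => rfl
      map_smul' := fun _ _ => rfl }
  refine LinearMap.finrank_le_finrank_of_injective (f := g) ?_
  rw [← LinearMap.ker_eq_bot, LinearMap.ker_eq_bot']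
  intro z hz
  apply Subtype.ext
  ext u v
  by_cases h : K.Adj u v
  · have h1 := congrFun hz ⟨s(u, v), h⟩
    have h2 : s((Quot.out s(u, v)).1, (Quot.out s(u, v)).2) = s(u, v) := Quot.out_eq s(u, v)
    have h3 : z.1 (Quot.out s(u, v)).1 (Quot.out s(u, v)).2 = 0 := h1
    rcases Sym2.eq_iff.1 h2 with ⟨e1, e2⟩ | ⟨e1, e2⟩
    · rw [e1, e2] at h3; exact h3
    · rw [e1, e2] at h3
      rw [z.2.1, h3]; simp
  · exact z.2.2 u v h

lemma compG_reachable {H : SimpleGraph V} {u v : V} (h : H.Reachable u v) :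
    (compG H (H.connectedComponentMk u)).Reachable u v := by
  obtain ⟨p⟩ := h
  induction p with
  | nil => exact Reachable.refl _
  | cons hadj p ih =>
    have := ConnectedComponent.connectedComponentMk_eq_of_adj hadj
    rw [← this] at ih
    have hadj' : (compG H (H.connectedComponentMk _)).Adj _ _ := ⟨hadj, rfl⟩
    exact hadj'.reachable.trans ih

lemma finrank_comp (H : SimpleGraph V) (C : H.ConnectedComponent) :
    Module.finrank ℝ (cycSp (compG H C)) + C.supp.ncard ≤ (compG H C).edgeSet.ncard + 1 := by
  classical
  obtain ⟨v0, hv0⟩ := C.exists_rep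
  have hv0' : H.connectedComponentMk v0 = C := hv0
  let T := {u : V // H.connectedComponentMk u = C ∧ u ≠ v0}
  let f : chainSp (compG H C) →ₗ[ℝ] (T → ℝ) :=
    { toFun := fun z u => bdry z.1 u.1
      map_add' := fun a b => by ext u; simp
      map_smul' := fun c a => by ext u; simp }
  have hsurj : Function.Surjective f := by
    rw [← LinearMap.range_eq_top, eq_top_iff, ← (Pi.basisFun ℝ T).span_eq, Submodule.span_le]
    rintro _ ⟨u, rfl⟩
    have hr : (compG H C).Reachable v0 u.1 := by
      have := compG_reachable (H := H) (u := v0) (v := u.1)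
        (ConnectedComponent.eq.1 (by rw [hv0', u.2.1]))
      rwa [hv0'] at this
    obtain ⟨z, hz, hz'⟩ := exists_flow hr.symm
    refine ⟨⟨z, hz⟩, ?_⟩
    ext w
    show bdry z w.1 = _
    rw [hz']
    have : w.1 ≠ v0 := w.2.2
    by_cases hwu : w = u
    · simp [hwu, Pi.single_apply, u.2.2]
    · have hwu' : w.1 ≠ u.1 := fun h => hwu (Subtype.ext h)
      simp [Pi.single_apply, this, hwu, hwu']
  have h1 := LinearMap.finrank_range_add_finrank_ker f
  rw [LinearMap.range_eq_top.2 hsurj, finrank_top, Module.finrank_fintype_fun_eq_card] at h1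
  have h2 : Module.finrank ℝ (cycSp (compG H C)) ≤ Module.finrank ℝ (LinearMap.ker f) := by
    let g : cycSp (compG H C) →ₗ[ℝ] LinearMap.ker f :=
      { toFun := fun z => ⟨⟨z.1, z.2.1⟩, by
          rw [LinearMap.mem_ker]
          ext u
          exact congrFun (LinearMap.mem_ker.1 z.2.2) u.1⟩
        map_add' := fun _ _ => rfl
        map_smul' := fun _ _ => rfl }
    refine LinearMap.finrank_le_finrank_of_injective (f := g) ?_
    intro z z' h
    exact Subtype.ext (congrArg (fun t => t.1.1) h)
  have h3 := finrank_chainSp (compG H C)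
  have h4 : C.supp.ncard = Fintype.card T + 1 := by
    have e1 : Fintype.card T = (C.supp \ {v0}).ncard := by
      rw [← Nat.card_eq_fintype_card, ← Nat.card_coe_set_eq]
      rfl
    rw [e1, Set.ncard_sdiff_singleton_add_one]
    exact hv0'
  omega

lemma finrank_rad_comp {G H : SimpleGraph V} (hHG : H ≤ G) {a b : V → V}
    (hab : ∀ v, GoodPair G v (a v) (b v)) (x : V → ℝ)
    (hx : ∀ v, ∀ z₁ ∈ radOn (gForm a b x) (cycSp H), ∀ z₂ ∈ radOn (gForm a b x) (cycSp H),
      z₁ v (a v) * z₂ v (b v) - z₁ v (b v) * z₂ v (a v) = 0)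
    (hH : ∀ u w, H.Adj u w → ∃ z ∈ radOn (gForm a b x) (cycSp H), z u w ≠ 0)
    (C : H.ConnectedComponent) :
    Module.finrank ℝ (radOn (gForm a b x) (cycSp (compG H C))) ≤ 1 := by
  classical
  have key : ∀ z ∈ radOn (gForm a b x) (cycSp H), ∀ v w, H.Adj v w → z v w = 0 →
      ∀ w', z v w' = 0 := by
    intro z hz v w hvw hzero
    obtain ⟨y, hy, hyne⟩ := hH v w hvw
    have hpar := hx v z hz y hy
    have hyab : y v (a v) ≠ 0 ∨ y v (b v) ≠ 0 := by
      by_contra hcon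
      push Not at hcon
      exact hyne (zero_of_goodPair hHG (hab v) hy.1 hcon.1 hcon.2 w)
    obtain ⟨c, hc1, hc2⟩ : ∃ c : ℝ, z v (a v) = c * y v (a v) ∧ z v (b v) = c * y v (b v) := by
      rcases hyab with h | h
      · refine ⟨z v (a v) / y v (a v), by field_simp, ?_⟩
        field_simp
        linarith
      · refine ⟨z v (b v) / y v (b v), ?_, by field_simp⟩
        field_simp
        linarith
    have hmem : z - c • y ∈ cycSp H :=
      Submodule.sub_mem _ hz.1 (Submodule.smul_mem _ _ hy.1)
    have hall := zero_of_goodPair hHG (hab v) hmem (by simp [hc1]) (by simp [hc2])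
    have hc0 : c = 0 := by
      have := hall w
      simp only [Pi.sub_apply, Pi.smul_apply, smul_eq_mul, hzero, zero_sub, neg_eq_zero] at this
      exact (mul_eq_zero.1 this).resolve_right hyne
    intro w'
    have := hall w'
    simpa [hc0] using this
  have prop : ∀ z ∈ radOn (gForm a b x) (cycSp H), ∀ v u, H.Reachable v u →
      (∀ w, z v w = 0) → ∀ w, z u w = 0 := by
    rintro z hz v u ⟨p⟩
    induction p with
    | nil => exact id
    | cons hadj p ih =>
      intro h
      refine ih ?_
      refine key z hz _ _ hadj.symm ?_
      rw [(mem_cycSp.1 hz.1).1.1, h, neg_zero]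
  obtain ⟨v0, hv0⟩ := C.exists_rep
  have hv0' : H.connectedComponentMk v0 = C := hv0
  obtain ⟨w0, hw0⟩ : ∃ w0, ∀ z ∈ radOn (gForm a b x) (cycSp H), z v0 w0 = 0 →
      ∀ w, z v0 w = 0 := by
    by_cases h : ∃ w, H.Adj v0 w
    · obtain ⟨w, hw⟩ := h
      exact ⟨w, fun z hz => key z hz v0 w hw⟩
    · push Not at h
      exact ⟨v0, fun z hz _ w => (mem_cycSp.1 hz.1).1.2 v0 w (h w)⟩
  have hinj : Function.Injective ((ev v0 w0).comp
      (radOn (gForm a b x) (cycSp (compG H C))).subtype) := by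
    rw [← LinearMap.ker_eq_bot, LinearMap.ker_eq_bot']
    intro z hz
    apply Subtype.ext
    have hzR := radOn_comp_le C a b x z.2
    ext u w
    by_cases hu : H.connectedComponentMk u = C
    · refine prop z.1 hzR v0 u (ConnectedComponent.eq.1 ?_) (hw0 z.1 hzR hz) w
      rw [hv0', hu]
    · exact zero_off z.2.1 hu w
  simpa using LinearMap.finrank_le_finrank_of_injective hinj

open Classical in
/-- The min-max type upper bound on the feedback vertex number. -/
theorem exists_cover {G : SimpleGraph V} (hG : Subcubic G) :
    ∃ H ≤ G, fvs G ≤ ∑ C : H.ConnectedComponent,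
      ((compG H C).edgeSet.ncard + 2 - C.supp.ncard) / 2 := by
  choose a b hab using exists_goodPair hG
  obtain ⟨x, hx⟩ := exists_generic (fun v => ev v (a v)) (fun v => ev v (b v))
    (fun H : SimpleGraph V => cycSp H)
  have : Nonempty {H : SimpleGraph V // H ≤ G ∧
      numN (gForm a b x) (cycSp G) ≤ numN (gForm a b x) (cycSp H)} := ⟨⟨G, le_rfl, le_rfl⟩⟩
  obtain ⟨⟨H, hHG, hN⟩, hmin⟩ := exists_nat_min (fun H : {H : SimpleGraph V // H ≤ G ∧
      numN (gForm a b x) (cycSp G) ≤ numN (gForm a b x) (cycSp H)} => H.1.edgeSet.ncard)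
  refine ⟨H, hHG, ?_⟩
  have hH : ∀ u w, H.Adj u w → ∃ z ∈ radOn (gForm a b x) (cycSp H), z u w ≠ 0 := by
    intro u w huw
    by_contra hcon
    push Not at hcon
    have h1 := numN_keep (gForm_alt a b x) (cycSp H) (ev u w) hcon
    rw [← cycSp_deleteEdge] at h1
    have h2 := hmin ⟨H.deleteEdges {s(u, w)}, (deleteEdges_le _).trans hHG, hN.trans h1⟩
    have h3 : (H.deleteEdges {s(u, w)}).edgeSet.ncard < H.edgeSet.ncard := by
      apply Set.ncard_lt_ncard _ (Set.toFinite _)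
      rw [edgeSet_deleteEdges]
      refine ⟨Set.sdiff_subset, fun h => ?_⟩
      have : s(u, w) ∈ H.edgeSet := huw
      exact (h this).2 rfl
    exact absurd h3 (not_lt.2 h2)
  have hfv : 2 * fvs G ≤ numN (gForm a b x) (cycSp G) := by
    obtain ⟨S, hS, hS'⟩ := exists_fvs_le (G := G) x _ G le_rfl (rfl : numN (gForm a b x) (cycSp G) = _)
    have : fvs G ≤ S.ncard := Nat.sInf_le ⟨S, hS, rfl⟩
    omega
  have h5 : numN (gForm a b x) (cycSp H) ≤ ∑ C : H.ConnectedComponent,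
      2 * (((compG H C).edgeSet.ncard + 2 - C.supp.ncard) / 2) := by
    refine (numN_le_sum H a b x).trans (Finset.sum_le_sum fun C _ => ?_)
    have e1 := finrank_comp H C
    have e2 := finrank_rad_comp hHG hab x (hx H) hH C
    have e3 := numN_even (gForm_alt a b x) (cycSp (compG H C))
    obtain ⟨k, hk⟩ := e3
    rw [hk]
    unfold numN at hk
    omega
  rw [← Finset.mul_sum] at h5
  omega

end Comp



section Count

set_option linter.unusedSectionVars false

/-- Triangle-free. -/
def TF {V : Type} (G : SimpleGraph V) : Prop :=
  ∀ a b c, G.Adj a b → G.Adj b c → G.Adj a c → False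

lemma TF_of_egirth {V : Type} {G : SimpleGraph V} (h : 4 ≤ G.egirth) : TF G := by
  intro a b c hab hbc hac
  rw [le_egirth] at h
  have h1 := h a (Walk.cons hab (Walk.cons hbc (Walk.cons hac.symm Walk.nil))) (by
    rw [Walk.cons_isCycle_iff]
    simp [Walk.cons_isPath_iff, hab.ne, hbc.ne, hac.ne, hab.ne', hac.ne'])
  have h2 : ((4 : ℕ) : ℕ∞) ≤ ((3 : ℕ) : ℕ∞) := by simpa using h1
  rw [Nat.cast_le] at h2
  omega

lemma TF_induce {V : Type} {H : SimpleGraph V} (h : TF H) (s : Set V) : TF (H.induce s) :=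
  fun a b c h1 h2 h3 => h a b c h1 h2 h3

lemma TF_mono {V : Type} {H G : SimpleGraph V} (hHG : H ≤ G) (h : TF G) : TF H :=
  fun a b c h1 h2 h3 => h a b c (hHG h1) (hHG h2) (hHG h3)

lemma subcubic_mono {V : Type} [Finite V] {H G : SimpleGraph V} (hHG : H ≤ G) (h : Subcubic G) :
    Subcubic H := fun v =>
  (Set.ncard_le_ncard (fun _ hw => hHG hw) (Set.toFinite _)).trans (h v)

lemma ncard_induce_neighbor {V : Type} [Finite V] (H : SimpleGraph V) (s : Set V) (v : s) :
    ((H.induce s).neighborSet v).ncard = (Subtype.val '' (H.induce s).neighborSet v).ncard :=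
  (Set.ncard_image_of_injective _ Subtype.val_injective).symm

lemma subcubic_induce {V : Type} [Finite V] {H : SimpleGraph V} (h : Subcubic H) (s : Set V) :
    Subcubic (H.induce s) := by
  intro v
  rw [ncard_induce_neighbor]
  refine (Set.ncard_le_ncard ?_ (Set.toFinite _)).trans (h v)
  rintro _ ⟨w, hw, rfl⟩
  exact hw

lemma ncard_neighbor {V : Type} [Fintype V] (G : SimpleGraph V) [DecidableRel G.Adj] (v : V) :
    (G.neighborSet v).ncard = G.degree v := by
  rw [← card_neighborFinset_eq_degree, ← Set.ncard_coe_finset, coe_neighborFinset]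

lemma ncard_edges {V : Type} [Fintype V] (G : SimpleGraph V) [DecidableRel G.Adj] [DecidableEq V] :
    G.edgeSet.ncard = G.edgeFinset.card := by
  rw [← coe_edgeFinset, Set.ncard_coe_finset]

lemma handshake {V : Type} [Fintype V] (G : SimpleGraph V) :
    ∑ v, (G.neighborSet v).ncard = 2 * G.edgeSet.ncard := by
  classical
  rw [ncard_edges, ← sum_degrees_eq_twice_card_edges]
  exact Finset.sum_congr rfl fun v _ => ncard_neighbor G v

lemma two_m_le {V : Type} [Finite V] {G : SimpleGraph V} (h : Subcubic G) :
    2 * G.edgeSet.ncard ≤ 3 * Nat.card V := by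
  classical
  have := Fintype.ofFinite V
  rw [← handshake, Nat.card_eq_fintype_card]
  refine (Finset.sum_le_sum fun v _ => h v).trans ?_
  simp [mul_comm]

lemma all_three {V : Type} [Finite V] {G : SimpleGraph V} (h : Subcubic G)
    (he : 2 * G.edgeSet.ncard = 3 * Nat.card V) (v : V) : (G.neighborSet v).ncard = 3 := by
  classical
  have := Fintype.ofFinite V
  by_contra hne
  have hlt : (G.neighborSet v).ncard < 3 := lt_of_le_of_ne (h v) hne
  have : ∑ v, (G.neighborSet v).ncard < ∑ _v : V, 3 :=
    Finset.sum_lt_sum (fun v _ => h v) ⟨v, Finset.mem_univ v, hlt⟩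
  rw [handshake, he, Nat.card_eq_fintype_card] at this
  simp [mul_comm] at this

lemma mantel {V : Type} [Finite V] {G : SimpleGraph V} (h : TF G) :
    4 * G.edgeSet.ncard ≤ Nat.card V ^ 2 := by
  classical
  have := Fintype.ofFinite V
  rw [ncard_edges, Nat.card_eq_fintype_card]
  by_cases hV : Nonempty V
  · obtain ⟨u, hu⟩ := G.exists_maximal_degree_vertex
    have hsub : G.edgeFinset ⊆ (G.neighborFinset u)ᶜ.biUnion fun v => G.incidenceFinset v := by
      intro e he
      induction e with
      | _ a b =>
        rw [mem_edgeFinset, mem_edgeSet] at he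
        rw [Finset.mem_biUnion]
        by_cases ha : G.Adj u a
        · refine ⟨b, ?_, ?_⟩
          · simp only [Finset.mem_compl, mem_neighborFinset]
            exact fun hb => h u a b ha he hb
          · rw [mem_incidenceFinset]; exact ⟨he, by simp⟩
        · refine ⟨a, ?_, ?_⟩
          · simpa using ha
          · rw [mem_incidenceFinset]; exact ⟨he, by simp⟩
    have h1 := Finset.card_le_card hsub
    have h2 := Finset.card_biUnion_le (s := (G.neighborFinset u)ᶜ) (t := fun v => G.incidenceFinset v)
    have h3 : ∑ v ∈ (G.neighborFinset u)ᶜ, (G.incidenceFinset v).card ≤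
        (G.neighborFinset u)ᶜ.card * G.degree u := by
      rw [← smul_eq_mul]
      refine Finset.sum_le_card_nsmul _ _ _ fun v _ => ?_
      rw [card_incidenceFinset_eq_degree, ← hu]
      exact G.degree_le_maxDegree v
    have h4 : (G.neighborFinset u)ᶜ.card + G.degree u = Fintype.card V := by
      rw [← card_neighborFinset_eq_degree, Finset.card_compl_add_card]
    rw [← h4]
    have h5 := (h1.trans h2).trans h3
    nlinarith [sq_nonneg (((G.neighborFinset u)ᶜ.card : ℤ) - G.degree u),
      two_mul_le_add_sq ((G.neighborFinset u)ᶜ.card) (G.degree u)]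
  · have hE : G.edgeFinset = ∅ := by
      rw [Finset.eq_empty_iff_forall_notMem]
      intro e
      induction e with
      | _ a b => exact absurd ⟨a⟩ hV
    simp [hE]

variable {V : Type} [Fintype V]

lemma compG_edges (H : SimpleGraph V) (C : H.ConnectedComponent) :
    (compG H C).edgeSet.ncard = (H.induce C.supp).edgeSet.ncard := by
  have h1 : compG H C = (H.induce C.supp).map (Function.Embedding.subtype _) := by
    ext a b
    rw [map_adj]
    constructor
    · rintro ⟨hab, ha⟩
      refine ⟨⟨a, ha⟩, ⟨b, ?_⟩, hab, rfl, rfl⟩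
      rw [ConnectedComponent.mem_supp_iff,
        ← ConnectedComponent.connectedComponentMk_eq_of_adj hab, ha]
    · rintro ⟨u, v, huv, rfl, rfl⟩
      exact ⟨huv, u.2⟩
  rw [h1, edgeSet_map, Set.ncard_image_of_injective _ (Function.Embedding.injective _)]

open Classical in
lemma sum_comp_edges (H : SimpleGraph V) :
    ∑ C : H.ConnectedComponent, (compG H C).edgeSet.ncard = H.edgeSet.ncard := by
  have h1 : H.edgeSet = ⋃ C : H.ConnectedComponent, (compG H C).edgeSet := by
    ext e
    induction e with
    | _ a b =>
      rw [Set.mem_iUnion]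
      exact ⟨fun h => ⟨H.connectedComponentMk a, h, rfl⟩, fun ⟨C, h⟩ => h.1⟩
  rw [h1, Set.ncard_iUnion_of_finite (fun _ => Set.toFinite _), finsum_eq_sum_of_fintype]
  intro C D hCD
  rw [Function.onFun, Set.disjoint_left]
  intro e
  induction e with
  | _ a b =>
    intro h1 h2
    exact hCD (h1.2.symm.trans h2.2)

lemma card_comp_le {K H : SimpleGraph V} (hK : K.Connected) :
    Nat.card H.ConnectedComponent ≤ (K.edgeSet \ H.edgeSet).ncard + 1 := by
  classical
  let Q : SimpleGraph H.ConnectedComponent :=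
    { Adj := fun C D => C ≠ D ∧ ∃ u v, H.connectedComponentMk u = C ∧
        H.connectedComponentMk v = D ∧ K.Adj u v
      symm := ⟨fun C D h => ⟨h.1.symm, by
        obtain ⟨u, v, h1, h2, h3⟩ := h.2
        exact ⟨v, u, h2, h1, h3.symm⟩⟩⟩
      loopless := ⟨fun C h => h.1 rfl⟩ }
  have hreach : ∀ u v, K.Reachable u v →
      Q.Reachable (H.connectedComponentMk u) (H.connectedComponentMk v) := by
    rintro u v ⟨p⟩
    induction p with
    | nil => exact Reachable.refl _
    | @cons a b c hadj p ih =>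
      refine Reachable.trans ?_ ih
      by_cases h : H.connectedComponentMk a = H.connectedComponentMk b
      · rw [h]
      · have : Q.Adj (H.connectedComponentMk a) (H.connectedComponentMk b) :=
          ⟨h, a, b, rfl, rfl, hadj⟩
        exact this.reachable
  have hQ : Q.Connected := by
    have : Nonempty V := hK.nonempty
    have hne : Nonempty H.ConnectedComponent := ⟨H.connectedComponentMk (Classical.arbitrary V)⟩
    refine ⟨fun C D => ?_⟩
    induction C using ConnectedComponent.ind with
    | _ u =>
      induction D using ConnectedComponent.ind with
      | _ v => exact hreach u v (hK.preconnected u v)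
  have h1 := hQ.card_vert_le_card_edgeSet_add_one
  rw [Nat.card_coe_set_eq] at h1
  have h2 : Q.edgeSet ⊆ Sym2.map H.connectedComponentMk '' (K.edgeSet \ H.edgeSet) := by
    intro e
    induction e with
    | _ C D =>
      rintro ⟨hne, u, v, rfl, rfl, h3⟩
      refine ⟨s(u, v), ⟨h3, fun h => hne ?_⟩, rfl⟩
      exact ConnectedComponent.connectedComponentMk_eq_of_adj h
  have h3 := Set.ncard_le_ncard h2 (Set.toFinite _)
  have h4 := Set.ncard_image_le (f := Sym2.map H.connectedComponentMk)
    (Set.toFinite (K.edgeSet \ H.edgeSet))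
  omega

/-- The numeric classification of components with positive deficiency. -/
lemma numeric {n m : ℕ} (h0 : 1 ≤ n) (h1 : n ≤ m + 1) (h2 : 2 * m ≤ 3 * n) (h3 : 4 * m ≤ n ^ 2)
    (hpos : 2 * m < 9 * ((m + 2 - n) / 2)) :
    (n = 4 ∧ m = 4) ∨ (n = 6 ∧ m = 8) ∨ (n = 8 ∧ m = 12) ∨ (n = 9 ∧ m = 13) := by
  have h4 : n < 12 := by omega
  interval_cases n <;> omega

end Count



section Main

lemma cubic_component {V : Type} [Finite V] {G H : SimpleGraph V} (hconn : G.Connected)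
    (hsub : Subcubic G) (hHG : H ≤ G) (C : H.ConnectedComponent)
    (h3 : ∀ v, ((H.induce C.supp).neighborSet v).ncard = 3) : H = G ∧ C.supp = Set.univ := by
  have key : ∀ v ∈ C.supp, ∀ w, G.Adj v w → H.Adj v w ∧ w ∈ C.supp := by
    intro v hv w hvw
    have h1 := h3 ⟨v, hv⟩
    rw [ncard_induce_neighbor] at h1
    have hss : Subtype.val '' (H.induce C.supp).neighborSet ⟨v, hv⟩ ⊆ G.neighborSet v := by
      rintro _ ⟨x, hx, rfl⟩
      exact hHG hx
    have heq := Set.eq_of_subset_of_ncard_le hss (by rw [h1]; exact hsub v) (Set.toFinite _)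
    have hw : w ∈ G.neighborSet v := hvw
    rw [← heq] at hw
    obtain ⟨x, hx, rfl⟩ := hw
    exact ⟨hx, x.2⟩
  have hall : ∀ u v, G.Reachable u v → u ∈ C.supp → v ∈ C.supp := by
    rintro u v ⟨p⟩
    induction p with
    | nil => exact id
    | cons hadj p ih => exact fun h => ih (key _ h _ hadj).2
  obtain ⟨v0, hv0⟩ := C.exists_rep
  have huniv : C.supp = Set.univ := by
    rw [Set.eq_univ_iff_forall]
    exact fun v => hall v0 v (hconn.preconnected v0 v) hv0
  refine ⟨le_antisymm hHG fun u v huv => ?_, huniv⟩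
  exact (key u (by rw [huniv]; trivial) v huv).1

open Classical in
lemma main_aux {V : Type} [Fintype V] (G : SimpleGraph V)
    (hconn : G.Connected) (hsub : Subcubic G) (htf : TF G)
    (cls4 : ∀ {W : Type} [Finite W] (K : SimpleGraph W), Subcubic K → TF K → Nat.card W = 4 →
      K.edgeSet.ncard = 4 → MemF 4 0 K)
    (cls6 : ∀ {W : Type} [Finite W] (K : SimpleGraph W), Subcubic K → TF K → Nat.card W = 6 →
      K.edgeSet.ncard = 8 → Nonempty (K ≃g Lgraph))
    (cls8 : ∀ {W : Type} [Finite W] (K : SimpleGraph W), Subcubic K → TF K → Nat.card W = 8 →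
      K.edgeSet.ncard = 12 → Nonempty (K ≃g Q3) ∨ Nonempty (K ≃g V8))
    (cls9 : ∀ {W : Type} [Finite W] (K : SimpleGraph W), Subcubic K → TF K → Nat.card W = 9 →
      K.edgeSet.ncard = 13 → MemF 3 2 K) :
    ((Nonempty (G ≃g Q3) ∨ Nonempty (G ≃g V8)) ∧
      9 * fvs G = 2 * G.edgeSet.ncard + 3) ∨
    ((∃ (ι : Type) (P : V → ι) (H : SimpleGraph V),
        AddCutEdges H G ∧ PartitionedBy H P ∧
        ∀ i : ι, Nonempty ((H.induce (P ⁻¹' {i})) ≃g Lgraph)) ∧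
      9 * fvs G = 2 * G.edgeSet.ncard + 2) ∨
    ((∃ (ι : Type) (P : V → Option ι) (H : SimpleGraph V),
        AddCutEdges H G ∧ PartitionedBy H P ∧
        (MemF 3 2 (H.induce (P ⁻¹' {none})) ∨ MemF 4 0 (H.induce (P ⁻¹' {none}))) ∧
        ∀ i : ι, Nonempty ((H.induce (P ⁻¹' {some i})) ≃g Lgraph)) ∧
      9 * fvs G = 2 * G.edgeSet.ncard + 1) ∨
    9 * fvs G ≤ 2 * G.edgeSet.ncard := by
  by_cases hbig : 9 * fvs G ≤ 2 * G.edgeSet.ncard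
  · exact Or.inr (Or.inr (Or.inr hbig))
  obtain ⟨H, hHG, hcov⟩ := exists_cover hsub
  let n : H.ConnectedComponent → ℕ := fun C => C.supp.ncard
  let m : H.ConnectedComponent → ℕ := fun C => (compG H C).edgeSet.ncard
  let q : H.ConnectedComponent → ℕ := fun C => (m C + 2 - n C) / 2
  let A := G.edgeSet \ H.edgeSet
  have hcov' : fvs G ≤ ∑ C, q C := hcov
  have hm : ∑ C, m C + A.ncard = G.edgeSet.ncard := by
    have h1 : ∑ C, m C = H.edgeSet.ncard := sum_comp_edges H
    rw [h1, add_comm]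
    exact Set.ncard_sdiff_add_ncard_of_subset (edgeSet_mono hHG)
  have hcA : Fintype.card H.ConnectedComponent ≤ A.ncard + 1 := by
    have := card_comp_le (H := H) hconn
    rwa [Nat.card_eq_fintype_card] at this
  have hsC : ∀ C : H.ConnectedComponent, Subcubic (H.induce C.supp) := fun C =>
    subcubic_induce (subcubic_mono hHG hsub) _
  have htC : ∀ C : H.ConnectedComponent, TF (H.induce C.supp) := fun C =>
    TF_induce (TF_mono hHG htf) _
  have hnC : ∀ C : H.ConnectedComponent, Nat.card C.supp = n C := fun C =>
    Nat.card_coe_set_eq _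
  have hmC : ∀ C : H.ConnectedComponent, (H.induce C.supp).edgeSet.ncard = m C := fun C =>
    (compG_edges H C).symm
  have hnum : ∀ C, 2 * m C < 9 * q C →
      (n C = 4 ∧ m C = 4) ∨ (n C = 6 ∧ m C = 8) ∨ (n C = 8 ∧ m C = 12) ∨
        (n C = 9 ∧ m C = 13) := by
    intro C hC
    have e1 := finrank_comp H C
    have e2 := two_m_le (hsC C)
    have e3 := mantel (htC C)
    rw [hnC, hmC] at e2 e3
    have e0 : 1 ≤ n C := by
      obtain ⟨v, hv⟩ := C.exists_rep
      exact (Set.ncard_pos (Set.toFinite _)).2 ⟨v, hv⟩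
    refine numeric e0 ?_ e2 e3 hC
    show C.supp.ncard ≤ (compG H C).edgeSet.ncard + 1
    omega
  by_cases h8 : ∃ C, n C = 8 ∧ m C = 12
  · obtain ⟨C, hC1, hC2⟩ := h8
    have h3 := all_three (hsC C) (by rw [hnC, hmC, hC1, hC2])
    obtain ⟨heq, huniv⟩ := cubic_component hconn hsub hHG C h3
    left
    subst heq
    have hiso := cls8 (H.induce C.supp) (hsC C) (htC C) (by rw [hnC, hC1]) (by rw [hmC, hC2])
    have hone : ∀ D, D = C := by
      intro D
      obtain ⟨v, hv⟩ := D.exists_rep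
      have : v ∈ C.supp := by rw [huniv]; trivial
      have h1 : H.connectedComponentMk v = C := this
      rw [← h1, ← hv]; rfl
    have hq : ∑ D, q D = q C := by
      rw [Finset.sum_eq_single C]
      · intro D _ hD; exact absurd (hone D) hD
      · simp
    have hms : ∑ D, m D = m C := by
      rw [Finset.sum_eq_single C]
      · intro D _ hD; exact absurd (hone D) hD
      · simp
    have hA : A.ncard = 0 := by simp [A]
    have hqC : q C = 3 := by
      show (m C + 2 - n C) / 2 = 3
      rw [hC1, hC2]
    constructor
    · rw [huniv] at hiso
      rcases hiso with ⟨⟨f⟩⟩ | ⟨⟨f⟩⟩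
      · exact Or.inl ⟨(induceUnivIso H).symm.trans f⟩
      · exact Or.inr ⟨(induceUnivIso H).symm.trans f⟩
    · omega
  push Not at h8
  right
  have hd2 : ∀ C, 9 * q C ≤ 2 * m C + 2 := by
    intro C
    by_contra hcon
    have hq : q C = (m C + 2 - n C) / 2 := rfl
    rcases hnum C (by omega) with h | h | h | h
    · omega
    · omega
    · exact h8 C h.1 h.2
    · omega
  -- the slack
  have hslack : ∑ C, (2 * m C + 2 - 9 * q C) + 9 * ∑ C, q C =
      2 * ∑ C, m C + 2 * Fintype.card H.ConnectedComponent := by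
    rw [Finset.mul_sum, Finset.mul_sum, ← Finset.sum_add_distrib]
    have : 2 * Fintype.card H.ConnectedComponent = ∑ _C : H.ConnectedComponent, 2 := by
      simp [mul_comm]
    rw [this, ← Finset.sum_add_distrib]
    exact Finset.sum_congr rfl fun C _ => by have := hd2 C; omega
  have hAc : A.ncard + 1 = Fintype.card H.ConnectedComponent := by omega
  have hle1 : ∑ C, (2 * m C + 2 - 9 * q C) ≤ 1 := by omega
  have hcut : AddCutEdges H G := by
    refine ⟨hHG, ?_⟩
    intro e he
    induction e with
    | _ u v =>
      by_contra hb
      have hc := hconn.connected_delete_edge_of_not_isBridge hb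
      have h1 := card_comp_le (H := H) hc
      rw [Nat.card_eq_fintype_card] at h1
      have h2 : ((G.deleteEdges {s(u, v)}).edgeSet \ H.edgeSet).ncard < A.ncard := by
        apply Set.ncard_lt_ncard _ (Set.toFinite _)
        rw [edgeSet_deleteEdges]
        refine ⟨fun x hx => ⟨hx.1.1, hx.2⟩, fun h => ?_⟩
        exact (h he).1.2 rfl
      omega
  have hL : ∀ C, 2 * m C + 2 - 9 * q C = 0 → Nonempty ((H.induce C.supp) ≃g Lgraph) ∧ m C = 8 := by
    intro C hC
    have hq : q C = (m C + 2 - n C) / 2 := rfl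
    rcases hnum C (by omega) with h | h | h | h
    · omega
    · exact ⟨cls6 _ (hsC C) (htC C) (by rw [hnC, h.1]) (by rw [hmC, h.2]), h.2⟩
    · exact absurd h.2 (h8 C h.1)
    · omega
  by_cases hz : ∑ C, (2 * m C + 2 - 9 * q C) = 0
  · left
    have hz' : ∀ C, 2 * m C + 2 - 9 * q C = 0 := by
      rw [Finset.sum_eq_zero_iff] at hz
      exact fun C => hz C (Finset.mem_univ C)
    refine ⟨⟨H.ConnectedComponent, H.connectedComponentMk, H, hcut, ?_, ?_⟩, ?_⟩
    · exact fun u v huv => ConnectedComponent.connectedComponentMk_eq_of_adj huv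
    · exact fun C => (hL C (hz' C)).1
    · have hsum : ∑ C, m C = 8 * Fintype.card H.ConnectedComponent := by
        rw [Finset.sum_congr rfl fun C _ => (hL C (hz' C)).2]
        simp [mul_comm]
      omega
  · right; left
    obtain ⟨C0, -, hC0⟩ := Finset.exists_ne_zero_of_sum_ne_zero hz
    have hsplit := Finset.add_sum_erase Finset.univ (fun C => 2 * m C + 2 - 9 * q C)
      (Finset.mem_univ C0)
    have hC0' : 2 * m C0 + 2 - 9 * q C0 = 1 := by omega
    have hrest : ∑ C ∈ Finset.univ.erase C0, (2 * m C + 2 - 9 * q C) = 0 := by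
      omega
    have hz' : ∀ C, C ≠ C0 → 2 * m C + 2 - 9 * q C = 0 := by
      rw [Finset.sum_eq_zero_iff] at hrest
      exact fun C hC => hrest C (by simp [hC])
    let P : V → Option {C : H.ConnectedComponent // C ≠ C0} := fun v =>
      if h : H.connectedComponentMk v = C0 then none else some ⟨H.connectedComponentMk v, h⟩
    have hP0 : P ⁻¹' {none} = C0.supp := by
      ext v
      simp only [Set.mem_preimage, Set.mem_singleton_iff, ConnectedComponent.mem_supp_iff, P]
      split_ifs with h <;> simp [h]
    have hP1 : ∀ C : {C : H.ConnectedComponent // C ≠ C0}, P ⁻¹' {some C} = C.1.supp := by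
      intro C
      ext v
      simp only [Set.mem_preimage, Set.mem_singleton_iff, ConnectedComponent.mem_supp_iff, P]
      split_ifs with h
      · simp only [false_iff]
        exact fun h' => C.2 (h'.symm.trans h)
      · simp [Subtype.ext_iff]
    refine ⟨⟨_, P, H, hcut, ?_, ?_, ?_⟩, ?_⟩
    · intro u v huv
      simp only [P, ConnectedComponent.connectedComponentMk_eq_of_adj huv]
    · rw [hP0]
      have hq : q C0 = (m C0 + 2 - n C0) / 2 := rfl
      rcases hnum C0 (by omega) with h | h | h | h
      · exact Or.inr (cls4 _ (hsC C0) (htC C0) (by rw [hnC, h.1]) (by rw [hmC, h.2]))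
      · omega
      · exact absurd h.2 (h8 C0 h.1)
      · exact Or.inl (cls9 _ (hsC C0) (htC C0) (by rw [hnC, h.1]) (by rw [hmC, h.2]))
    · intro C
      rw [hP1]
      exact (hL C.1 (hz' C.1 C.2)).1
    · omega

end Main



/-- Adjacency bit. -/
def bit (g i j : ℕ) : Bool :=
  Nat.beq (Nat.land 1 (Nat.shiftRight g (Nat.add (Nat.mul 16 i) j))) 1

/-- Mask of a pair. -/
def pm (i j : ℕ) : ℕ := 2 ^ (16 * i + j) ||| 2 ^ (16 * j + i)

def degM (n g i : ℕ) : ℕ := (List.range n).countP (bit g i)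

def isoS (n g T : ℕ) : ℕ → List (ℕ × ℕ) → Bool
  | 0, _ => true
  | k + 1, l => (List.range n).any fun c =>
      l.all (fun p => bit g p.1 (n - (k + 1)) == bit T p.2 c && p.2 != c) &&
      degM n g (n - (k + 1)) == degM n T c && isoS n g T k ((n - (k + 1), c) :: l)

def search (n dsum : ℕ) (lo : ℕ → ℕ) (Ts : List ℕ) : List (ℕ × ℕ) → ℕ → ℕ → Bool
  | [], u, g => u == 0 && (((List.range n).map (degM n g)).sum != dsum ||
      Ts.any fun T => isoS n g T n [])
  | (i, j) :: ps, u, g =>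
      decide (i < n) && decide (j < n) && decide (n ≤ 16) && bit u i j && bit u j i &&
      (decide (degM n g i + degM n (u ^^^ pm i j) i < lo i) ||
        decide (degM n g j + degM n (u ^^^ pm i j) j < lo j) ||
        search n dsum lo Ts ps (u ^^^ pm i j) g) &&
      (decide (3 < degM n (g ||| pm i j) i) || decide (3 < degM n (g ||| pm i j) j) ||
        (List.range n).any (fun k => bit g i k && bit g j k) ||
        search n dsum lo Ts ps (u ^^^ pm i j) (g ||| pm i j))

def pairs (a n : ℕ) : List (ℕ × ℕ) :=
  ((List.range n).filter (fun i => a ≤ i)).flatMap fun i =>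
    ((List.range n).filter (fun j => i < j)).map fun j => (i, j)

def maskOf (l : List (ℕ × ℕ)) : ℕ := l.foldr (fun p m => m ||| pm p.1 p.2) 0

theorem s4 : search 4 8 (fun _ => 0)
   [maskOf [(0,1),(1,2),(2,3),(3,0)]] (pairs 0 4) (maskOf (pairs 0 4)) 0 = true := by decide +kernel
theorem s6 : search 6 16 (fun _ => 0)
   [maskOf [(0,2),(0,3),(1,2),(1,3),(0,4),(1,4),(2,5),(3,5)]] (pairs 1 6) (maskOf (pairs 1 6)) (maskOf [(0,1),(0,2),(0,3)]) = true := by decide +kernel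

theorem s8 : search 8 24 (fun _ => 3)
   [maskOf [(0,1),(0,2),(0,4),(1,3),(1,5),(2,3),(2,6),(3,7),(4,5),(4,6),(5,7),(6,7)],
    maskOf [(0,1),(1,2),(2,3),(3,4),(4,5),(5,6),(6,7),(7,0),(0,4),(1,5),(2,6),(3,7)]]
   (pairs 2 8) (maskOf (pairs 2 8)) (maskOf [(0,1),(0,2),(0,3),(1,4),(1,5)]) = true := by decide +kernel

theorem s9 : search 9 26 (fun i => if i = 0 then 2 else 3)
   [maskOf [(0,4),(4,1),(0,5),(5,2),(0,6),(6,3),(1,8),(8,2),(1,3),(2,3),(7,4),(7,5),(7,6)],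
    maskOf [(0,4),(4,1),(0,5),(5,2),(1,6),(6,2),(0,8),(8,3),(1,3),(2,3),(7,4),(7,5),(7,6)],
    maskOf [(0,4),(4,1),(0,5),(5,2),(1,6),(6,3),(2,8),(8,3),(0,3),(1,2),(7,4),(7,5),(7,6)],
    maskOf [(0,4),(4,1),(0,5),(5,2),(1,6),(6,3),(0,8),(8,3),(1,2),(2,3),(7,4),(7,5),(7,6)]]
   (pairs 2 9) (maskOf (pairs 2 9)) (maskOf [(0,1),(0,2),(1,3),(1,4)]) = true := by decide +kernel


lemma bit_eq (g i j : ℕ) : bit g i j = Nat.testBit g (16 * i + j) := by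
  have h : ∀ x : ℕ, Nat.beq (1 &&& x) 1 = ((1 &&& x) != 0) := by
    intro x
    rw [Nat.one_and_eq_mod_two]
    rcases Nat.mod_two_eq_zero_or_one x with h | h <;> rw [h] <;> rfl
  exact h _

lemma bit_or (g h i j : ℕ) : bit (g ||| h) i j = (bit g i j || bit h i j) := by
  simp [bit_eq]

lemma bit_xor (g h i j : ℕ) : bit (g ^^^ h) i j = (bit g i j ^^ bit h i j) := by
  simp [bit_eq]

lemma bit_pm {i j a b : ℕ} (hi : i < 16) (hj : j < 16) (ha : a < 16) (hb : b < 16) :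
    bit (pm i j) a b = decide ((a = i ∧ b = j) ∨ (a = j ∧ b = i)) := by
  simp only [bit_eq, pm, Nat.testBit_or, Nat.testBit_two_pow]
  rw [← Bool.decide_or, decide_eq_decide]
  omega

lemma search_sound (n dsum : ℕ) (lo : ℕ → ℕ) (Ts : List ℕ) (adj : ℕ → ℕ → Bool)
    (hsym : ∀ i j, adj i j = adj j i)
    (hlo : ∀ i < n, lo i ≤ (List.range n).countP (adj i))
    (hhi : ∀ i < n, (List.range n).countP (adj i) ≤ 3)
    (htf : ∀ i < n, ∀ j < n, ∀ k < n, adj i j = true → adj i k = true → adj j k = true → False)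
    (hsum : ((List.range n).map fun i => (List.range n).countP (adj i)).sum = dsum)
    (ps : List (ℕ × ℕ)) : ∀ u g : ℕ,
    (∀ i < n, ∀ j < n, bit g i j = (adj i j && !bit u i j)) →
    search n dsum lo Ts ps u g = true →
    ∃ T ∈ Ts, ∃ g', (∀ i < n, ∀ j < n, bit g' i j = adj i j) ∧ isoS n g' T n [] = true := by
  induction ps with
  | nil =>
    intro u g hinv hs
    simp only [search, Bool.and_eq_true, beq_iff_eq, Bool.or_eq_true, bne_iff_ne, ne_eq,
      List.any_eq_true] at hs
    obtain ⟨rfl, h⟩ := hs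
    have hg : ∀ i < n, ∀ j < n, bit g i j = adj i j := by
      intro i hi j hj
      rw [hinv i hi j hj]; simp [bit_eq]
    rcases h with h | ⟨T, hT, h⟩
    · exfalso
      apply h
      rw [← hsum]
      congr 1
      apply List.map_congr_left
      intro i hi
      apply List.countP_congr
      intro j hj
      rw [hg i (List.mem_range.1 hi) j (List.mem_range.1 hj)]
    · exact ⟨T, hT, g, hg, h⟩
  | cons p ps ih =>
    obtain ⟨i, j⟩ := p
    intro u g hinv hs
    simp only [search, Bool.and_eq_true, Bool.or_eq_true, decide_eq_true_eq,
      List.any_eq_true] at hs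
    obtain ⟨⟨⟨⟨⟨⟨hi, hj⟩, hn⟩, hu1⟩, hu2⟩, hA⟩, hB⟩ := hs
    have hu' : ∀ a < n, ∀ b < n, bit (u ^^^ pm i j) a b =
        (bit u a b && !decide ((a = i ∧ b = j) ∨ (a = j ∧ b = i))) := by
      intro a ha b hb
      rw [bit_xor, bit_pm (by omega) (by omega) (by omega) (by omega)]
      by_cases hp : (a = i ∧ b = j) ∨ (a = j ∧ b = i)
      · rcases hp with ⟨rfl, rfl⟩ | ⟨rfl, rfl⟩ <;> simp [hu1, hu2]
      · simp [hp]
    have hcnt : ∀ g', (∀ a < n, ∀ b < n, bit g' a b = (adj a b && !bit (u ^^^ pm i j) a b)) →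
        ∀ a < n, (List.range n).countP (adj a) ≤ degM n g' a + degM n (u ^^^ pm i j) a ∧
          degM n g' a ≤ (List.range n).countP (adj a) := by
      intro g' hg' a ha
      constructor
      · have : ∀ l : List ℕ, (∀ b ∈ l, b < n) → l.countP (adj a) ≤
            l.countP (bit g' a) + l.countP (bit (u ^^^ pm i j) a) := by
          intro l
          induction l with
          | nil => simp
          | cons b l ihl =>
            intro hl
            have h1 := ihl (fun b hb => hl b (List.mem_cons_of_mem _ hb))
            have h2 := hg' a ha b (hl b List.mem_cons_self)
            simp only [List.countP_cons]
            rw [h2]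
            cases adj a b <;> cases bit (u ^^^ pm i j) a b <;> simp <;> omega
        exact this _ (fun b hb => List.mem_range.1 hb)
      · apply List.countP_mono_left
        intro b hb h
        rw [hg' a ha b (List.mem_range.1 hb)] at h
        simp at h
        exact h.1
    by_cases hadj : adj i j = true
    · have hinv' : ∀ a < n, ∀ b < n,
          bit (g ||| pm i j) a b = (adj a b && !bit (u ^^^ pm i j) a b) := by
        intro a ha b hb
        rw [hu' a ha b hb, bit_or, hinv a ha b hb,
          bit_pm (by omega) (by omega) (by omega) (by omega)]
        by_cases hp : (a = i ∧ b = j) ∨ (a = j ∧ b = i)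
        · have : adj a b = true := by
            rcases hp with ⟨rfl, rfl⟩ | ⟨rfl, rfl⟩
            · exact hadj
            · rw [hsym]; exact hadj
          simp [hp, this]
        · simp [hp]
      have hc := hcnt _ hinv'
      rcases hB with ((h | h) | ⟨k, hk, h⟩) | h
      · have := (hc i hi).2; have := hhi i hi; omega
      · have := (hc j hj).2; have := hhi j hj; omega
      · exfalso
        have hk' := List.mem_range.1 hk
        rw [hinv i hi k hk', hinv j hj k hk'] at h
        simp only [Bool.and_eq_true] at h
        exact htf i hi j hj k hk' hadj h.1.1 h.2.1
      · exact ih _ _ hinv' h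
    · have hadj' : adj i j = false := by simpa using hadj
      have hinv' : ∀ a < n, ∀ b < n,
          bit g a b = (adj a b && !bit (u ^^^ pm i j) a b) := by
        intro a ha b hb
        rw [hu' a ha b hb, hinv a ha b hb]
        by_cases hp : (a = i ∧ b = j) ∨ (a = j ∧ b = i)
        · have : adj a b = false := by
            rcases hp with ⟨rfl, rfl⟩ | ⟨rfl, rfl⟩
            · exact hadj'
            · rw [hsym]; exact hadj'
          simp [this]
        · simp [hp]
      have hc := hcnt _ hinv'
      rcases hA with (h | h) | h
      · have := (hc i hi).1; have := hlo i hi; omega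
      · have := (hc j hj).1; have := hlo j hj; omega
      · exact ih _ _ hinv' h

lemma isoS_sound (n g T : ℕ) : ∀ (k : ℕ) (l : List (ℕ × ℕ)), k ≤ n → isoS n g T k l = true →
    ∃ f : ℕ → ℕ, (∀ v, n - k ≤ v → v < n → f v < n ∧
        ∀ p ∈ l, bit g p.1 v = bit T p.2 (f v) ∧ p.2 ≠ f v) ∧
      ∀ v w, n - k ≤ v → v < w → w < n → bit g v w = bit T (f v) (f w) ∧ f v ≠ f w := by
  intro k
  induction k with
  | zero =>
    intro l _ _
    exact ⟨id, fun v h1 h2 => by omega, fun v w h1 h2 h3 => by omega⟩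
  | succ k ih =>
    intro l hk h
    simp only [isoS, List.any_eq_true, Bool.and_eq_true, List.all_eq_true, beq_iff_eq,
      bne_iff_ne] at h
    obtain ⟨c, hc, ⟨hl, -⟩, hrec⟩ := h
    obtain ⟨f, hf1, hf2⟩ := ih _ (by omega) hrec
    have hne : ∀ v, n - k ≤ v → v ≠ n - (k + 1) := fun v hv => by omega
    refine ⟨Function.update f (n - (k + 1)) c, ?_, ?_⟩
    · intro v h1 h2
      by_cases hv : v = n - (k + 1)
      · subst hv
        rw [Function.update_self]
        exact ⟨List.mem_range.1 hc, hl⟩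
      · rw [Function.update_of_ne hv]
        have := hf1 v (by omega) h2
        exact ⟨this.1, fun p hp => this.2 p (List.mem_cons_of_mem _ hp)⟩
    · intro v w h1 h2 h3
      rw [Function.update_of_ne (by omega : w ≠ n - (k + 1))]
      by_cases hv : v = n - (k + 1)
      · subst hv
        rw [Function.update_self]
        exact (hf1 w (by omega) h3).2 _ List.mem_cons_self
      · rw [Function.update_of_ne hv]
        exact hf2 v w (by omega) h2 h3



lemma countP_range_fin (n : ℕ) (p : ℕ → Bool) :
    (List.range n).countP p = (Finset.univ.filter fun i : Fin n => p i = true).card := by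
  induction n with
  | zero => simp
  | succ n ih =>
    rw [List.range_succ, List.countP_append, ih, Finset.card_filter, Finset.card_filter,
      Fin.sum_univ_castSucc]
    simp [List.countP_cons]

open Classical in
lemma classify {W : Type} [Finite W] (K : SimpleGraph W) (hsub : Subcubic K) (htf : TF K)
    {n m : ℕ} (e : Fin n ≃ W) (hm : K.edgeSet.ncard = m) (lo : ℕ → ℕ) (Ts : List ℕ)
    (ps : List (ℕ × ℕ)) (u g a : ℕ)
    (hlo : ∀ i : Fin n, lo i ≤ (K.neighborSet (e i)).ncard)
    (hu : ∀ i j : Fin n, bit u i j = (decide (a ≤ i.1) && decide (a ≤ j.1) && decide (i ≠ j)))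
    (hg : ∀ i j : Fin n, bit g i j = true → bit g j i = true ∧ i ≠ j ∧ (i.1 < a ∨ j.1 < a))
    (hrow : ∀ i j : Fin n, i.1 < a → (K.Adj (e i) (e j) ↔ bit g i j = true))
    (hs : search n (2 * m) lo Ts ps u g = true) :
    ∃ T ∈ Ts, ∃ f : Fin n → Fin n, Function.Injective f ∧
      ∀ i j : Fin n, i < j → (K.Adj (e i) (e j) ↔ bit T (f i) (f j) = true) := by
  have : Fintype W := Fintype.ofFinite W
  set adj : ℕ → ℕ → Bool := fun i j =>
    if h : i < n ∧ j < n then decide (K.Adj (e ⟨i, h.1⟩) (e ⟨j, h.2⟩)) else false with hadj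
  have hA : ∀ i j : Fin n, adj i j = decide (K.Adj (e i) (e j)) := by
    intro i j
    simp [hadj]
  have hA' : ∀ i j : Fin n, adj i j = true ↔ K.Adj (e i) (e j) := by
    intro i j
    rw [hA, decide_eq_true_eq]
  have hcnt : ∀ i : Fin n, (List.range n).countP (adj i) = (K.neighborSet (e i)).ncard := by
    intro i
    rw [countP_range_fin, ncard_neighbor, ← K.card_neighborFinset_eq_degree]
    apply Finset.card_bij (fun j _ => e j)
    · intro j hj
      simpa [hA'] using hj
    · intro j _ k _ h
      exact e.injective h
    · intro w hw
      refine ⟨e.symm w, ?_, by simp⟩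
      simpa [hA'] using hw
  have hsym : ∀ i j, adj i j = adj j i := by
    intro i j
    by_cases h : i < n ∧ j < n
    · rw [hA ⟨i, h.1⟩ ⟨j, h.2⟩, hA ⟨j, h.2⟩ ⟨i, h.1⟩, K.adj_comm]
    · have h' : ¬ (j < n ∧ i < n) := fun h' => h ⟨h'.2, h'.1⟩
      simp [hadj, h, h']
  obtain ⟨T, hT, g', hg', hiso⟩ := search_sound n (2 * m) lo Ts adj hsym
    (fun i hi => (hlo ⟨i, hi⟩).trans (hcnt ⟨i, hi⟩).ge)
    (fun i hi => (hcnt ⟨i, hi⟩).le.trans (hsub _))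
    (fun i hi j hj k hk h1 h2 h3 => htf _ _ _ ((hA' ⟨i, hi⟩ ⟨j, hj⟩).1 h1)
      ((hA' ⟨j, hj⟩ ⟨k, hk⟩).1 h3) ((hA' ⟨i, hi⟩ ⟨k, hk⟩).1 h2))
    (by
      rw [← hm, ← handshake K, ← Equiv.sum_comp e, ← List.sum_ofFn, List.ofFn_eq_map]
      rw [← List.map_coe_finRange_eq_range, List.map_map]
      congr 1
      apply List.map_congr_left
      intro i _
      rw [Function.comp_apply, List.map_coe_finRange_eq_range, hcnt])
    ps u g
    (by
      intro i hi j hj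
      have h1 := hu ⟨i, hi⟩ ⟨j, hj⟩
      have h2 := hg ⟨i, hi⟩ ⟨j, hj⟩
      have h3 := hrow ⟨i, hi⟩ ⟨j, hj⟩
      have h4 := hrow ⟨j, hj⟩ ⟨i, hi⟩
      have h5 := hg ⟨j, hj⟩ ⟨i, hi⟩
      have h6 := hA' ⟨i, hi⟩ ⟨j, hj⟩
      have h7 : ¬ K.Adj (e ⟨i, hi⟩) (e ⟨i, hi⟩) := K.loopless.irrefl _
      rw [K.adj_comm] at h4
      simp only at h1 h2 h3 h4 h5 h6
      rw [h1, Bool.eq_iff_iff]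
      simp only [Bool.and_eq_true, Bool.not_eq_true', Bool.and_eq_false_iff, decide_eq_false_iff_not,
        h6, not_le, not_not, ne_eq, Fin.mk.injEq]
      constructor
      · intro h
        obtain ⟨h8, h9, h10⟩ := h2 h
        rcases h10 with h10 | h10
        · exact ⟨(h3 h10).2 h, Or.inl (Or.inl h10)⟩
        · exact ⟨(h4 h10).2 h8, Or.inl (Or.inr h10)⟩
      · rintro ⟨h, (h8 | h8) | h8⟩
        · exact (h3 h8).1 h
        · exact (h5 ((h4 h8).1 h)).1
        · subst h8; exact absurd h h7)
    hs
  obtain ⟨f, hf1, hf2⟩ := isoS_sound n g' T n [] le_rfl hiso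
  refine ⟨T, hT, fun i => ⟨f i, (hf1 i (by omega) i.2).1⟩, ?_, ?_⟩
  · intro i j hij
    simp only [Fin.mk.injEq] at hij
    rcases lt_trichotomy i j with h | h | h
    · exact absurd hij (hf2 i j (by omega) h j.2).2
    · exact h
    · exact absurd hij.symm (hf2 j i (by omega) h i.2).2
  · intro i j hij
    rw [← hA', ← hg' i i.2 j j.2, (hf2 i j (by omega) hij j.2).1]

lemma finish {W X : Type} (K : SimpleGraph W) (XG : SimpleGraph X) {n : ℕ} (e : Fin n ≃ W)
    (T : ℕ) (f : Fin n → Fin n) (hf : Function.Injective f)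
    (h : ∀ i j : Fin n, i < j → (K.Adj (e i) (e j) ↔ bit T (f i) (f j) = true))
    (dec : Fin n → X) (hdec : Function.Bijective dec)
    (hT : ∀ i j : Fin n, XG.Adj (dec i) (dec j) ↔ bit T i j = true) :
    Nonempty (K ≃g XG) := by
  have hfb : Function.Bijective f := Finite.injective_iff_bijective.1 hf
  set E : W ≃ X := e.symm.trans ((Equiv.ofBijective f hfb).trans (Equiv.ofBijective dec hdec))
    with hE
  have hEe : ∀ i, E (e i) = dec (f i) := by intro i; simp [hE]
  refine ⟨⟨E, ?_⟩⟩
  intro a b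
  obtain ⟨i, rfl⟩ := e.surjective a
  obtain ⟨j, rfl⟩ := e.surjective b
  rw [hEe, hEe]
  rcases lt_trichotomy i j with hij | rfl | hij
  · rw [h i j hij, hT]
  · simp
  · rw [K.adj_comm, XG.adj_comm, h j i hij, hT]

lemma naming {W : Type} [Finite W] {n : ℕ} (hn : Nat.card W = n) (l : List W) (hl : l.Nodup)
    (hle : l.length ≤ n) : ∃ e : Fin n ≃ W, ∀ (i : ℕ) (h : i < l.length),
      e ⟨i, h.trans_le hle⟩ = l[i] := by
  classical
  have : Fintype W := Fintype.ofFinite W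
  rw [Nat.card_eq_fintype_card] at hn
  rcases l.eq_nil_or_concat with rfl | ⟨l', x, -⟩
  · refine ⟨(Fintype.equivFinOfCardEq hn).symm, fun i h => by simp at h⟩
  · obtain ⟨g, hg⟩ := Finset.exists_equiv_extend_of_card_eq (α := Fin n) (t := (Finset.univ : Finset W))
      (by simp [hn]) (s := Finset.univ.filter fun i : Fin n => i.1 < l.length)
      (f := fun i => l.getD i x) (Finset.subset_univ _) (by
        intro i hi j hj hij
        simp only [Finset.coe_filter, Finset.mem_univ, true_and, Set.mem_ofPred_eq] at hi hj
        simp only [List.getD_eq_getElem _ _ hi, List.getD_eq_getElem _ _ hj] at hij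
        exact Fin.ext ((hl.getElem_inj_iff).1 hij))
    refine ⟨g.trans (Equiv.subtypeUnivEquiv (by simp)), fun i h => ?_⟩
    have := hg ⟨i, h.trans_le hle⟩ (by simp [h])
    rw [List.getD_eq_getElem _ _ h] at this
    exact this



instance decSubdivide {V : Type} [DecidableEq V] (H : SimpleGraph V) [DecidableRel H.Adj]
    (x y : V) : DecidableRel (subdivide H x y).Adj := fun p q =>
  match p, q with
  | some u, some v => inferInstanceAs (Decidable (some u ≠ some v ∧
      ((H.Adj u v ∧ s(u, v) ≠ s(x, y)) ∨ (H.Adj v u ∧ s(v, u) ≠ s(x, y)))))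
  | some u, none => inferInstanceAs (Decidable (some u ≠ none ∧ ((u = x ∨ u = y) ∨ False)))
  | none, some u => inferInstanceAs (Decidable (none ≠ some u ∧ (False ∨ (u = x ∨ u = y))))
  | none, none => inferInstanceAs (Decidable ((none : Option V) ≠ none ∧ (False ∨ False)))

instance decAddApex {V : Type} [DecidableEq V] (K : SimpleGraph V) [DecidableRel K.Adj]
    (a b c : V) : DecidableRel (addApex K {a, b, c}).Adj := fun p q =>
  match p, q with
  | some u, some v => inferInstanceAs (Decidable (some u ≠ some v ∧ (K.Adj u v ∨ K.Adj v u)))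
  | some u, none =>
      inferInstanceAs (Decidable (some u ≠ none ∧ ((u = a ∨ u = b ∨ u = c) ∨ False)))
  | none, some u =>
      inferInstanceAs (Decidable (none ≠ some u ∧ (False ∨ (u = a ∨ u = b ∨ u = c))))
  | none, none => inferInstanceAs (Decidable ((none : Option V) ≠ none ∧ (False ∨ False)))

instance : DecidableRel Q3.Adj := fun u v => inferInstanceAs (Decidable (u ≠ v ∧ (_ ∨ _)))
instance : DecidableRel V8.Adj := fun u v => inferInstanceAs (Decidable (u ≠ v ∧ (_ ∨ _)))
instance : DecidableRel (cyc 4).Adj := fun u v => inferInstanceAs (Decidable (u ≠ v ∧ (_ ∨ _)))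

lemma cls4 {W : Type} [Finite W] (K : SimpleGraph W) (hsub : Subcubic K) (htf : TF K)
    (hc : Nat.card W = 4) (hm : K.edgeSet.ncard = 4) : MemF 4 0 K := by
  obtain ⟨e, -⟩ := naming hc [] List.nodup_nil (by simp)
  obtain ⟨T, hT, f, hf, h⟩ := classify K hsub htf e hm _ _ _ _ _ 0 (fun i => Nat.zero_le _)
    (by decide +kernel) (by decide +kernel) (fun i j h => absurd h (Nat.not_lt_zero _)) s4
  simp only [List.mem_singleton] at hT
  subst hT
  exact MemF.cycle (by norm_num) (finish K (cyc 4) e _ f hf h ![0, 1, 2, 3]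
    (by decide +kernel) (by decide +kernel))

lemma cls6 {W : Type} [Finite W] (K : SimpleGraph W) (hsub : Subcubic K) (htf : TF K)
    (hc : Nat.card W = 6) (hm : K.edgeSet.ncard = 8) : Nonempty (K ≃g Lgraph) := by
  have hex : ∃ v, (K.neighborSet v).ncard = 3 := by
    by_contra hne
    push Not at hne
    have := Fintype.ofFinite W
    have h1 := handshake K
    have h2 : ∑ v, (K.neighborSet v).ncard ≤ ∑ _v : W, 2 := Finset.sum_le_sum fun v _ => by
      have := hsub v; have := hne v; omega
    rw [Finset.sum_const, Finset.card_univ, ← Nat.card_eq_fintype_card, hc] at h2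
    simp at h2
    omega
  obtain ⟨v, hv⟩ := hex
  obtain ⟨x, y, z, hxy, hxz, hyz, hN⟩ := Set.ncard_eq_three.1 hv
  have hx : K.Adj v x := by rw [← mem_neighborSet, hN]; simp
  have hy : K.Adj v y := by rw [← mem_neighborSet, hN]; simp
  have hz : K.Adj v z := by rw [← mem_neighborSet, hN]; simp
  obtain ⟨e, he⟩ := naming hc [v, x, y, z] (by simp [hx.ne, hy.ne, hz.ne, hxy, hxz, hyz]) (by simp)
  have e0 : e 0 = v := he 0 (by simp)
  have e1 : e 1 = x := he 1 (by simp)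
  have e2 : e 2 = y := he 2 (by simp)
  have e3 : e 3 = z := he 3 (by simp)
  obtain ⟨T, hT, f, hf, h⟩ := classify K hsub htf e hm _ _ _ _ _ 1 (fun i => Nat.zero_le _)
    (by decide +kernel) (by decide +kernel) (fun i j hi => by
      have : i = 0 := Fin.ext (by change i.1 = 0; omega)
      subst this
      rw [e0, ← mem_neighborSet, hN, ← e1, ← e2, ← e3]
      simp only [Set.mem_insert_iff, Set.mem_singleton_iff, e.injective.eq_iff]
      revert j
      decide +kernel) s6
  simp only [List.mem_singleton] at hT
  subst hT
  exact finish K Lgraph e _ f hf h ![some (some 0), some (some 1), some (some 2), some (some 3),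
    some none, none] (by decide +kernel) (by unfold Lgraph; decide +kernel)

lemma cls8 {W : Type} [Finite W] (K : SimpleGraph W) (hsub : Subcubic K) (htf : TF K)
    (hc : Nat.card W = 8) (hm : K.edgeSet.ncard = 12) :
    Nonempty (K ≃g Q3) ∨ Nonempty (K ≃g V8) := by
  have h3 := all_three hsub (by omega)
  have hne : Nonempty W := (Nat.card_pos_iff.1 (by omega)).1
  obtain ⟨v⟩ := hne
  obtain ⟨x, y, z, hxy, hxz, hyz, hN⟩ := Set.ncard_eq_three.1 (h3 v)
  have hx : K.Adj v x := by rw [← mem_neighborSet, hN]; simp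
  have hy : K.Adj v y := by rw [← mem_neighborSet, hN]; simp
  have hz : K.Adj v z := by rw [← mem_neighborSet, hN]; simp
  obtain ⟨p, q, hpq, hN1⟩ : ∃ p q, p ≠ q ∧ K.neighborSet x \ {v} = {p, q} := by
    rw [← Set.ncard_eq_two, Set.ncard_sdiff_singleton_of_mem (by simpa using hx.symm), h3]
  have hN1' : K.neighborSet x = {v, p, q} := by
    rw [← Set.insert_sdiff_self_of_mem (show v ∈ K.neighborSet x by simpa using hx.symm), hN1]
  have hp : p ∈ K.neighborSet x \ {v} := by rw [hN1]; simp
  have hq : q ∈ K.neighborSet x \ {v} := by rw [hN1]; simp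
  have hnadj : ∀ w, K.Adj v w → w ≠ p ∧ w ≠ q := by
    intro w hw
    exact ⟨fun h => htf v x w hx (h ▸ hp.1) hw, fun h => htf v x w hx (h ▸ hq.1) hw⟩
  obtain ⟨e, he⟩ := naming hc [v, x, y, z, p, q] (by
    simp [hx.ne, hy.ne, hz.ne, hxy, hxz, hyz, hnadj x hx, hnadj y hy, hnadj z hz, hpq,
      Ne.symm hp.2, Ne.symm hq.2]) (by simp)
  have e0 : e 0 = v := he 0 (by simp)
  have e1 : e 1 = x := he 1 (by simp)
  have e2 : e 2 = y := he 2 (by simp)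
  have e3 : e 3 = z := he 3 (by simp)
  have e4 : e 4 = p := he 4 (by simp)
  have e5 : e 5 = q := he 5 (by simp)
  obtain ⟨T, hT, f, hf, h⟩ := classify K hsub htf e hm _ _ _ _ _ 2 (fun i => (h3 _).ge)
    (by decide +kernel) (by decide +kernel) (fun i j hi => by
      have : i = 0 ∨ i = 1 := by
        have h0 : i.1 = 0 ∨ i.1 = 1 := by omega
        exact h0.imp (fun h => Fin.ext h) (fun h => Fin.ext h)
      rcases this with rfl | rfl
      · rw [e0, ← mem_neighborSet, hN, ← e1, ← e2, ← e3]
        simp only [Set.mem_insert_iff, Set.mem_singleton_iff, e.injective.eq_iff]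
        revert j
        decide +kernel
      · rw [e1, ← mem_neighborSet, hN1', ← e0, ← e4, ← e5]
        simp only [Set.mem_insert_iff, Set.mem_singleton_iff, e.injective.eq_iff]
        revert j
        decide +kernel) s8
  simp only [List.mem_cons, List.not_mem_nil, or_false] at hT
  rcases hT with rfl | rfl
  · exact Or.inl (finish K Q3 e _ f hf h ![(0, 0, 0), (0, 0, 1), (0, 1, 0), (0, 1, 1),
      (1, 0, 0), (1, 0, 1), (1, 1, 0), (1, 1, 1)] (by decide +kernel) (by decide +kernel))
  · exact Or.inr (finish K V8 e _ f hf h ![0, 1, 2, 3, 4, 5, 6, 7]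
      (by decide +kernel) (by decide +kernel))

/-- Members of the second family. -/
abbrev H22 (a b c d : Fin 4) : SimpleGraph (Option (Option (Option (Option (Fin 4))))) :=
  addApex (subdivide (subdivide (subdivide (⊤ : SimpleGraph (Fin 4)) 0 1) (some a) (some b))
    (some (some c)) (some (some d))) {some (some none), some none, none}

abbrev H32 (a b c d p q : Fin 4) :
    SimpleGraph (Option (Option (Option (Option (Option (Fin 4)))))) :=
  subdivide (H22 a b c d) (some (some (some (some p)))) (some (some (some (some q))))

instance decH22 (a b c d : Fin 4) : DecidableRel (H22 a b c d).Adj := decAddApex _ _ _ _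

instance decH32 (a b c d p q : Fin 4) : DecidableRel (H32 a b c d p q).Adj :=
  decSubdivide _ _ _

lemma memF32 {W : Type} (K : SimpleGraph W) (a b c d p q : Fin 4)
    (h1 : s((some a : Option (Fin 4)), some b) ≠ s(some c, some d))
    (h2 : (subdivide (⊤ : SimpleGraph (Fin 4)) 0 1).Adj (some a) (some b))
    (h3 : (subdivide (⊤ : SimpleGraph (Fin 4)) 0 1).Adj (some c) (some d))
    (h4 : (H22 a b c d).Adj (some (some (some (some p)))) (some (some (some (some q)))))
    (h : Nonempty (K ≃g H32 a b c d p q)) : MemF 3 2 K := by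
  refine MemF.subd (i := 2) (by norm_num) ?_ h4 h
  refine MemF.circ (j := 2) le_rfl (MemF.k4 ⟨Iso.refl⟩) (x := 0) (y := 1) (by decide)
    (e1 := s(some a, some b)) (e2 := s(some c, some d)) h2 h3 ?_
  exact Or.inl ⟨h1, _, _, _, _, rfl, rfl, ⟨Iso.refl⟩⟩

def dec9 : Fin 9 → Option (Option (Option (Option (Option (Fin 4))))) :=
  ![some (some (some (some (some 0)))), some (some (some (some (some 1)))),
    some (some (some (some (some 2)))), some (some (some (some (some 3)))),
    some (some (some (some none))), some (some (some none)), some (some none), some none, none]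

lemma deg9 {W : Type} [Finite W] (K : SimpleGraph W) (hsub : Subcubic K)
    (hc : Nat.card W = 9) (hm : K.edgeSet.ncard = 13) :
    ∃ v, (K.neighborSet v).ncard = 2 ∧ ∀ w, w ≠ v → (K.neighborSet w).ncard = 3 := by
  classical
  have := Fintype.ofFinite W
  have h1 := handshake K
  have h2 : ∑ v, (3 - (K.neighborSet v).ncard) = 1 := by
    have h3 : ∑ v, (3 - (K.neighborSet v).ncard) + ∑ v, (K.neighborSet v).ncard = ∑ _v : W, 3 := by
      rw [← Finset.sum_add_distrib]
      exact Finset.sum_congr rfl fun v _ => Nat.sub_add_cancel (hsub v)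
    rw [Finset.sum_const, Finset.card_univ, ← Nat.card_eq_fintype_card, hc] at h3
    simp at h3
    omega
  obtain ⟨v, -, hv⟩ := Finset.exists_ne_zero_of_sum_ne_zero (h2.trans_ne one_ne_zero)
  have h4 := Finset.add_sum_erase Finset.univ (fun v => 3 - (K.neighborSet v).ncard)
    (Finset.mem_univ v)
  have h5 := hsub v
  refine ⟨v, by omega, fun w hw => ?_⟩
  have h6 : ∑ v ∈ Finset.univ.erase v, (3 - (K.neighborSet v).ncard) = 0 := by omega
  have h7 := Finset.sum_eq_zero_iff.1 h6 w (by simp [hw])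
  have h8 := hsub w
  omega

lemma cls9 {W : Type} [Finite W] (K : SimpleGraph W) (hsub : Subcubic K) (htf : TF K)
    (hc : Nat.card W = 9) (hm : K.edgeSet.ncard = 13) : MemF 3 2 K := by
  obtain ⟨v, hv, h3⟩ := deg9 K hsub hc hm
  obtain ⟨x, y, hxy, hN⟩ := Set.ncard_eq_two.1 hv
  have hx : K.Adj v x := by rw [← mem_neighborSet, hN]; simp
  have hy : K.Adj v y := by rw [← mem_neighborSet, hN]; simp
  obtain ⟨p, q, hpq, hN1⟩ : ∃ p q, p ≠ q ∧ K.neighborSet x \ {v} = {p, q} := by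
    rw [← Set.ncard_eq_two, Set.ncard_sdiff_singleton_of_mem (by simpa using hx.symm),
      h3 x hx.ne.symm]
  have hN1' : K.neighborSet x = {v, p, q} := by
    rw [← Set.insert_sdiff_self_of_mem (show v ∈ K.neighborSet x by simpa using hx.symm), hN1]
  have hp : p ∈ K.neighborSet x \ {v} := by rw [hN1]; simp
  have hq : q ∈ K.neighborSet x \ {v} := by rw [hN1]; simp
  have hnadj : ∀ w, K.Adj v w → w ≠ p ∧ w ≠ q := by
    intro w hw
    exact ⟨fun h => htf v x w hx (h ▸ hp.1) hw, fun h => htf v x w hx (h ▸ hq.1) hw⟩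
  obtain ⟨e, he⟩ := naming hc [v, x, y, p, q] (by
    simp [hx.ne, hy.ne, hxy, hnadj x hx, hnadj y hy, hpq, Ne.symm hp.2, Ne.symm hq.2]) (by simp)
  have e0 : e 0 = v := he 0 (by simp)
  have e1 : e 1 = x := he 1 (by simp)
  have e2 : e 2 = y := he 2 (by simp)
  have e3 : e 3 = p := he 3 (by simp)
  have e4 : e 4 = q := he 4 (by simp)
  obtain ⟨T, hT, f, hf, h⟩ := classify K hsub htf e hm _ _ _ _ _ 2 (fun i => by
      by_cases hi : i = 0
      · subst hi
        rw [e0, hv]; simp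
      · rw [h3 (e i) (fun h => hi (e.injective (h.trans e0.symm)))]
        split_ifs <;> norm_num)
    (by decide +kernel) (by decide +kernel) (fun i j hi => by
      have : i = 0 ∨ i = 1 := by
        have h0 : i.1 = 0 ∨ i.1 = 1 := by omega
        exact h0.imp (fun h => Fin.ext h) (fun h => Fin.ext h)
      rcases this with rfl | rfl
      · rw [e0, ← mem_neighborSet, hN, ← e1, ← e2]
        simp only [Set.mem_insert_iff, Set.mem_singleton_iff, e.injective.eq_iff]
        revert j
        decide +kernel
      · rw [e1, ← mem_neighborSet, hN1', ← e0, ← e3, ← e4]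
        simp only [Set.mem_insert_iff, Set.mem_singleton_iff, e.injective.eq_iff]
        revert j
        decide +kernel) s9
  simp only [List.mem_cons, List.not_mem_nil, or_false] at hT
  rcases hT with rfl | rfl | rfl | rfl
  · exact memF32 K 0 2 0 3 1 2 (by decide) (by decide) (by decide) (by decide +kernel)
      (finish K _ e _ f hf h dec9 (by decide +kernel) (by decide +kernel))
  · exact memF32 K 0 2 1 2 0 3 (by decide) (by decide) (by decide) (by decide +kernel)
      (finish K _ e _ f hf h dec9 (by decide +kernel) (by decide +kernel))
  · exact memF32 K 0 2 1 3 2 3 (by decide) (by decide) (by decide) (by decide +kernel)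
      (finish K _ e _ f hf h dec9 (by decide +kernel) (by decide +kernel))
  · exact memF32 K 0 2 1 3 0 3 (by decide) (by decide) (by decide) (by decide +kernel)
      (finish K _ e _ f hf h dec9 (by decide +kernel) (by decide +kernel))


/-- girth ≥ 4 case of the explicit main theorem. -/
theorem statement0 {V : Type} [Fintype V] (G : SimpleGraph V)
    (hconn : G.Connected) (hsub : Subcubic G) (hgirth : 4 ≤ G.egirth) :
    ((Nonempty (G ≃g Q3) ∨ Nonempty (G ≃g V8)) ∧
      (fvs G : ℝ) = 2 / 9 * G.edgeSet.ncard + 1 / 3) ∨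
    ((∃ (ι : Type) (P : V → ι) (H : SimpleGraph V),
        AddCutEdges H G ∧ PartitionedBy H P ∧
        ∀ i : ι, Nonempty ((H.induce (P ⁻¹' {i})) ≃g Lgraph)) ∧
      (fvs G : ℝ) = 2 / 9 * G.edgeSet.ncard + 2 / 9) ∨
    ((∃ (ι : Type) (P : V → Option ι) (H : SimpleGraph V),
        AddCutEdges H G ∧ PartitionedBy H P ∧
        (MemF 3 2 (H.induce (P ⁻¹' {none})) ∨ MemF 4 0 (H.induce (P ⁻¹' {none}))) ∧
        ∀ i : ι, Nonempty ((H.induce (P ⁻¹' {some i})) ≃g Lgraph)) ∧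
      (fvs G : ℝ) = 2 / 9 * G.edgeSet.ncard + 1 / 9) ∨
    (fvs G : ℝ) ≤ 2 / 9 * G.edgeSet.ncard := by
  rcases main_aux G hconn hsub (TF_of_egirth hgirth) cls4 cls6 cls8 cls9 with
    ⟨h, h'⟩ | ⟨h, h'⟩ | ⟨h, h'⟩ | h'
  · refine Or.inl ⟨h, ?_⟩
    have : (9 : ℝ) * fvs G = 2 * G.edgeSet.ncard + 3 := by exact_mod_cast h'
    linarith
  · refine Or.inr (Or.inl ⟨h, ?_⟩)
    have : (9 : ℝ) * fvs G = 2 * G.edgeSet.ncard + 2 := by exact_mod_cast h'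
    linarith
  · refine Or.inr (Or.inr (Or.inl ⟨h, ?_⟩))
    have : (9 : ℝ) * fvs G = 2 * G.edgeSet.ncard + 1 := by exact_mod_cast h'
    linarith
  · refine Or.inr (Or.inr (Or.inr ?_))
    have : (9 : ℝ) * fvs G ≤ 2 * G.edgeSet.ncard := by exact_mod_cast h'
    linarith

end InducedForest
end

section
/- If G is a connected triangle-free subcubic graph on n vertices and G is not isomorphic to Q_3 or V_8, then G contains an induced forest on at least (2/3)n vertices, i.e., a(G) ≥ (2/3)n. -/
open SimpleGraph

namespace InducedForest

/-- edges inside `U` -/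
noncomputable def inn {V : Type} [Fintype V] (G : SimpleGraph V) (U : Finset V) : Finset (Sym2 V) := by
  classical exact G.edgeFinset.filter (fun e => ∀ v ∈ e, v ∈ U)

lemma mem_inn {V : Type} [Fintype V] (G : SimpleGraph V) (U : Finset V) (e : Sym2 V) :
    e ∈ inn G U ↔ e ∈ G.edgeSet ∧ ∀ v ∈ e, v ∈ U := by
  classical
  simp [inn]

noncomputable def pp {V : Type} [Fintype V] (G : SimpleGraph V) (U : Finset V) : ℕ :=
  ((inn G U).card + 2 - U.card) / 2

def Sparse {V : Type} [Fintype V] (G : SimpleGraph V) (S : Finset V) : Prop :=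
  ∀ U ⊆ S, U.Nonempty → (inn G U).card + 1 ≤ U.card

def IsPart {V : Type} [DecidableEq V] (A : Finset (Finset V)) (W : Finset V) : Prop :=
  (∀ F ∈ A, F.Nonempty) ∧ (∀ F ∈ A, ∀ F' ∈ A, ∀ v, v ∈ F → v ∈ F' → F = F') ∧
    ∀ v, v ∈ W ↔ ∃ F ∈ A, v ∈ F

/-- the abstract selection lemma -/
lemma select {ι ε V : Type} [DecidableEq ι] [DecidableEq ε] [DecidableEq V]
    [Nonempty V] (part : ι → Finset V)
    (A : Finset ι) (hpart : ∀ o ∈ A, (part o).Nonempty) (ends : ε → Finset ι)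
    (R : V → ε → Prop)
    (hR : ∀ o e, o ∈ ends e → ∃ v ∈ part o, R v e) (O : Finset ι) :
    ∀ (_ : O ⊆ A) (E : Finset ε) (_ : ∀ e ∈ E, (ends e).Nonempty)
    (_ : ∀ U ⊆ A, U.Nonempty → (E.filter (fun e => ends e ⊆ U)).card + 1 ≤ U.card + (U ∩ O).card),
    ∃ τ : ι → V, (∀ o ∈ O, τ o ∈ part o) ∧ ∀ U ⊆ A, U.Nonempty → ∀ E' ⊆ E,
      (∀ e ∈ E', ends e ⊆ U ∧ ∀ o ∈ O, ¬ R (τ o) e) → E'.card + 1 ≤ U.card := by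
  classical
  induction O using Finset.induction_on with
  | empty =>
    intro _ E _ h
    refine ⟨fun _ => Classical.arbitrary V, by simp, fun U hUA hU E' hE' h' => ?_⟩
    have := h U hUA hU
    have h2 : E'.card ≤ (E.filter (fun e => ends e ⊆ U)).card :=
      Finset.card_le_card (fun e he => Finset.mem_filter.2 ⟨hE' he, (h' e he).1⟩)
    simp at this
    omega
  | insert o O ho ih =>
    intro hOA E hE2 h
    have hoA : o ∈ A := hOA (Finset.mem_insert_self _ _)
    have hOA' : O ⊆ A := fun x hx => hOA (Finset.mem_insert_of_mem hx)
    -- find a good vertex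
    have key : ∃ v ∈ part o, ∀ U ⊆ A, U.Nonempty →
        ((E.filter (fun e => ¬ R v e)).filter (fun e => ends e ⊆ U)).card + 1 ≤ U.card + (U ∩ O).card := by
      by_contra hcon
      push Not at hcon
      have tight : ∀ P : Finset V, P.Nonempty → P ⊆ part o → ∃ U ⊆ A, o ∈ U ∧
          U.card + (U ∩ insert o O).card ≤ (E.filter (fun e => ends e ⊆ U)).card + 1 ∧
          ∀ v ∈ P, ∀ e ∈ E, ends e ⊆ U → ¬ R v e := by
        intro P hP
        induction hP using Finset.Nonempty.cons_induction with
        | singleton v =>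
          intro hv
          obtain ⟨U, hUA, hU, hc⟩ := hcon v (hv (by simp))
          have h1 := h U hUA hU
          have hsub : (E.filter (fun e => ¬ R v e)).filter (fun e => ends e ⊆ U) ⊆ 
             E.filter (fun e => ends e ⊆ U) := by
            intro e; simp; tauto
          have h2 := Finset.card_le_card hsub
          have h3 : o ∈ U := by
            by_contra hoU
            rw [Finset.inter_insert_of_notMem hoU] at h1
            omega
          have h4 : (U ∩ insert o O).card = (U ∩ O).card + 1 := by
            rw [Finset.inter_insert_of_mem h3, Finset.card_insert_of_notMem (by simp [ho])]
          refine ⟨U, hUA, h3, by omega, ?_⟩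
          have h5 := Finset.eq_of_subset_of_card_le hsub (by omega)
          intro v' hv' e he heU
          obtain rfl : v' = v := by simpa using hv'
          have : e ∈ E.filter (fun e => ends e ⊆ U) := by simp [he, heU]
          rw [← h5] at this
          simp at this
          exact this.1.2
        | cons v P hv hP ih2 =>
          intro hsub
          obtain ⟨U, hUA, hU, hc, hn⟩ := ih2 (fun x hx => hsub (by simp [hx]))
          obtain ⟨U', hUA', hU', hc'⟩ := hcon v (hsub (by simp))
          have h1 := h U' hUA' hU'
          have hsub' : (E.filter (fun e => ¬ R v e)).filter (fun e => ends e ⊆ U') ⊆ 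
             E.filter (fun e => ends e ⊆ U') := by
            intro e; simp; tauto
          have h2 := Finset.card_le_card hsub'
          have h3 : o ∈ U' := by
            by_contra hoU
            rw [Finset.inter_insert_of_notMem hoU] at h1
            omega
          have h4 : (U' ∩ insert o O).card = (U' ∩ O).card + 1 := by
            rw [Finset.inter_insert_of_mem h3, Finset.card_insert_of_notMem (by simp [ho])]
          have h5 := Finset.eq_of_subset_of_card_le hsub' (by omega)
          refine ⟨U ∩ U', fun x hx => hUA (Finset.mem_inter.1 hx).1, by simp [hU, h3], ?_, ?_⟩
          · have e1 := Finset.card_union_add_card_inter U U'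
            have e2 := Finset.card_union_add_card_inter (U ∩ insert o O) (U' ∩ insert o O)
            have e3 := Finset.card_union_add_card_inter (E.filter (fun e => ends e ⊆ U))
              (E.filter (fun e => ends e ⊆ U'))
            have e4 : (E.filter (fun e => ends e ⊆ U)) ∩ (E.filter (fun e => ends e ⊆ U'))
               = E.filter (fun e => ends e ⊆ U ∩ U') := by
              ext e; simp [Finset.subset_inter_iff]; tauto
            have e5 : (E.filter (fun e => ends e ⊆ U)) ∪ (E.filter (fun e => ends e ⊆ U'))
               ⊆ E.filter (fun e => ends e ⊆ U ∪ U') := by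
              intro e; simp
              rintro (⟨a, b⟩ | ⟨a, b⟩)
              · exact ⟨a, b.trans Finset.subset_union_left⟩
              · exact ⟨a, b.trans Finset.subset_union_right⟩
            have e6 := Finset.card_le_card e5
            have e7 : (U ∩ insert o O) ∪ (U' ∩ insert o O) = (U ∪ U') ∩ insert o O := by
              ext; simp; tauto
            have e8 : (U ∩ insert o O) ∩ (U' ∩ insert o O) = (U ∩ U') ∩ insert o O := by
              ext; simp
            have e9 := h (U ∪ U') (Finset.union_subset hUA hUA') ⟨o, by simp [hU]⟩
            rw [e4] at e3
            rw [e7, e8] at e2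
            omega
          · intro v' hv' e he heU
            rw [Finset.subset_inter_iff] at heU
            rcases Finset.mem_cons.1 hv' with rfl | hv'
            · have : e ∈ E.filter (fun e => ends e ⊆ U') := by simp [he, heU]
              rw [← h5] at this
              simp at this
              exact this.1.2
            · exact hn v' hv' e he heU.1
      obtain ⟨U, hUA, hU, hc, hn⟩ := tight (part o) (hpart o hoA) subset_rfl
      have h1 : E.filter (fun e => ends e ⊆ U) = E.filter (fun e => ends e ⊆ U.erase o) := by
        apply Finset.filter_congr
        intro e he
        constructor
        · intro h1 x hx
          refine Finset.mem_erase.2 ⟨?_, h1 hx⟩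
          rintro rfl
          obtain ⟨v, hv, hvR⟩ := hR x e hx
          exact hn v hv e he h1 hvR
        · exact fun h1 => h1.trans (Finset.erase_subset _ _)
      have h4 : (U ∩ insert o O).card = (U ∩ O).card + 1 := by
        rw [Finset.inter_insert_of_mem hU, Finset.card_insert_of_notMem (by simp [ho])]
      have h6 : U.card = (U.erase o).card + 1 := (Finset.card_erase_add_one hU).symm
      rw [h1] at hc
      rcases Finset.eq_empty_or_nonempty (U.erase o) with h0 | h0
      · have : E.filter (fun e => ends e ⊆ U.erase o) = ∅ := by
          rw [h0]
          apply Finset.filter_false_of_mem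
          intro e he h7
          have := hE2 e he
          simp [Finset.subset_empty.1 h7] at this
        rw [this] at hc
        simp at hc
        omega
      · have h8 := h _ ((Finset.erase_subset _ _).trans hUA) h0
        have h9 : (U.erase o ∩ insert o O).card ≤ (U ∩ O).card := by
          apply Finset.card_le_card
          intro x; simp
        omega
    obtain ⟨v, hv, hgood⟩ := key
    obtain ⟨τ, hτ, hfin⟩ := ih hOA' (E.filter (fun e => ¬ R v e)) 
      (fun e he => hE2 e (Finset.mem_filter.1 he).1) hgood
    refine ⟨Function.update τ o v, ?_, ?_⟩
    · intro x hxO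
      by_cases hx : x = o
      · subst hx; simpa using hv
      · simpa [hx] using hτ x (by simpa [hx] using hxO)
    · intro U hUA hU E' hE' h'
      refine hfin U hUA hU E' ?_ ?_
      · intro e he
        refine Finset.mem_filter.2 ⟨hE' he, ?_⟩
        have := (h' e he).2 o (by simp)
        simpa using this
      · intro e he
        refine ⟨(h' e he).1, fun x hx => ?_⟩
        have := (h' e he).2 x (by simp [hx])
        have hxo : x ≠ o := by rintro rfl; exact ho hx
        simpa [hxo] using this


lemma inn_mono {V : Type} [Fintype V] (G : SimpleGraph V) {U U' : Finset V} (h : U ⊆ U') :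
    inn G U ⊆ inn G U' := by
  intro e
  simp only [mem_inn]
  exact fun ⟨a, b⟩ => ⟨a, fun v hv => h (b v hv)⟩

lemma inn_singleton {V : Type} [Fintype V] (G : SimpleGraph V) (U : Finset V) (h : U.card ≤ 1) :
    inn G U = ∅ := by
  rw [Finset.eq_empty_iff_forall_notMem]
  intro e
  rw [mem_inn]
  induction e with
  | _ a b =>
    rintro ⟨h1, h2⟩
    have ha := h2 a (by simp)
    have hb := h2 b (by simp)
    have : a = b := Finset.card_le_one.1 h a ha b hb
    subst this
    simp at h1

theorem exists_fvs {V : Type} [Fintype V] [DecidableEq V] [Nonempty V] (G : SimpleGraph V) :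
    ∀ (n : ℕ) (W : Finset V), W.card = n → ∃ S ⊆ W, Sparse G (W \ S) ∧
      ∃ A : Finset (Finset V), IsPart A W ∧ S.card ≤ ∑ F ∈ A, pp G F := by
  classical
  intro n
  induction n using Nat.strong_induction_on with
  | _ n ih =>
  intro W hWn
  -- a best partition
  obtain ⟨A, hA, hmax⟩ : ∃ A : Finset (Finset V), IsPart A W ∧ ∀ B, IsPart B W →
      toLex (∑ F ∈ B, pp G F, B.card) ≤ toLex (∑ F ∈ A, pp G F, A.card) := by
    have hne : ((Finset.univ : Finset (Finset (Finset V))).filter (fun A => IsPart A W)).Nonempty := by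
      refine ⟨W.image (fun v => {v}), ?_⟩
      simp only [Finset.mem_filter, Finset.mem_univ, true_and]
      refine ⟨?_, ?_, ?_⟩
      · intro F hF
        obtain ⟨v, _, rfl⟩ := Finset.mem_image.1 hF
        simp
      · intro F hF F' hF' v hv hv'
        obtain ⟨a, _, rfl⟩ := Finset.mem_image.1 hF
        obtain ⟨b, _, rfl⟩ := Finset.mem_image.1 hF'
        simp at hv hv'
        rw [← hv, ← hv']
      · intro v; simp
    obtain ⟨A, hA, hm⟩ := Finset.exists_max_image _ 
      (fun B : Finset (Finset V) => toLex (∑ F ∈ B, pp G F, B.card)) hne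
    refine ⟨A, (Finset.mem_filter.1 hA).2, fun B hB => hm B (by simpa using hB)⟩
  obtain ⟨hA1, hA2, hA3⟩ := hA
  have hmax1 : ∀ B, IsPart B W → ∑ F ∈ B, pp G F ≤ ∑ F ∈ A, pp G F := by
    intro B hB
    have := hmax B hB
    rw [Prod.Lex.toLex_le_toLex] at this
    rcases this with h | h
    · exact h.le
    · exact h.1.le
  have hmax2 : ∀ B, IsPart B W → A.card < B.card → ∑ F ∈ B, pp G F < ∑ F ∈ A, pp G F := by
    intro B hB hc
    have := hmax B hB
    rw [Prod.Lex.toLex_le_toLex] at this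
    rcases this with h | h
    · exact h
    · exact absurd h.2 (by simpa using hc)
  have hFW : ∀ F ∈ A, F ⊆ W := fun F hF v hv => (hA3 v).2 ⟨F, hF, hv⟩
  -- big parts are critical
  have crit : ∀ F ∈ A, 2 ≤ F.card → ∀ v ∈ F, ∃ S ⊆ F.erase v, Sparse G (F.erase v \ S) ∧
      S.card + 1 ≤ pp G F := by
    intro F hF hF2 v hv
    have hlt : (F.erase v).card < n := by
      have h1 := Finset.card_le_card (hFW F hF)
      have h2 := Finset.card_erase_add_one hv
      omega
    obtain ⟨S, hS, hsp, B, ⟨hB1, hB2, hB3⟩, hle⟩ := ih _ hlt (F.erase v) rfl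
    refine ⟨S, hS, hsp, ?_⟩
    have hsubF : ∀ X ∈ B, ∀ x ∈ X, x ∈ F ∧ x ≠ v := by
      intro X hX x hx
      have := (hB3 x).2 ⟨X, hX, hx⟩
      simp at this
      exact ⟨this.2, this.1⟩
    have hvB : {v} ∉ B := fun h => (hsubF _ h v (by simp)).2 rfl
    have hdisj : Disjoint (A.erase F) (insert {v} B) := by
      rw [Finset.disjoint_left]
      intro X hX hX'
      have hXA := Finset.mem_erase.1 hX
      obtain ⟨x, hx⟩ := hA1 X hXA.2
      apply hXA.1
      apply hA2 X hXA.2 F hF x hx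
      rcases Finset.mem_insert.1 hX' with rfl | h
      · simp at hx; subst hx; exact hv
      · exact (hsubF X h x hx).1
    have hP : IsPart (A.erase F ∪ insert {v} B) W := by
      refine ⟨?_, ?_, ?_⟩
      · intro X hX
        simp only [Finset.mem_union, Finset.mem_erase, Finset.mem_insert] at hX
        rcases hX with h | rfl | h
        · exact hA1 X h.2
        · simp
        · exact hB1 X h
      · intro X hX Y hY x hx hy
        simp only [Finset.mem_union, Finset.mem_erase, Finset.mem_insert] at hX hY
        rcases hX with h | rfl | h <;> rcases hY with h' | rfl | h'
        · exact hA2 _ h.2 _ h'.2 x hx hy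
        · simp at hy; subst hy; exact absurd (hA2 _ h.2 _ hF x hx hv) h.1
        · exact absurd (hA2 _ h.2 _ hF x hx (hsubF _ h' x hy).1) h.1
        · simp at hx; subst hx; exact absurd (hA2 _ h'.2 _ hF x hy hv) h'.1
        · rfl
        · simp at hx; exact absurd hx (hsubF _ h' x hy).2
        · exact absurd (hA2 _ h'.2 _ hF x hy (hsubF _ h x hx).1) h'.1
        · simp at hy; exact absurd hy (hsubF _ h x hx).2
        · exact hB2 _ h _ h' x hx hy
      · intro x
        rw [hA3]
        constructor
        · rintro ⟨X, hX, hx⟩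
          by_cases hXF : X = F
          · subst hXF
            by_cases hxv : x = v
            · exact ⟨{v}, by simp, by simp [hxv]⟩
            · obtain ⟨Y, hY, hxY⟩ := (hB3 x).1 (by simp [hxv, hx])
              exact ⟨Y, by simp [hY], hxY⟩
          · exact ⟨X, by simp [hX, hXF], hx⟩
        · rintro ⟨X, hX, hx⟩
          simp only [Finset.mem_union, Finset.mem_erase, Finset.mem_insert] at hX
          rcases hX with h | rfl | h
          · exact ⟨X, h.2, hx⟩
          · simp at hx; subst hx; exact ⟨F, hF, hv⟩
          · exact ⟨F, hF, (hsubF _ h x hx).1⟩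
    have hBne : 0 < B.card := by
      obtain ⟨x, hx⟩ : (F.erase v).Nonempty := by
        rw [← Finset.card_pos]
        have h2 := Finset.card_erase_add_one hv
        omega
      obtain ⟨X, hX, _⟩ := (hB3 x).1 hx
      exact Finset.card_pos.2 ⟨X, hX⟩
    have hlt2 := hmax2 _ hP (by
      rw [Finset.card_union_of_disjoint hdisj, Finset.card_insert_of_notMem hvB]
      have := Finset.card_erase_add_one hF
      omega)
    rw [Finset.sum_union hdisj, Finset.sum_insert hvB, ← Finset.sum_erase_add _ _ hF] at hlt2
    omega
  -- cross edges
  set O := A.filter (fun F => 2 ≤ F.card) with hO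
  set E := (inn G W).filter (fun e => ¬ ∃ F ∈ A, ∀ v ∈ e, v ∈ F) with hE
  set ends : Sym2 V → Finset (Finset V) := fun e => A.filter (fun F => ∃ v ∈ F, v ∈ e) with hends
  have hsel := select (id : Finset V → Finset V) A hA1 ends (fun v e => v ∈ e)
    (by
      intro o e ho
      exact (Finset.mem_filter.1 ho).2) O (Finset.filter_subset _ _) E
    (by
      intro e he
      have h1 := (Finset.mem_filter.1 he).1
      rw [mem_inn] at h1
      induction e with
      | _ a b =>
        have ha := h1.2 a (by simp)
        obtain ⟨F, hF, haF⟩ := (hA3 a).1 ha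
        exact ⟨F, Finset.mem_filter.2 ⟨hF, a, haF, by simp⟩⟩)
    (by
      intro U hUA hU
      set B := U.biUnion id with hB
      have hcardB : B.card = ∑ F ∈ U, F.card := by
        rw [hB, Finset.card_biUnion]
        · rfl
        · intro X hX Y hY hXY
          rw [Function.onFun, Finset.disjoint_left]
          intro x hx hy
          exact hXY (hA2 X (hUA hX) Y (hUA hY) x hx hy)
      have hinn : ∑ F ∈ U, (inn G F).card + (E.filter (fun e => ends e ⊆ U)).card ≤ (inn G B).card := by
        rw [← Finset.card_biUnion, ← Finset.card_union_of_disjoint]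
        · apply Finset.card_le_card
          intro e he
          rcases Finset.mem_union.1 he with h | h
          · obtain ⟨F, hF, heF⟩ := Finset.mem_biUnion.1 h
            refine inn_mono G ?_ heF
            exact Finset.subset_biUnion_of_mem id hF
          · obtain ⟨h1, h2⟩ := Finset.mem_filter.1 h
            have h3 := (mem_inn _ _ _).1 (Finset.mem_filter.1 h1).1
            refine (mem_inn _ _ _).2 ⟨h3.1, fun v hv => ?_⟩
            obtain ⟨F, hF, hvF⟩ := (hA3 v).1 (h3.2 v hv)
            exact Finset.mem_biUnion.2 ⟨F, h2 (Finset.mem_filter.2 ⟨hF, v, hvF, hv⟩), hvF⟩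
        · rw [Finset.disjoint_left]
          intro e h h'
          obtain ⟨F, hF, heF⟩ := Finset.mem_biUnion.1 h
          exact (Finset.mem_filter.1 (Finset.mem_filter.1 h').1).2 
            ⟨F, hUA hF, ((mem_inn _ _ _).1 heF).2⟩
        · intro X hX Y hY hXY
          rw [Function.onFun, Finset.disjoint_left]
          intro e hx hy
          rw [mem_inn] at hx hy
          induction e with
          | _ a b =>
            exact hXY (hA2 X (hUA hX) Y (hUA hY) a (hx.2 a (by simp)) (hy.2 a (by simp)))
      have hBmem : ∀ F ∈ A, ∀ x ∈ F, x ∈ B → F ∈ U := by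
        intro F hF x hx hxB
        obtain ⟨Y, hY, hxY⟩ := Finset.mem_biUnion.1 hxB
        rw [hA2 F hF Y (hUA hY) x hx hxY]
        exact hY
      have hBne : B.Nonempty := by
        obtain ⟨F, hF⟩ := hU
        obtain ⟨x, hx⟩ := hA1 F (hUA hF)
        exact ⟨x, Finset.mem_biUnion.2 ⟨F, hF, hx⟩⟩
      have hBnot : B ∉ A \ U := by
        intro h
        obtain ⟨x, hx⟩ := hBne
        exact (Finset.mem_sdiff.1 h).2 (hBmem B (Finset.mem_sdiff.1 h).1 x hx hx)
      have hP : IsPart (insert B (A \ U)) W := by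
        refine ⟨?_, ?_, ?_⟩
        · intro X hX
          rcases Finset.mem_insert.1 hX with rfl | h
          · exact hBne
          · exact hA1 X (Finset.mem_sdiff.1 h).1
        · intro X hX Y hY x hx hy
          rcases Finset.mem_insert.1 hX with hX | hX <;> rcases Finset.mem_insert.1 hY with hY | hY
          · rw [hX, hY]
          · rw [Finset.mem_sdiff] at hY
            rw [hX] at hx
            exact absurd (hBmem Y hY.1 x hy hx) hY.2
          · rw [Finset.mem_sdiff] at hX
            rw [hY] at hy
            exact absurd (hBmem X hX.1 x hx hy) hX.2
          · exact hA2 X (Finset.mem_sdiff.1 hX).1 Y (Finset.mem_sdiff.1 hY).1 x hx hy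
        · intro x
          rw [hA3]
          constructor
          · rintro ⟨X, hX, hx⟩
            by_cases h : X ∈ U
            · exact ⟨B, by simp, Finset.mem_biUnion.2 ⟨X, h, hx⟩⟩
            · exact ⟨X, by simp [hX, h], hx⟩
          · rintro ⟨X, hX, hx⟩
            rcases Finset.mem_insert.1 hX with hX | hX
            · rw [hX] at hx
              obtain ⟨Y, hY, hxY⟩ := Finset.mem_biUnion.1 hx
              exact ⟨Y, hUA hY, hxY⟩
            · exact ⟨X, (Finset.mem_sdiff.1 hX).1, hx⟩
      have hle := hmax1 _ hP
      rw [Finset.sum_insert hBnot, ← Finset.sum_sdiff hUA] at hle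
      have hle' : pp G B ≤ ∑ F ∈ U, pp G F := by omega
      have hUO : (U ∩ O).card = ∑ F ∈ U, (if 2 ≤ F.card then 1 else 0) := by
        rw [Finset.card_eq_sum_ones, ← Finset.sum_filter]
        congr 1
        ext X
        simp only [hO, Finset.mem_inter, Finset.mem_filter]
        constructor
        · tauto
        · exact fun h => ⟨h.1, hUA h.1, h.2⟩
      have hpart : ∑ F ∈ U, (2 * pp G F + F.card) ≤ 
          ∑ F ∈ U, ((inn G F).card + 1 + (if 2 ≤ F.card then 1 else 0)) := by
        apply Finset.sum_le_sum
        intro F hF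
        split_ifs with h2
        · obtain ⟨v, hv⟩ := hA1 F (hUA hF)
          obtain ⟨S, -, -, hS⟩ := crit F (hUA hF) h2 v hv
          unfold pp at *
          omega
        · have h3 : F.card ≤ 1 := by omega
          simp [pp, inn_singleton G F h3]
          have := Finset.card_pos.2 (hA1 F (hUA hF))
          omega
      simp only [Finset.sum_add_distrib, ← Finset.mul_sum, Finset.sum_const, smul_eq_mul, mul_one] at hpart
      rw [← hUO, ← hcardB] at hpart
      have : pp G B = ((inn G B).card + 2 - B.card) / 2 := rfl
      omega)
  obtain ⟨τ, hτ, hsel⟩ := hsel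
  have hOA : O ⊆ A := Finset.filter_subset _ _
  have crit2 : ∀ F : Finset V, ∃ S : Finset V, F ∈ O → (S ⊆ F ∧ τ F ∈ S ∧ Sparse G (F \ S) ∧ S.card ≤ pp G F) := by
    intro F
    by_cases hF : F ∈ O
    · obtain ⟨S, h1, h2, h3⟩ := crit F (hOA hF) (Finset.mem_filter.1 hF).2 (τ F) (hτ F hF)
      refine ⟨insert (τ F) S, fun _ => ⟨?_, by simp, ?_, ?_⟩⟩
      · intro x hx
        rcases Finset.mem_insert.1 hx with rfl | hx
        · exact hτ F hF
        · exact (Finset.mem_erase.1 (h1 hx)).2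
      · convert h2 using 1
        ext x; simp; tauto
      · exact (Finset.card_insert_le _ _).trans h3
    · exact ⟨∅, fun h => absurd h hF⟩
  choose S hS using crit2
  refine ⟨O.biUnion S, ?_, ?_, A, ⟨hA1, hA2, hA3⟩, ?_⟩
  · intro x hx
    obtain ⟨F, hF, hx⟩ := Finset.mem_biUnion.1 hx
    exact hFW F (hOA hF) ((hS F hF).1 hx)
  · intro U hU hUne
    set Q := A.filter (fun F => (F ∩ U).Nonempty) with hQ
    have hQA : Q ⊆ A := Finset.filter_subset _ _
    have hcov : ∀ x ∈ U, ∃ F ∈ Q, x ∈ F := by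
      intro x hx
      obtain ⟨F, hF, hxF⟩ := (hA3 x).1 (Finset.mem_sdiff.1 (hU hx)).1
      exact ⟨F, Finset.mem_filter.2 ⟨hF, x, by simp [hx, hxF]⟩, hxF⟩
    have hQne : Q.Nonempty := by
      obtain ⟨x, hx⟩ := hUne
      obtain ⟨F, hF, _⟩ := hcov x hx
      exact ⟨F, hF⟩
    have h1 := hsel Q hQA hQne (E.filter (fun e => e ∈ inn G U)) (Finset.filter_subset _ _) (by
      intro e he
      have h2 := ((mem_inn _ _ _).1 (Finset.mem_filter.1 he).2).2
      constructor
      · intro F hF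
        obtain ⟨hFA, v, hvF, hve⟩ := Finset.mem_filter.1 hF
        exact Finset.mem_filter.2 ⟨hFA, v, by simp [hvF, h2 v hve]⟩
      · intro o ho hoe
        have h3 := hU (h2 _ hoe)
        exact (Finset.mem_sdiff.1 h3).2 (Finset.mem_biUnion.2 ⟨o, ho, (hS o ho).2.1⟩))
    have h2 : (inn G U).card ≤ ∑ F ∈ Q, (inn G (F ∩ U)).card + (E.filter (fun e => e ∈ inn G U)).card := by
      refine le_trans (Finset.card_le_card (?_ : _ ⊆ (Q.biUnion (fun F => inn G (F ∩ U))) ∪ (E.filter (fun e => e ∈ inn G U)))) ?_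
      · intro e he
        by_cases heE : e ∈ E
        · exact Finset.mem_union_right _ (Finset.mem_filter.2 ⟨heE, he⟩)
        · apply Finset.mem_union_left
          have h3 := (mem_inn _ _ _).1 he
          have h4 : e ∈ inn G W := inn_mono G (fun x hx => (Finset.mem_sdiff.1 (hU hx)).1) he
          have h5 : ∃ F ∈ A, ∀ v ∈ e, v ∈ F := by
            by_contra h
            exact heE (Finset.mem_filter.2 ⟨h4, h⟩)
          obtain ⟨F, hF, hFe⟩ := h5
          refine Finset.mem_biUnion.2 ⟨F, ?_, (mem_inn _ _ _).2 ⟨h3.1, fun v hv => 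
            Finset.mem_inter.2 ⟨hFe v hv, h3.2 v hv⟩⟩⟩
          refine Finset.mem_filter.2 ⟨hF, ?_⟩
          induction e with
          | _ a b => exact ⟨a, Finset.mem_inter.2 ⟨hFe a (by simp), h3.2 a (by simp)⟩⟩
      · refine (Finset.card_union_le _ _).trans ?_
        exact Nat.add_le_add_right Finset.card_biUnion_le _
    have h3 : U.card = ∑ F ∈ Q, (F ∩ U).card := by
      rw [← Finset.card_biUnion]
      · congr 1
        ext x
        simp only [Finset.mem_biUnion, Finset.mem_inter]
        constructor
        · intro hx
          obtain ⟨F, hF, hxF⟩ := hcov x hx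
          exact ⟨F, hF, hxF, hx⟩
        · rintro ⟨F, _, _, hx⟩; exact hx
      · intro X hX Y hY hXY
        rw [Function.onFun, Finset.disjoint_left]
        intro x hx hy
        exact hXY (hA2 X (hQA hX) Y (hQA hY) x (Finset.mem_inter.1 hx).1 (Finset.mem_inter.1 hy).1)
    have h4 : ∑ F ∈ Q, ((inn G (F ∩ U)).card + 1) ≤ ∑ F ∈ Q, (F ∩ U).card := by
      apply Finset.sum_le_sum
      intro F hF
      obtain ⟨hFA, hFU⟩ := Finset.mem_filter.1 hF
      by_cases h2 : 2 ≤ F.card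
      · have hFO : F ∈ O := Finset.mem_filter.2 ⟨hFA, h2⟩
        refine (hS F hFO).2.2.1 _ ?_ hFU
        intro x hx
        rw [Finset.mem_inter] at hx
        rw [Finset.mem_sdiff]
        exact ⟨hx.1, fun h => (Finset.mem_sdiff.1 (hU hx.2)).2 (Finset.mem_biUnion.2 ⟨F, hFO, h⟩)⟩
      · have : (F ∩ U).card ≤ 1 := (Finset.card_le_card Finset.inter_subset_left).trans (by omega)
        rw [inn_singleton G _ this]
        simpa using hFU
    rw [Finset.sum_add_distrib, Finset.sum_const, smul_eq_mul, mul_one] at h4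
    omega
  · refine Finset.card_biUnion_le.trans ?_
    refine (Finset.sum_le_sum (fun F hF => (hS F hF).2.2.2)).trans ?_
    exact Finset.sum_le_sum_of_subset hOA


lemma inn_card {V : Type} [Fintype V] [DecidableEq V] (G : SimpleGraph V) (U : Finset V)
    [Fintype (G.induce (U : Set V)).edgeSet] :
    (inn G U).card = (G.induce (U : Set V)).edgeFinset.card := by
  symm
  apply Finset.card_bij (fun e _ => Sym2.map Subtype.val e)
  · intro e he
    induction e with
    | _ a b =>
      rw [mem_inn]
      simp at he
      simpa using he
  · intro a _ b _ h
    exact Sym2.map.injective Subtype.val_injective h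
  · intro e he
    induction e with
    | _ a b =>
      rw [mem_inn] at he
      refine ⟨s(⟨a, ?_⟩, ⟨b, ?_⟩), ?_, ?_⟩
      · simpa using he.2 a (by simp)
      · simpa using he.2 b (by simp)
      · simpa using he.1
      · simp

lemma acyclic_of_sparse {V : Type} [Fintype V] [DecidableEq V] (G : SimpleGraph V) (T : Finset V)
    (h : Sparse G T) : (G.induce (T : Set V)).IsAcyclic := by
  classical
  intro v c hc
  set U : Finset V := c.support.tail.toFinset.image Subtype.val with hU
  have hUc : U.card = c.length := by
    rw [hU, Finset.card_image_of_injective _ Subtype.val_injective,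
      List.toFinset_card_of_nodup hc.support_nodup]
    simp
  have hUT : U ⊆ T := by
    intro x hx
    obtain ⟨y, _, rfl⟩ := Finset.mem_image.1 hx
    exact y.2
  have hpos := hc.three_le_length
  have hmem : ∀ x ∈ c.support, x.1 ∈ U := by
    intro x hx
    refine Finset.mem_image_of_mem _ (List.mem_toFinset.2 ?_)
    rw [← c.cons_tail_support] at hx
    rcases List.mem_cons.1 hx with rfl | hx
    · exact c.end_mem_tail_support (fun hn => by cases c <;> simp_all)
    · exact hx
  have h1 := h U hUT (Finset.card_pos.1 (by omega))
  have h2 : c.length ≤ (inn G U).card := by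
    have : (c.edges.toFinset.image (Sym2.map Subtype.val)).card = c.length := by
      rw [Finset.card_image_of_injective _ (Sym2.map.injective Subtype.val_injective),
        List.toFinset_card_of_nodup hc.edges_nodup]
      simp
    rw [← this]
    apply Finset.card_le_card
    intro e he
    obtain ⟨e', he', rfl⟩ := Finset.mem_image.1 he
    rw [List.mem_toFinset] at he'
    have h3 := c.edges_subset_edgeSet he'
    induction e' with
    | _ a b =>
      rw [mem_inn]
      have ha := hmem a (c.fst_mem_support_of_mem_edges he')
      have hb := hmem b (c.snd_mem_support_of_mem_edges he')
      simp at h3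
      simp [h3, ha, hb]
  omega

lemma pp_bound {V : Type} [Fintype V] [DecidableEq V] (G : SimpleGraph V)
    (hsub : ∀ v : V, (G.neighborSet v).ncard ≤ 3) (htf : G.CliqueFree 3)
    (U : Finset V) (h8 : ¬ (U.card = 8 ∧ (inn G U).card = 12)) (hU : U.Nonempty) :
    3 * pp G U ≤ U.card := by
  classical
  have hcard : Fintype.card (U : Set V) = U.card := by simp
  have h1 : 2 * (inn G U).card ≤ 3 * U.card := by
    rw [inn_card, ← sum_degrees_eq_twice_card_edges]
    refine (Finset.sum_le_card_nsmul _ _ 3 ?_).trans ?_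
    · intro v _
      refine le_trans ?_ (hsub v)
      rw [← SimpleGraph.card_neighborSet_eq_degree, ← Nat.card_eq_fintype_card, Nat.card_coe_set_eq,
        ← Set.ncard_image_of_injective _ Subtype.val_injective]
      apply Set.ncard_le_ncard _ (Set.toFinite _)
      rintro _ ⟨w, hw, rfl⟩
      simpa using hw
    · rw [Finset.card_univ, hcard, smul_eq_mul, mul_comm]
  have h2 : (inn G U).card ≤ U.card ^ 2 / 4 := by
    rw [inn_card]
    have hcf : (G.induce (U : Set V)).CliqueFree (2 + 1) :=
      htf.comap ⟨(SimpleGraph.Embedding.induce (U : Set V)).toCopy⟩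
    have h3 := hcf.card_edgeFinset_le
    simp only [hcard] at h3
    refine le_trans (le_of_eq ?_) (h3.trans ?_)
    · congr!
    · have h4 := Nat.mod_two_eq_zero_or_one U.card
      have h5 : 4 ∣ U.card ^ 2 - (U.card % 2) ^ 2 := by
        rcases h4 with h | h
        · rw [h]
          obtain ⟨m, hm⟩ := Nat.dvd_of_mod_eq_zero h
          rw [hm]; exact ⟨m ^ 2, by rw [mul_pow]; norm_num⟩
        · obtain ⟨m, hm⟩ : ∃ m, U.card = 2 * m + 1 := ⟨U.card / 2, by omega⟩
          rw [h, hm]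
          exact ⟨m ^ 2 + m, by ring_nf; omega⟩
      have h6 : (U.card % 2).choose 2 = 0 := by
        rcases h4 with h | h <;> rw [h] <;> rfl
      rw [h6]
      simp only [Nat.add_one_sub_one, mul_one, add_zero]
      exact Nat.div_le_div_right (Nat.sub_le _ _)
  have h0 := Finset.card_pos.2 hU
  unfold pp
  by_cases hk : U.card ≤ 12
  · generalize U.card = k at *
    interval_cases k <;> omega
  · omega


lemma iso_of_hom {W V : Type} [Fintype W] [Fintype V] (H : SimpleGraph W) (G : SimpleGraph V)
    (hc : Fintype.card W = Fintype.card V) (f : W → V) (hf : Function.Injective f)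
    (hom : ∀ u w, H.Adj u w → G.Adj (f u) (f w))
    (hH : ∀ w, (H.neighborSet w).ncard = 3) (hG : ∀ v, (G.neighborSet v).ncard = 3) :
    Nonempty (G ≃g H) := by
  have hb : Function.Bijective f := (Fintype.bijective_iff_injective_and_card f).2 ⟨hf, hc⟩
  refine ⟨(RelIso.symm ⟨Equiv.ofBijective f hb, ?_⟩)⟩
  intro a b
  simp only [Equiv.ofBijective_apply]
  refine ⟨fun h => ?_, hom a b⟩
  have h1 : f '' (H.neighborSet a) = G.neighborSet (f a) := by
    apply Set.eq_of_subset_of_ncard_le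
    · rintro _ ⟨w, hw, rfl⟩
      exact hom a w hw
    · rw [Set.ncard_image_of_injective _ hf, hH, hG]
    · exact Set.toFinite _
  have h2 : f b ∈ f '' (H.neighborSet a) := by rw [h1]; exact h
  obtain ⟨w, hw, hwb⟩ := h2
  rw [← hf hwb]
  exact hw

lemma q3_cubic (w : Fin 2 × Fin 2 × Fin 2) : (Q3.neighborSet w).ncard = 3 := by
  have : ∀ w : Fin 2 × Fin 2 × Fin 2, (Finset.univ.filter (fun u : Fin 2 × Fin 2 × Fin 2 =>
      w ≠ u ∧ (((w.1 ≠ u.1 ∧ w.2 = u.2) ∨ (w.1 = u.1 ∧ w.2.1 ≠ u.2.1 ∧ w.2.2 = u.2.2) ∨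
    (w.1 = u.1 ∧ w.2.1 = u.2.1 ∧ w.2.2 ≠ u.2.2)) ∨ ((u.1 ≠ w.1 ∧ u.2 = w.2) ∨ (u.1 = w.1 ∧ u.2.1 ≠ w.2.1 ∧ u.2.2 = w.2.2) ∨
    (u.1 = w.1 ∧ u.2.1 = w.2.1 ∧ u.2.2 ≠ w.2.2))))).card = 3 := by decide
  rw [← this w, ← Set.ncard_coe_finset]
  congr 1
  ext u
  simp [Q3]

lemma v8_cubic (w : ZMod 8) : (V8.neighborSet w).ncard = 3 := by
  have : ∀ w : ZMod 8, (Finset.univ.filter (fun u : ZMod 8 =>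
      w ≠ u ∧ ((u = w + 1 ∨ u = w + 4) ∨ (w = u + 1 ∨ w = u + 4)))).card = 3 := by decide
  rw [← this w, ← Set.ncard_coe_finset]
  congr 1
  ext u
  simp [V8]

lemma two_of_three {V : Type} [DecidableEq V] (N : Finset V) (hN : N.card = 3) (a p q r : V)
    (h : ∀ v ∈ N, v = a ∨ v = p ∨ v = q ∨ v = r) :
    (p ∈ N ∧ q ∈ N) ∨ (p ∈ N ∧ r ∈ N) ∨ (q ∈ N ∧ r ∈ N) := by
  by_contra hcon
  push Not at hcon
  obtain ⟨h1, h2, h3⟩ := hcon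
  have : ∃ s, N ⊆ {a, s} := by
    by_cases hp : p ∈ N
    · refine ⟨p, fun v hv => ?_⟩
      have := h1 hp
      have := h2 hp
      rcases h v hv with rfl | rfl | rfl | rfl <;> simp_all
    · by_cases hq : q ∈ N
      · refine ⟨q, fun v hv => ?_⟩
        have := h3 hq
        rcases h v hv with rfl | rfl | rfl | rfl <;> simp_all
      · refine ⟨r, fun v hv => ?_⟩
        rcases h v hv with rfl | rfl | rfl | rfl <;> simp_all
  obtain ⟨s, hs⟩ := this
  have := Finset.card_le_card hs
  have := Finset.card_le_two (a := a) (b := s)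
  omega


lemma third {V : Type} [Fintype V] [DecidableEq V] (G : SimpleGraph V) [DecidableRel G.Adj]
    (hc : ∀ v, (G.neighborFinset v).card = 3) : ∀ v p q, p ≠ q → G.Adj v p → G.Adj v q → ∃ r, r ≠ p ∧ r ≠ q ∧ G.Adj v r ∧
    ∀ u, G.Adj v u → u = p ∨ u = q ∨ u = r := by
  intro v p q hpq hp hq
  have h1 : ({p, q} : Finset V) ⊆ G.neighborFinset v := by
    intro x hx
    simp at hx
    rcases hx with rfl | rfl <;> simpa
  have h2 : (G.neighborFinset v \ {p, q}).card = 1 := by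
    rw [Finset.card_sdiff_of_subset h1, hc, Finset.card_pair hpq]
  obtain ⟨r, hr⟩ := Finset.card_eq_one.1 h2
  have h3 : ∀ u, (G.Adj v u ∧ u ≠ p ∧ u ≠ q) ↔ u = r := by
    intro u
    have : u ∈ G.neighborFinset v \ {p, q} ↔ u ∈ ({r} : Finset V) := by rw [hr]
    simpa using this
  have h4 := (h3 r).2 rfl
  refine ⟨r, h4.2.1, h4.2.2, h4.1, fun u hu => ?_⟩
  have := h3 u
  tauto

lemma four {V : Type} [Fintype V] [DecidableEq V] (G : SimpleGraph V) [DecidableRel G.Adj]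
    (hc : ∀ v, (G.neighborFinset v).card = 3) : ∀ v p q r s, G.Adj v p → G.Adj v q → G.Adj v r → G.Adj v s → p ≠ q → p ≠ r → q ≠ r →
    s = p ∨ s = q ∨ s = r := by
  intro v p q r s hp hq hr hs hpq hpr hqr
  obtain ⟨t, ht⟩ := third G hc v p q hpq hp hq
  have h1 := ht.2.2.2 r hr
  have h2 := ht.2.2.2 s hs
  grind

lemma noK_main {V : Type} [Fintype V] [DecidableEq V] (G : SimpleGraph V) [DecidableRel G.Adj]
    (hc : ∀ v, (G.neighborFinset v).card = 3) (a e x y z : V) (hae : a ≠ e)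
    (ax : G.Adj a x) (ay : G.Adj a y) (az : G.Adj a z)
    (ex : G.Adj e x) (ey : G.Adj e y) (ez : G.Adj e z) : ∀ f g h, f ≠ g → (∀ v, v = a ∨ v = e ∨ v = x ∨ v = y ∨ v = z ∨ v = f ∨ v = g ∨ v = h) →
    (∀ v, v = f ∨ v = g ∨ v = h → v ≠ a ∧ v ≠ e ∧ v ≠ x ∧ v ≠ y ∧ v ≠ z) →
    (∀ v, v = f ∨ v = g ∨ v = h → ¬ G.Adj v a ∧ ¬ G.Adj v e) → ¬ G.Adj f g → False := by
  intro f g h hfg cov out nA hn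
  have hf := two_of_three (G.neighborFinset f) (hc f) h x y z (by
    intro v hv
    simp at hv
    have h1 := nA f (by simp)
    have h2 := hv.ne
    rcases cov v with h | h | h | h | h | h | h | h
    · exact absurd (h ▸ hv) h1.1
    · exact absurd (h ▸ hv) h1.2
    · exact Or.inr (Or.inl h)
    · exact Or.inr (Or.inr (Or.inl h))
    · exact Or.inr (Or.inr (Or.inr h))
    · exact absurd h.symm h2
    · exact absurd (h ▸ hv) hn
    · exact Or.inl h)
  have hg := two_of_three (G.neighborFinset g) (hc g) h x y z (by
    intro v hv
    simp at hv
    have h1 := nA g (by simp)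
    have h2 := hv.ne
    rcases cov v with h | h | h | h | h | h | h | h
    · exact absurd (h ▸ hv) h1.1
    · exact absurd (h ▸ hv) h1.2
    · exact Or.inr (Or.inl h)
    · exact Or.inr (Or.inr (Or.inl h))
    · exact Or.inr (Or.inr (Or.inr h))
    · exact absurd (h ▸ hv).symm hn
    · exact absurd h.symm h2
    · exact Or.inl h)
  simp only [mem_neighborFinset] at hf hg
  have of := out f (by simp)
  have og := out g (by simp)
  have bad : ∀ w, G.Adj a w → G.Adj e w → G.Adj f w → G.Adj g w → False := by
    intro w h1 h2 h3 h4
    have := four G hc w a e f g h1.symm h2.symm h3.symm h4.symm hae of.1.symm of.2.1.symm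
    rcases this with h | h | h
    · exact og.1 h
    · exact og.2.1 h
    · exact hfg h.symm
  have b1 := bad x ax ex
  have b2 := bad y ay ey
  have b3 := bad z az ez
  tauto

lemma noK {V : Type} [Fintype V] [DecidableEq V] (G : SimpleGraph V) [DecidableRel G.Adj]
    (h8 : Fintype.card V = 8) (hc : ∀ v, (G.neighborFinset v).card = 3)
    (tf : ∀ p q r, G.Adj p q → G.Adj q r → G.Adj p r → False) : ∀ a e x y z, a ≠ e → x ≠ y → x ≠ z → y ≠ z → G.Adj a x → G.Adj a y → G.Adj a z →
    G.Adj e x → G.Adj e y → G.Adj e z → False := by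
  intro a e x y z hae hxy hxz hyz ax ay az ex ey ez
  have hcardS : ({a, e, x, y, z} : Finset V).card = 5 := by
    have := ax.ne; have := ay.ne; have := az.ne; have := ex.ne; have := ey.ne; have := ez.ne
    rw [Finset.card_insert_of_notMem, Finset.card_insert_of_notMem, Finset.card_insert_of_notMem,
      Finset.card_insert_of_notMem, Finset.card_singleton] <;> simp_all
  have hT : (({a, e, x, y, z} : Finset V)ᶜ).card = 3 := by
    rw [Finset.card_compl, hcardS, h8]
  obtain ⟨f, g, h, hfg, hfh, hgh, hT⟩ := Finset.card_eq_three.1 hT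
  have cov : ∀ v, v = a ∨ v = e ∨ v = x ∨ v = y ∨ v = z ∨ v = f ∨ v = g ∨ v = h := by
    intro v
    have : v ∈ ({a, e, x, y, z} : Finset V)ᶜ ↔ v ∈ ({f, g, h} : Finset V) := by rw [hT]
    simp only [Finset.mem_compl, Finset.mem_insert, Finset.mem_singleton] at this
    clear hT hcardS
    grind
  have out : ∀ v, v = f ∨ v = g ∨ v = h → v ≠ a ∧ v ≠ e ∧ v ≠ x ∧ v ≠ y ∧ v ≠ z := by
    intro v hv
    have : v ∈ ({a, e, x, y, z} : Finset V)ᶜ := by rw [hT]; simpa using hv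
    simpa using this
  have nA : ∀ v, v = f ∨ v = g ∨ v = h → ¬ G.Adj v a ∧ ¬ G.Adj v e := by
    intro v hv
    have hv' := out v hv
    constructor
    · intro hh
      have := four G hc a x y z v ax ay az hh.symm hxy hxz hyz
      tauto
    · intro hh
      have := four G hc e x y z v ex ey ez hh.symm hxy hxz hyz
      tauto
  by_cases h1 : G.Adj f g
  · by_cases h2 : G.Adj g h
    · by_cases h3 : G.Adj f h
      · exact tf f g h h1 h2 h3
      · exact noK_main G hc a e x y z hae ax ay az ex ey ez f h g hfh (fun v => by rcases cov v with h | h | h | h | h | h | h | h <;> simp only [h, true_or, or_true]) 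
          (fun v hv => out v (by rcases hv with h | h | h <;> simp only [h, true_or, or_true]))
          (fun v hv => nA v (by rcases hv with h | h | h <;> simp only [h, true_or, or_true])) h3
    · exact noK_main G hc a e x y z hae ax ay az ex ey ez g h f hgh (fun v => by rcases cov v with h | h | h | h | h | h | h | h <;> simp only [h, true_or, or_true]) 
          (fun v hv => out v (by rcases hv with h | h | h <;> simp only [h, true_or, or_true]))
          (fun v hv => nA v (by rcases hv with h | h | h <;> simp only [h, true_or, or_true])) h2
  · exact noK_main G hc a e x y z hae ax ay az ex ey ez f g h hfg cov out nA h1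

lemma hcyc {V : Type} [Fintype V] [DecidableEq V] (G : SimpleGraph V) [DecidableRel G.Adj]
    (h8 : Fintype.card V = 8) (hc : ∀ v, (G.neighborFinset v).card = 3)
    (tf : ∀ p q r, G.Adj p q → G.Adj q r → G.Adj p r → False) : ∃ a e x y, a ≠ e ∧ x ≠ y ∧ G.Adj a x ∧ G.Adj a y ∧ G.Adj e x ∧ G.Adj e y := by
  by_contra hcon
  push Not at hcon
  have : Nonempty V := Fintype.card_pos_iff.1 (by omega)
  obtain ⟨a⟩ := this
  obtain ⟨b, c, d, hbc, hbd, hcd, hN⟩ := Finset.card_eq_three.1 (hc a)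
  have hadj : ∀ v, G.Adj a v ↔ v = b ∨ v = c ∨ v = d := by
    intro v
    rw [← mem_neighborFinset, hN]; simp
  have ab := (hadj b).2 (by simp)
  have ac := (hadj c).2 (by simp)
  have ad := (hadj d).2 (by simp)
  set N : V → Finset V := fun v => (G.neighborFinset v).erase a with hNdef
  have hNc : ∀ v, G.Adj a v → (N v).card = 2 := by
    intro v hv
    rw [hNdef]
    simp only
    rw [Finset.card_erase_of_mem (by simpa using hv.symm), hc]
  have hdis : ∀ v w, v ≠ w → G.Adj a v → G.Adj a w → Disjoint (N v) (N w) := by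
    intro v w hvw hv hw
    rw [Finset.disjoint_left]
    intro e h1 h2
    simp [hNdef] at h1 h2
    exact hcon a e v w (fun h => h1.1 h.symm) hvw hv hw h1.2.symm h2.2.symm
  have hdisa : ∀ v, G.Adj a v → Disjoint (N v) ({a, b, c, d} : Finset V) := by
    intro v hv
    rw [Finset.disjoint_left]
    intro e h1 h2
    simp [hNdef] at h1
    have h3 : G.Adj a e := by
      rw [hadj]
      simp at h2
      tauto
    exact tf a v e hv h1.2 h3
  have h4 : ({a, b, c, d} : Finset V).card = 4 := by
    have := ab.ne; have := ac.ne; have := ad.ne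
    rw [Finset.card_insert_of_notMem, Finset.card_insert_of_notMem, Finset.card_insert_of_notMem,
      Finset.card_singleton] <;> simp_all
  have h5 := Finset.card_le_univ (((N b ∪ N c) ∪ N d) ∪ {a, b, c, d})
  rw [Finset.card_union_of_disjoint, Finset.card_union_of_disjoint, Finset.card_union_of_disjoint,
    hNc b ab, hNc c ac, hNc d ad, h4, h8] at h5
  · omega
  · exact hdis b c hbc ab ac
  · rw [Finset.disjoint_union_left]
    exact ⟨hdis b d hbd ab ad, hdis c d hcd ac ad⟩
  · rw [Finset.disjoint_union_left, Finset.disjoint_union_left]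
    exact ⟨⟨hdisa b ab, hdisa c ac⟩, hdisa d ad⟩

set_option maxHeartbeats 4000000 in
lemma cubic8 {V : Type} [Fintype V] [DecidableEq V] (G : SimpleGraph V) [DecidableRel G.Adj]
    (h8 : Fintype.card V = 8) (hc : ∀ v, (G.neighborFinset v).card = 3)
    (tf : ∀ p q r, G.Adj p q → G.Adj q r → G.Adj p r → False) :
    Nonempty (G ≃g Q3) ∨ Nonempty (G ≃g V8) := by
  have hG : ∀ v, (G.neighborSet v).ncard = 3 := by
    intro v
    rw [← hc v, ← Set.ncard_coe_finset, coe_neighborFinset]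
  obtain ⟨a, e, x, y, hae, hxy, ax, ay, ex, ey⟩ := hcyc G h8 hc tf
  obtain ⟨z, hzx, hzy, az, hNa⟩ := third G hc a x y hxy ax ay
  obtain ⟨z', hzx', hzy', ez', hNe⟩ := third G hc e x y hxy ex ey
  obtain ⟨x', hxa', hxe', xx', hNx⟩ := third G hc x a e hae ax.symm ex.symm
  obtain ⟨y', hya', hye', yy', hNy⟩ := third G hc y a e hae ay.symm ey.symm
  have hzz : z ≠ z' := by
    rintro rfl
    exact noK G h8 hc tf a e x y z hae hxy hzx.symm hzy.symm ax ay az ex ey ez'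
  have hxxyy : x' ≠ y' := by
    rintro rfl
    exact noK G h8 hc tf x y a e x' hxy hae hxa'.symm hxe'.symm ax.symm ex.symm xx' ay.symm ey.symm yy'
  have d1 : z ≠ x' := by rintro rfl; exact tf a x z ax xx' az
  have d2 : z ≠ y' := by rintro rfl; exact tf a y z ay yy' az
  have d3 : z' ≠ x' := by rintro rfl; exact tf e x z' ex xx' ez'
  have d4 : z' ≠ y' := by rintro rfl; exact tf e y z' ey yy' ez'
  have d5 : z ≠ e := by rintro rfl; exact tf a x z ax ex.symm az
  have d6 : z' ≠ a := by rintro rfl; exact tf e x z' ex ax.symm ez'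
  have d7 : x' ≠ y := by rintro rfl; exact tf a x x' ax xx' ay
  have d8 : y' ≠ x := by rintro rfl; exact tf a y y' ay yy' ax
  have nd : [a, x, y, e, z, x', y', z'].Nodup := by
    have := ax.ne; have := ay.ne; have := ex.ne; have := ey.ne; have := az.ne; have := ez'.ne
    have := xx'.ne; have := yy'.ne
    simp
    grind
  have cov : ∀ v, v = a ∨ v = x ∨ v = y ∨ v = e ∨ v = z ∨ v = x' ∨ v = y' ∨ v = z' := by
    have h1 : ([a, x, y, e, z, x', y', z'].toFinset) = Finset.univ := by
      apply Finset.eq_univ_of_card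
      rw [List.toFinset_card_of_nodup nd, h8]; rfl
    intro v
    have : v ∈ [a, x, y, e, z, x', y', z'].toFinset := by rw [h1]; simp
    simpa using this
  have Ia : ∀ u, G.Adj u a → u = x ∨ u = y ∨ u = z := fun u hu => hNa u hu.symm
  have Ie : ∀ u, G.Adj u e → u = x ∨ u = y ∨ u = z' := fun u hu => hNe u hu.symm
  have Ix : ∀ u, G.Adj u x → u = a ∨ u = e ∨ u = x' := fun u hu => hNx u hu.symm
  have Iy : ∀ u, G.Adj u y → u = a ∨ u = e ∨ u = y' := fun u hu => hNy u hu.symm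
  have Hz := two_of_three _ (hc z) a x' y' z' (by
    intro v hv
    simp at hv
    have := hv.ne
    rcases cov v with rfl | rfl | rfl | rfl | rfl | rfl | rfl | rfl <;> grind)
  have Hz' := two_of_three _ (hc z') e x' y' z (by
    intro v hv
    simp at hv
    have := hv.ne
    rcases cov v with rfl | rfl | rfl | rfl | rfl | rfl | rfl | rfl <;> grind)
  have Hx' := two_of_three _ (hc x') x y' z z' (by
    intro v hv
    simp at hv
    have := hv.ne
    rcases cov v with rfl | rfl | rfl | rfl | rfl | rfl | rfl | rfl <;> grind)
  have Hy' := two_of_three _ (hc y') y x' z z' (by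
    intro v hv
    simp at hv
    have := hv.ne
    rcases cov v with rfl | rfl | rfl | rfl | rfl | rfl | rfl | rfl <;> grind)
  simp only [mem_neighborFinset] at Hz Hz' Hx' Hy'
  rw [G.adj_comm z' x', G.adj_comm z' y', G.adj_comm z' z] at Hz'
  rw [G.adj_comm x' z] at Hx'
  rw [G.adj_comm y' z, G.adj_comm y' x'] at Hy'
  have cases3 : (G.Adj z x' ∧ G.Adj z y' ∧ G.Adj x' z' ∧ G.Adj y' z') ∨
      (G.Adj z z' ∧ G.Adj x' z' ∧ G.Adj x' y' ∧ G.Adj z y') ∨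
      (G.Adj z z' ∧ G.Adj y' z' ∧ G.Adj x' y' ∧ G.Adj z x') := by tauto
  have mkV : ∀ x y x' y', [a, x, y, e, z, x', y', z'].Nodup → G.Adj a x → G.Adj a y → G.Adj e x →
      G.Adj e y → G.Adj x x' → G.Adj y y' → G.Adj z z' → G.Adj x' z' → G.Adj x' y' → G.Adj z y' →
      Nonempty (G ≃g V8) := by
    intro x y x' y' nd ax ay ex ey xx' yy' zz' xz' xy' zy'
    refine iso_of_hom V8 G (by rw [h8]; rfl) (![a, x, x', y', y, e, z', z] : Fin 8 → V) ?_ ?_ v8_cubic hG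
    · change Function.Injective (![a, x, x', y', y, e, z', z] : Fin 8 → V)
      rw [← List.nodup_ofFn]
      simp [List.ofFn_succ] at nd ⊢
      grind
    · have key : ∀ u w : Fin 8, (w = u + 1 ∨ w = u + 4) →
          G.Adj ((![a, x, x', y', y, e, z', z] : Fin 8 → V) u) ((![a, x, x', y', y, e, z', z] : Fin 8 → V) w) := by
        intro u w h
        rcases h with rfl | rfl <;> fin_cases u <;> simp [ax, ay, ex, ey, xx', yy', zz', xz', xy', zy', az, ez', G.adj_comm] <;>
          first | assumption | (apply SimpleGraph.Adj.symm; assumption)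
      intro u w h
      simp only [V8, fromRel_adj] at h
      rcases h.2 with h | h
      · exact key u w h
      · exact (key w u h).symm
  rcases cases3 with ⟨h1, h2, h3, h4⟩ | ⟨h1, h2, h3, h4⟩ | ⟨h1, h2, h3, h4⟩
  · left
    set F : Fin 2 × Fin 2 × Fin 2 → V := fun t =>
      (![![![a, z], ![y, y']], ![![x, x'], ![e, z']]] : Fin 2 → Fin 2 → Fin 2 → V) t.1 t.2.1 t.2.2 with hF
    refine iso_of_hom Q3 G (by rw [h8]; rfl) F ?_ ?_ q3_cubic hG
    · simp at nd
      rintro ⟨i, j, k⟩ ⟨i', j', k'⟩ h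
      fin_cases i <;> fin_cases j <;> fin_cases k <;> fin_cases i' <;> fin_cases j' <;> fin_cases k' <;>
        simp [hF] at h ⊢ <;> grind
    · rintro ⟨i, j, k⟩ ⟨i', j', k'⟩ h
      fin_cases i <;> fin_cases j <;> fin_cases k <;> fin_cases i' <;> fin_cases j' <;> fin_cases k' <;>
        simp [Q3] at h <;> simp [hF] <;> first | assumption | (apply SimpleGraph.Adj.symm; assumption)
  · right
    exact mkV x y x' y' nd ax ay ex ey xx' yy' h1 h2 h3 h4
  · right
    refine mkV y x y' x' ?_ ay ax ey ex yy' xx' h1 h2 h3.symm h4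
    simp at nd ⊢
    grind


lemma eight {V : Type} [Fintype V] [DecidableEq V] (G : SimpleGraph V) (hconn : G.Connected)
    (hsub : ∀ v : V, (G.neighborSet v).ncard ≤ 3) (htf : G.CliqueFree 3)
    (U : Finset V) (h8 : U.card = 8) (h12 : (inn G U).card = 12) :
    Nonempty (G ≃g Q3) ∨ Nonempty (G ≃g V8) := by
  classical
  have hcard : Fintype.card (U : Set V) = U.card := by simp
  have him : ∀ v : (U : Set V), Subtype.val '' ((G.induce (U : Set V)).neighborSet v) ⊆ G.neighborSet v := by
    rintro v _ ⟨w, hw, rfl⟩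
    simpa using hw
  have hdeg : ∀ v : (U : Set V), (G.induce (U : Set V)).degree v =
      (Subtype.val '' ((G.induce (U : Set V)).neighborSet v)).ncard := by
    intro v
    rw [← SimpleGraph.card_neighborSet_eq_degree, ← Nat.card_eq_fintype_card, Nat.card_coe_set_eq,
        ← Set.ncard_image_of_injective _ Subtype.val_injective]
  have hle : ∀ v : (U : Set V), (G.induce (U : Set V)).degree v ≤ 3 := by
    intro v
    rw [hdeg]
    exact (Set.ncard_le_ncard (him v) (Set.toFinite _)).trans (hsub v)
  have hsum : ∑ v : (U : Set V), (G.induce (U : Set V)).degree v = ∑ v : (U : Set V), 3 := by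
    rw [sum_degrees_eq_twice_card_edges, ← inn_card, h12, Finset.sum_const, Finset.card_univ, hcard, h8]
    rfl
  have heq := (Finset.sum_eq_sum_iff_of_le (fun v _ => hle v)).1 hsum
  have hN : ∀ v ∈ U, (G.neighborSet v).ncard = 3 ∧ ∀ w, G.Adj v w → w ∈ U := by
    intro v hv
    have h3 := heq ⟨v, hv⟩ (Finset.mem_univ _)
    rw [hdeg] at h3
    have h4 : _ = G.neighborSet v := Set.eq_of_subset_of_ncard_le (him ⟨v, hv⟩) (by rw [h3]; exact hsub v) (Set.toFinite _)
    rw [h4] at h3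
    refine ⟨h3, fun w hw => ?_⟩
    have : w ∈ G.neighborSet v := hw
    rw [← h4] at this
    obtain ⟨w', _, rfl⟩ := this
    exact w'.2
  obtain ⟨u, hu⟩ : U.Nonempty := Finset.card_pos.1 (by omega)
  have hall : ∀ v, v ∈ U := by
    intro v
    obtain ⟨p⟩ := hconn.preconnected u v
    induction p with
    | nil => exact hu
    | cons h p ih => exact ih ((hN _ hu).2 _ h)
  have hUu : U = Finset.univ := Finset.eq_univ_of_forall hall
  apply cubic8 G
  · rw [← Finset.card_univ, ← hUu, h8]
  · intro v
    rw [← (hN v (hall v)).1, ← Set.ncard_coe_finset, coe_neighborFinset]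
  · intro p q r h1 h2 h3
    exact htf {p, q, r} (is3Clique_triple_iff.2 ⟨h1, h3, h2⟩)


/-- every connected triangle-free subcubic graph other than `Q_3` and `V_8`
has an induced forest on at least `2n/3` vertices. -/
theorem statement2 {V : Type} [Fintype V] (G : SimpleGraph V)
    (hconn : G.Connected) (hsub : Subcubic G) (htf : G.CliqueFree 3)
    (hQ3 : ¬ Nonempty (G ≃g Q3)) (hV8 : ¬ Nonempty (G ≃g V8)) :
    2 / 3 * (Nat.card V : ℝ) ≤ indForestNum G := by
  classical
  have hne : Nonempty V := hconn.nonempty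
  obtain ⟨S, -, hS, A, ⟨hA1, hA2, hA3⟩, hle⟩ := exists_fvs G _ (Finset.univ : Finset V) rfl
  have hpp : ∀ F ∈ A, 3 * pp G F ≤ F.card := by
    intro F hF
    apply pp_bound G hsub htf F _ (hA1 F hF)
    rintro ⟨h8, h12⟩
    rcases eight G hconn hsub htf F h8 h12 with h | h
    · exact hQ3 h
    · exact hV8 h
  have hsumA : ∑ F ∈ A, F.card ≤ Fintype.card V := by
    have hd : (A : Set (Finset V)).PairwiseDisjoint id := by
      intro F hF F' hF' hne
      rw [Function.onFun, Finset.disjoint_left]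
      intro v h1 h2
      exact hne (hA2 F hF F' hF' v h1 h2)
    have := Finset.card_biUnion hd
    simp only [id] at this
    rw [← this]
    exact Finset.card_le_univ _
  have h3 : 3 * S.card ≤ Fintype.card V := by
    calc 3 * S.card ≤ 3 * ∑ F ∈ A, pp G F := by omega
      _ = ∑ F ∈ A, 3 * pp G F := by rw [Finset.mul_sum]
      _ ≤ ∑ F ∈ A, F.card := Finset.sum_le_sum hpp
      _ ≤ _ := hsumA
  have hT : (Finset.univ \ S).card ≤ indForestNum G := by
    apply le_csSup
    · refine ⟨Nat.card V, ?_⟩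
      rintro n ⟨T, -, rfl⟩
      exact Set.ncard_le_card T
    · exact ⟨((Finset.univ \ S : Finset V) : Set V), acyclic_of_sparse G _ hS, Set.ncard_coe_finset _⟩
  rw [← Finset.compl_eq_univ_sdiff, Finset.card_compl] at hT
  have hSle := Finset.card_le_univ S
  have h4 : 2 * Fintype.card V ≤ 3 * indForestNum G := by omega
  rw [Nat.card_eq_fintype_card]
  have h5 : (2 : ℝ) * (Fintype.card V : ℝ) ≤ 3 * (indForestNum G : ℝ) := by exact_mod_cast h4
  linarith

end InducedForest
end
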